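/- For every integer r ≥ 3 there exists an r-graph F whose uniform Turán density equals C(r,2)^(−C(r,2)); that is, there exists a locally C(r,2)^(−C(r,2))-dense sequence of F-free r-graphs, and for every ε > 0 there is no locally (C(r,2)^(−C(r,2))+ε)-dense sequence of F-free r-graphs. -/

import Mathlib

namespace UTD

/-- An `r`-uniform hypergraph on a finite vertex set of naturals. -/
structure RGraph (r : ℕ) where
  verts : Finset ℕ
  edges : Finset (Finset ℕ)
  edges_subset : ∀ e ∈ edges, e ⊆ verts
  edges_card : ∀ e ∈ edges, e.card = r

/-- `F` is a subgraph of `H`: an injection of `V(F)` into `V(H)` mapping edges to edges. -/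
def IsSubgraph {r : ℕ} (F H : RGraph r) : Prop :=
  ∃ φ : ℕ → ℕ, Set.InjOn φ ↑F.verts ∧ (∀ v ∈ F.verts, φ v ∈ H.verts) ∧
    ∀ e ∈ F.edges, e.image φ ∈ H.edges

/-- `H` is `(d, ε)`-dense: every `S ⊆ V(H)` with `|S| ≥ ε|V(H)|` spans at least
`(d - ε) * C(|S|, r)` edges. -/
def IsDense {r : ℕ} (H : RGraph r) (d ε : ℝ) : Prop :=
  ∀ S ⊆ H.verts, ε * H.verts.card ≤ S.card →
    (d - ε) * (S.card.choose r : ℝ) ≤ ((H.edges.filter (fun e => e ⊆ S)).card : ℝ)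

/-- A sequence of `r`-graphs is locally `d`-dense. -/
def LocallyDense {r : ℕ} (H : ℕ → RGraph r) (d : ℝ) : Prop :=
  ∃ ε : ℕ → ℝ, (∀ n, 0 < ε n) ∧
    Filter.Tendsto ε Filter.atTop (nhds 0) ∧
    Filter.Tendsto (fun n => (H n).verts.card) Filter.atTop Filter.atTop ∧
    ∀ n, IsDense (H n) d (ε n)

/-- The role (set of ranks, 1-indexed) that the elements of `p` play within the
set `e`, with respect to the order given by `ord`. -/
def role (ord : ℕ → ℕ) (e p : Finset ℕ) : Finset ℕ :=
  p.image (fun v => (e.filter (fun w => ord w < ord v)).card + 1)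

/-- Twin pair of edges: distinct edges intersecting in exactly two vertices. -/
def IsTwin {r : ℕ} (F : RGraph r) (e f : Finset ℕ) : Prop :=
  e ∈ F.edges ∧ f ∈ F.edges ∧ e ≠ f ∧ (e ∩ f).card = 2

/-- Quasi-linear: every edge `e` has a unique twin, and all other edges meet `e`
in at most one vertex. -/
def QuasiLinear {r : ℕ} (F : RGraph r) : Prop :=
  ∀ e ∈ F.edges, ∃ f ∈ F.edges, f ≠ e ∧ (e ∩ f).card = 2 ∧
    ∀ f' ∈ F.edges, f' ≠ e → f' ≠ f → (e ∩ f').card ≤ 1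

/-- `F` with the vertex order `ord` is consistently ordered. -/
def ConsistentlyOrdered {r : ℕ} (F : RGraph r) (ord : ℕ → ℕ) : Prop :=
  ∀ e f, IsTwin F e f → role ord e (e ∩ f) = role ord f (e ∩ f)

/-- `F` is consistent: some linear order of its vertices makes it consistently ordered. -/
def Consistent {r : ℕ} (F : RGraph r) : Prop :=
  ∃ ord : ℕ → ℕ, Set.InjOn ord ↑F.verts ∧ ConsistentlyOrdered F ord

/-- `p` is the head of the edge `e`: its two smallest vertices w.r.t. `ord`. -/
def IsHead (ord : ℕ → ℕ) (e p : Finset ℕ) : Prop :=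
  p ⊆ e ∧ p.card = 2 ∧ ∀ u ∈ p, ∀ w ∈ e, w ∉ p → ord u < ord w

/-- `p` is the tail of the edge `e`: its two largest vertices w.r.t. `ord`. -/
def IsTail (ord : ℕ → ℕ) (e p : Finset ℕ) : Prop :=
  p ⊆ e ∧ p.card = 2 ∧ ∀ u ∈ p, ∀ w ∈ e, w ∉ p → ord w < ord u

/-- Head-tail-mixing: for every linear order of the vertex set there are edges
`e, f` such that the head of `e` equals the tail of `f`. -/
def HeadTailMixing {r : ℕ} (F : RGraph r) : Prop :=
  ∀ ord : ℕ → ℕ, Set.InjOn ord ↑F.verts →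
    ∃ e ∈ F.edges, ∃ f ∈ F.edges, ∃ p : Finset ℕ, IsHead ord e p ∧ IsTail ord f p

inductive Letter : Type
  | X | Y | Z
  deriving DecidableEq

/-- A descriptive sequence of order `r`: `2r - 2` letters, among which `r - 2`
are `X`, `r - 2` are `Y`, and two are `Z`. -/
def IsDescSeq (r : ℕ) (σ : Fin (2 * r - 2) → Letter) : Prop :=
  (Finset.univ.filter (fun i => σ i = Letter.X)).card = r - 2 ∧
  (Finset.univ.filter (fun i => σ i = Letter.Y)).card = r - 2 ∧
  (Finset.univ.filter (fun i => σ i = Letter.Z)).card = 2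

/-- The descriptive sequence `XX…XZZYY…Y`. -/
def headTailSeq (r : ℕ) : Fin (2 * r - 2) → Letter := fun i =>
  if (i : ℕ) < r - 2 then Letter.X
  else if (i : ℕ) < r then Letter.Z
  else Letter.Y

/-- The role (set of ranks, 1-indexed) played by the positions of the two `Z`s
within the positions carrying letters different from `avoid`. -/
def seqRole (r : ℕ) (σ : Fin (2 * r - 2) → Letter) (avoid : Letter) : Finset ℕ :=
  (Finset.univ.filter (fun i => σ i = Letter.Z)).image
    (fun i => (Finset.univ.filter (fun j => σ j ≠ avoid ∧ j < i)).card + 1)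

/-- A descriptive sequence is consistent if its two `Z`s play the same role among
the `X/Z` positions as among the `Y/Z` positions. -/
def SeqConsistent (r : ℕ) (σ : Fin (2 * r - 2) → Letter) : Prop :=
  seqRole r σ Letter.Y = seqRole r σ Letter.X

def SeqInconsistent (r : ℕ) (σ : Fin (2 * r - 2) → Letter) : Prop :=
  IsDescSeq r σ ∧ ¬ SeqConsistent r σ

/-- The descriptive sequence `σ` describes the pair of edges `{e, f}` under the
vertex order `ord`. -/
def Describes (r : ℕ) (σ : Fin (2 * r - 2) → Letter) (ord : ℕ → ℕ)
    (e f : Finset ℕ) : Prop :=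
  ∃ w : Fin (2 * r - 2) → ℕ,
    (∀ i j : Fin (2 * r - 2), i < j → ord (w i) < ord (w j)) ∧
    (∀ v : ℕ, v ∈ e ∪ f ↔ ∃ i, w i = v) ∧
    (((∀ i, w i ∈ e ↔ σ i ≠ Letter.Y) ∧ (∀ i, w i ∈ f ↔ σ i ≠ Letter.X)) ∨
     ((∀ i, w i ∈ e ↔ σ i ≠ Letter.X) ∧ (∀ i, w i ∈ f ↔ σ i ≠ Letter.Y)))

/-- A quasi-linear `r`-graph admits the descriptive sequence `σ`: there is a
linear order of its vertices in which every twin pair of edges is described by `σ`. -/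
def AdmitsSeq {r : ℕ} (F : RGraph r) (σ : Fin (2 * r - 2) → Letter) : Prop :=
  ∃ ord : ℕ → ℕ, Set.InjOn ord ↑F.verts ∧
    ∀ e f, IsTwin F e f → Describes r σ ord e f

/-- Linear hypergraph: any two distinct edges intersect in at most one vertex. -/
def LinearGraph {r : ℕ} (H : RGraph r) : Prop :=
  ∀ e ∈ H.edges, ∀ f ∈ H.edges, e ≠ f → (e ∩ f).card ≤ 1

/-- Nowhere-empty sequence of `r`-graphs. -/
def NowhereEmpty {r : ℕ} (H : ℕ → RGraph r) : Prop :=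
  ∀ c : ℝ, 0 < c → ∃ n₀ : ℕ, ∀ n ≥ n₀, ∀ S : Fin r → Finset ℕ,
    (∀ i, S i ⊆ (H n).verts) →
    (∀ i j, i ≠ j → Disjoint (S i) (S j)) →
    (∀ i, c * (H n).verts.card ≤ (S i).card) →
    ∃ e ∈ (H n).edges, ∀ i, (e ∩ S i).Nonempty

/-- A `(k, r)`-reduced hypergraph. -/
structure ReducedGraph (k r : ℕ) where
  part : Fin k → Fin k → Finset ℕ
  part_symm : ∀ i j, part i j = part j i
  part_disj : ∀ i j i' j' : Fin k, i < j → i' < j' → (i, j) ≠ (i', j') →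
    Disjoint (part i j) (part i' j')
  edges : Finset (Finset ℕ)
  edges_card : ∀ e ∈ edges, e.card = r.choose 2
  edges_struct : ∀ e ∈ edges, ∃ t : Fin r → Fin k, StrictMono t ∧
    ∀ a b : Fin r, a < b → (e ∩ part (t a) (t b)).card = 1

/-- The constituent `A_{t 0, …, t (r-1)}` of a reduced hypergraph. -/
def constituent {k r : ℕ} (H : ReducedGraph k r) (t : Fin r → Fin k) :
    Finset (Finset ℕ) :=
  H.edges.filter (fun e => ∀ a b : Fin r, a < b → (e ∩ H.part (t a) (t b)).card = 1)

/-- A reduced hypergraph has density at least `d`. -/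
def HasDensity {k r : ℕ} (H : ReducedGraph k r) (d : ℝ) : Prop :=
  ∀ t : Fin r → Fin k, StrictMono t →
    d * ∏ p ∈ Finset.univ.filter (fun p : Fin r × Fin r => p.1 < p.2),
      ((H.part (t p.1) (t p.2)).card : ℝ) ≤ ((constituent H t).card : ℝ)

/-- The `(2r-2)`-tuple of indices `t` admits the descriptive sequence `σ` in the
reduced hypergraph `H`. -/
def TupleAdmits {k r : ℕ} (H : ReducedGraph k r) (σ : Fin (2 * r - 2) → Letter)
    (t : Fin (2 * r - 2) → Fin k) : Prop :=
  ∃ tx ty : Fin r → Fin k, StrictMono tx ∧ StrictMono ty ∧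
    Set.range tx = t '' {i | σ i ≠ Letter.Y} ∧
    Set.range ty = t '' {i | σ i ≠ Letter.X} ∧
    ∃ eX ∈ constituent H tx, ∃ eY ∈ constituent H ty, (eX ∩ eY).card = 1

/-- The uniform Turán density threshold `C(r,2)^(-C(r,2))`. -/
noncomputable def piR (r : ℕ) : ℝ := ((r.choose 2 : ℝ) ^ (r.choose 2))⁻¹

section

/-- Finite Ramsey theorem for `k`-uniform hypergraphs. -/
theorem ramsey {κ : Type*} [Finite κ] (k : ℕ) : ∀ m : ℕ, ∃ N : ℕ, ∀ S : Finset ℕ, N ≤ S.card →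
    ∀ f : Finset ℕ → κ, ∃ I ⊆ S, I.card = m ∧ ∃ c : κ, ∀ t ⊆ I, t.card = k → f t = c := by
  classical
  induction k with
  | zero =>
    intro m
    refine ⟨m, fun S hS f => ?_⟩
    obtain ⟨I, hI, hIc⟩ := Finset.exists_subset_card_eq hS
    refine ⟨I, hI, hIc, f ∅, fun t _ ht0 => ?_⟩
    rw [Finset.card_eq_zero.mp ht0]
  | succ k ih =>
    have pre : ∀ l : ℕ, ∃ N : ℕ, ∀ S : Finset ℕ, N ≤ S.card → ∀ f : Finset ℕ → κ,
        ∃ I ⊆ S, I.card = l ∧ ∃ g : ℕ → κ, ∀ t ⊆ I, t.card = k + 1 → ∀ a ∈ t,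
          (∀ b ∈ t, a ≤ b) → f t = g a := by
      intro l
      induction l with
      | zero =>
        refine ⟨0, fun S _ f => ⟨∅, by simp, rfl, fun _ => f ∅, fun t ht htc => ?_⟩⟩
        have : t = ∅ := Finset.subset_empty.mp ht
        simp [this] at htc
      | succ l ihl =>
        obtain ⟨N, hN⟩ := ihl
        obtain ⟨N', hN'⟩ := ih N
        refine ⟨N' + 1, fun S hS f => ?_⟩
        have hne : S.Nonempty := by
          rw [← Finset.card_pos]; omega
        set a := S.min' hne with ha
        have haS : a ∈ S := Finset.min'_mem _ _
        obtain ⟨S', hS', hS'c, c, hc⟩ := hN' (S.erase a)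
          (by rw [Finset.card_erase_of_mem haS]; omega) (fun t => f (insert a t))
        obtain ⟨I, hI, hIc, g, hg⟩ := hN S' hS'c.ge f
        have haI : a ∉ I := fun h => by
          have := hS' (hI h)
          simp at this
        have hlt : ∀ b ∈ I, a < b := fun b hb => by
          have h1 := hS' (hI hb)
          rw [Finset.mem_erase] at h1
          exact lt_of_le_of_ne (Finset.min'_le _ _ h1.2) (Ne.symm h1.1)
        refine ⟨insert a I, ?_, by rw [Finset.card_insert_of_notMem haI, hIc],
          Function.update g a c, ?_⟩
        · intro x hx
          rw [Finset.mem_insert] at hx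
          rcases hx with rfl | hx
          · exact haS
          · exact Finset.mem_of_mem_erase (hS' (hI hx))
        · intro t ht htc b hb hmin
          by_cases hat : a ∈ t
          · have hba : b = a := by
              apply le_antisymm (hmin a hat)
              have := ht hb
              rw [Finset.mem_insert] at this
              rcases this with rfl | h
              · exact le_refl _
              · exact (hlt b h).le
            rw [hba, Function.update_self]
            have h2 := hc (t.erase a) (by
              intro x hx
              rw [Finset.mem_erase] at hx
              have := ht hx.2
              rw [Finset.mem_insert] at this
              exact hI (this.resolve_left hx.1)) (by
                rw [Finset.card_erase_of_mem hat]; omega)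
            simpa [Finset.insert_erase hat] using h2
          · have htI : t ⊆ I := fun x hx => by
              have := ht hx
              rw [Finset.mem_insert] at this
              exact this.resolve_left (fun h => hat (h ▸ hx))
            have hba : b ≠ a := fun h => hat (h ▸ hb)
            rw [Function.update_of_ne hba]
            exact hg t htI htc b hb hmin
    intro m
    have := Fintype.ofFinite κ
    obtain ⟨N, hN⟩ := pre (Fintype.card κ * m + 1)
    refine ⟨N, fun S hS f => ?_⟩
    obtain ⟨I, hI, hIc, g, hg⟩ := hN S hS f
    have hp : ∃ c ∈ (Finset.univ : Finset κ), m < (I.filter (fun x => g x = c)).card ∨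
        m ≤ (I.filter (fun x => g x = c)).card := by
      by_contra hcon
      push Not at hcon
      have h1 : I.card = ∑ c : κ, (I.filter (fun x => g x = c)).card :=
        Finset.card_eq_sum_card_fiberwise (fun x _ => Finset.mem_univ _)
      have h2 : ∑ c : κ, (I.filter (fun x => g x = c)).card ≤ ∑ c : κ, m :=
        Finset.sum_le_sum (fun c hc => (hcon c hc).1)
      simp at h2
      omega
    obtain ⟨c, -, hc⟩ := hp
    have hc' : m ≤ (I.filter (fun x => g x = c)).card := by omega
    obtain ⟨J, hJ, hJc⟩ := Finset.exists_subset_card_eq hc'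
    refine ⟨J, fun x hx => hI (Finset.mem_of_mem_filter x (hJ hx)), hJc, c, fun t ht htc => ?_⟩
    have hne : t.Nonempty := by rw [← Finset.card_pos]; omega
    have hm := Finset.min'_mem t hne
    rw [hg t (fun x hx => Finset.mem_of_mem_filter x (hJ (ht hx))) htc (t.min' hne) hm
      (fun b hb => Finset.min'_le _ _ hb)]
    exact (Finset.mem_filter.mp (hJ (ht hm))).2

end

section

/-- A small version of Arrow's theorem: transitive sign functions are dictatorial. -/
theorem arrow {Sg : Type*} [Fintype Sg] (g : (Sg → Bool) → Prop)
    (A1 : ∀ ε : Sg → Bool, g (fun σ => !(ε σ)) ↔ ¬ g ε)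
    (A2 : ∀ ε ε' δ : Sg → Bool, g ε → g ε' → (∀ σ, ε σ = ε' σ → δ σ = ε σ) → g δ) :
    ∃ σ : Sg, ∃ b : Bool, ∀ ε, g ε ↔ ε σ = b := by
  classical
  let Q : Finset Sg → (Sg → Bool) → Prop := fun D π => ∀ ε, (∀ σ ∈ D, ε σ = π σ) → g ε
  have hex : ∃ n : ℕ, ∃ D : Finset Sg, ∃ π, D.card = n ∧ Q D π := by
    have : ∃ ε, g ε := by
      by_cases h : g (fun _ => true)
      · exact ⟨_, h⟩
      · exact ⟨_, (A1 _).2 h⟩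
    obtain ⟨ε, hε⟩ := this
    refine ⟨_, Finset.univ, ε, rfl, fun ε' h => ?_⟩
    have : ε' = ε := funext fun σ => h σ (Finset.mem_univ _)
    rwa [this]
  obtain ⟨D, π, hDc, hQ⟩ := Nat.find_spec hex
  have hmin : ∀ D' π', Q D' π' → D.card ≤ D'.card := fun D' π' h => by
    rw [hDc]; exact Nat.find_min' hex ⟨D', π', rfl, h⟩
  have hne : D.Nonempty := by
    rw [Finset.nonempty_iff_ne_empty]
    rintro rfl
    have h1 : g (fun _ => true) := hQ _ (by simp)
    have h2 : g (fun _ => !true) := hQ _ (by simp)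
    exact (A1 (fun _ => true)).1 h2 h1
  obtain ⟨σ, hσ⟩ := hne
  have hD1 : Q {σ} π := by
    let ε : Sg → Bool := fun τ => if τ = σ then π τ else !(π τ)
    by_cases hg : g ε
    · intro δ hδ
      refine A2 ε π δ hg (hQ π (fun _ _ => rfl)) ?_
      intro τ hτ
      by_cases h : τ = σ
      · subst h
        rw [hδ τ (by simp)]; simp [ε]
      · simp [ε, h] at hτ
    · exfalso
      have hg' := (A1 ε).2 hg
      have hQ' : Q (D.erase σ) π := by
        intro δ hδ
        refine A2 _ (fun τ => if τ ∈ D then π τ else !(π τ)) δ hg' (hQ _ ?_) ?_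
        · intro τ hτ; simp [hτ]
        · intro τ hτ
          by_cases h : τ = σ
          · subst h
            simp [ε, hσ] at hτ
          · by_cases hD : τ ∈ D
            · rw [hδ τ (by simp [h, hD])]
              simp [ε, h]
            · simp [ε, h, hD] at hτ
      have := hmin _ _ hQ'
      rw [Finset.card_erase_of_mem hσ] at this
      have := Finset.card_pos.mpr ⟨σ, hσ⟩
      omega
  refine ⟨σ, π σ, fun ε => ⟨fun h => ?_, fun h => hD1 ε (by simpa using h)⟩⟩
  by_contra hcon
  refine (A1 ε).1 (hD1 _ ?_) h
  intro τ hτ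
  rw [Finset.mem_singleton] at hτ
  subst hτ
  cases h1 : ε τ <;> cases h2 : π τ <;> simp_all

/-- The sorted list of a pair of entries in each of `s` consecutive blocks. -/
theorem grid_ramsey {Sg L : Type*} [Fintype Sg] [Nonempty Sg] (q : ℕ) (hq : 3 ≤ q)
    (lam : Sg → L → Fin q) (hlam : ∀ σ, Function.Injective (lam σ)) :
    ∃ N1 : ℕ, ∀ ord : (Sg → ℕ) → ℕ, Set.InjOn ord {x | ∀ σ, x σ < N1} →
      ∃ u : L → Sg → ℕ, (∀ a σ, u a σ < N1) ∧
        (∀ σ a b, lam σ a < lam σ b → u a σ < u b σ) ∧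
        ∃ σ, (∀ a b, lam σ a < lam σ b → ord (u a) < ord (u b)) ∨
             (∀ a b, lam σ a < lam σ b → ord (u b) < ord (u a)) := by
  classical
  set s := Fintype.card Sg with hs
  let e : Sg ≃ Fin s := Fintype.equivFin Sg
  obtain ⟨N1, hN1⟩ := ramsey (κ := (Sg → Bool) → Bool) (s * 2) (s * q)
  refine ⟨N1, fun ord hord => ?_⟩
  let idx : Sg → Bool → Fin (s * 2) := fun σ b =>
    ⟨(e σ : ℕ) * 2 + (if b then 0 else 1), by
      have := (e σ).2
      split_ifs <;> omega⟩
  let col : Finset ℕ → (Sg → Bool) → Bool := fun t ε =>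
    if h : t.card = s * 2 then
      decide (ord (fun σ => t.orderEmbOfFin h (idx σ (ε σ))) <
        ord (fun σ => t.orderEmbOfFin h (idx σ (!(ε σ)))))
    else false
  obtain ⟨I, hI, hIc, c, hc⟩ := hN1 (Finset.range N1) (by simp) col
  let h := I.orderEmbOfFin hIc
  let B : Sg → Fin q → ℕ := fun σ j => h ⟨(e σ : ℕ) * q + j, by
    have h1 := (e σ).2
    have h2 := j.2
    calc (e σ : ℕ) * q + j < (e σ : ℕ) * q + q := by omega
      _ = ((e σ : ℕ) + 1) * q := by ring
      _ ≤ s * q := Nat.mul_le_mul_right _ h1⟩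
  have hBlt : ∀ σ i j, B σ i < B σ j ↔ i < j := fun σ i j => by
    simp only [B, h, OrderEmbedding.lt_iff_lt, Fin.mk_lt_mk]
    rw [Fin.lt_def]; omega
  have hBlk : ∀ σ τ i j, e σ < e τ → B σ i < B τ j := fun σ τ i j hst => by
    simp only [B, h, OrderEmbedding.lt_iff_lt, Fin.mk_lt_mk]
    have h1 : (e σ : ℕ) + 1 ≤ e τ := hst
    have h2 := i.2
    calc (e σ : ℕ) * q + i < (e σ : ℕ) * q + q := by omega
      _ = ((e σ : ℕ) + 1) * q := by ring
      _ ≤ (e τ : ℕ) * q := Nat.mul_le_mul_right _ h1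
      _ ≤ _ := Nat.le_add_right _ _
  have hBI : ∀ σ i, B σ i ∈ I := fun σ i => Finset.orderEmbOfFin_mem _ _ _
  have hBN : ∀ σ i, B σ i < N1 := fun σ i => Finset.mem_range.mp (hI (hBI σ i))
  let pt : (Sg → Fin q) → Sg → ℕ := fun x σ => B σ (x σ)
  have key : ∀ x y : Sg → Fin q, (∀ σ, x σ ≠ y σ) →
      (ord (pt x) < ord (pt y) ↔ c (fun σ => decide (x σ < y σ)) = true) := by
    intro x y hxy
    let w : Fin (s * 2) → ℕ := fun k =>
      let σ := e.symm ⟨(k : ℕ) / 2, by omega⟩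
      if (k : ℕ) % 2 = 0 then B σ (min (x σ) (y σ)) else B σ (max (x σ) (y σ))
    have hw : StrictMono w := by
      intro k k' hkk
      simp only [w]
      have hkk' : (k : ℕ) < k' := hkk
      by_cases hd : (k : ℕ) / 2 = (k' : ℕ) / 2
      · have h1 : (k : ℕ) % 2 = 0 := by omega
        have h2 : ¬ (k' : ℕ) % 2 = 0 := by omega
        rw [if_pos h1, if_neg h2]
        simp only [hd]
        rw [hBlt]
        exact min_lt_max.mpr (hxy _)
      · have hlt : e (e.symm ⟨(k : ℕ) / 2, by omega⟩) < e (e.symm ⟨(k' : ℕ) / 2, by omega⟩) := by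
          rw [Equiv.apply_symm_apply, Equiv.apply_symm_apply, Fin.mk_lt_mk]
          omega
        split_ifs <;> exact hBlk _ _ _ _ hlt
    let t := Finset.univ.image w
    have htc : t.card = s * 2 := by
      rw [Finset.card_image_of_injective _ hw.injective]; simp
    have htI : t ⊆ I := by
      intro z hz
      obtain ⟨k, -, rfl⟩ := Finset.mem_image.mp hz
      simp only [w]
      split_ifs <;> exact hBI _ _
    have hemb : w = t.orderEmbOfFin htc :=
      Finset.orderEmbOfFin_unique htc (fun k => Finset.mem_image_of_mem _ (Finset.mem_univ _)) hw
    have hwt : ∀ σ, w (idx σ true) = B σ (min (x σ) (y σ)) := by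
      intro σ
      have hd : ((e σ : ℕ) * 2 + 0) / 2 = e σ := by omega
      simp [w, idx]
    have hwf : ∀ σ, w (idx σ false) = B σ (max (x σ) (y σ)) := by
      intro σ
      have hd : ((e σ : ℕ) * 2 + 1) / 2 = e σ := by omega
      have hm : ((e σ : ℕ) * 2 + 1) % 2 = 1 := by omega
      simp [w, idx, hd, hm]
    rw [← hc t htI htc]
    simp only [col, htc, dif_pos]
    rw [← hemb, decide_eq_true_iff]
    have e1 : (fun σ => w (idx σ (decide (x σ < y σ)))) = pt x := by
      funext σ
      by_cases hlt : x σ < y σ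
      · simp only [hlt, decide_true, hwt, pt, min_eq_left hlt.le]
      · have := lt_of_le_of_ne (not_lt.mp hlt) (hxy σ).symm
        simp only [hlt, decide_false, hwf, pt, max_eq_left this.le]
    have e2 : (fun σ => w (idx σ (!decide (x σ < y σ)))) = pt y := by
      funext σ
      by_cases hlt : x σ < y σ
      · simp only [hlt, decide_true, Bool.not_true, hwf, pt, max_eq_right hlt.le]
      · have := lt_of_le_of_ne (not_lt.mp hlt) (hxy σ).symm
        simp only [hlt, decide_false, Bool.not_false, hwt, pt, min_eq_right this.le]
    rw [e1, e2]
  have hptinj : ∀ x y : Sg → Fin q, (∀ σ, x σ ≠ y σ) → ord (pt x) ≠ ord (pt y) := by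
    intro x y hxy heq
    have := hord (fun σ => hBN _ _) (fun σ => hBN _ _) heq
    obtain ⟨σ⟩ := (inferInstance : Nonempty Sg)
    have h1 := congrFun this σ
    rcases lt_or_gt_of_ne (hxy σ) with hh | hh
    · exact absurd h1 ((hBlt σ _ _).2 hh).ne
    · exact absurd h1 ((hBlt σ _ _).2 hh).ne'
  let i0 : Fin q := ⟨0, by omega⟩
  let i1 : Fin q := ⟨1, by omega⟩
  let i2 : Fin q := ⟨2, by omega⟩
  have h01 : i0 < i1 := by simp [i0, i1]
  have h02 : i0 < i2 := by simp [i0, i2]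
  have h12 : i1 < i2 := by simp [i1, i2]
  obtain ⟨σ, b, hσ⟩ := arrow (fun ε => c ε = true) (by
    intro ε
    let x : Sg → Fin q := fun σ => if ε σ then i0 else i1
    let y : Sg → Fin q := fun σ => if ε σ then i1 else i0
    have hxy : ∀ σ, x σ ≠ y σ := fun σ => by
      simp only [x, y]; split_ifs
      · exact h01.ne
      · exact h01.ne'
    have k1 := key x y hxy
    have k2 := key y x (fun σ => (hxy σ).symm)
    have e1 : (fun σ => decide (x σ < y σ)) = ε := by
      funext σ
      by_cases h : ε σ = true
      · simp [x, y, h, h01]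
      · simp only [x, y, h]; simp [h01.le]
    have e2 : (fun σ => decide (y σ < x σ)) = fun σ => !(ε σ) := by
      funext σ
      by_cases h : ε σ = true
      · simp [x, y, h, h01.le]
      · simp only [x, y, h]; simp [h01]
    rw [e1] at k1
    rw [e2] at k2
    have := hptinj x y hxy
    rw [← k1, ← k2]
    omega) (by
    intro ε ε' δ h1 h2 hδ
    let x : Sg → Fin q := fun σ => match ε σ, ε' σ, δ σ with
      | true, true, _ => i0
      | false, false, _ => i2
      | true, false, true => i0
      | true, false, false => i1
      | false, true, true => i1
      | false, true, false => i2
    let y : Sg → Fin q := fun σ => match ε σ, ε' σ, δ σ with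
      | true, true, _ => i1
      | false, false, _ => i1
      | true, false, true => i2
      | true, false, false => i2
      | false, true, true => i0
      | false, true, false => i0
    let z : Sg → Fin q := fun σ => match ε σ, ε' σ, δ σ with
      | true, true, _ => i2
      | false, false, _ => i0
      | true, false, true => i1
      | true, false, false => i0
      | false, true, true => i2
      | false, true, false => i1
    have hall : ∀ σ, x σ ≠ y σ ∧ y σ ≠ z σ ∧ x σ ≠ z σ ∧ decide (x σ < y σ) = ε σ ∧
        decide (y σ < z σ) = ε' σ ∧ decide (x σ < z σ) = δ σ := by
      intro σ
      have := hδ σ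
      cases h1 : ε σ <;> cases h2 : ε' σ <;> cases h3 : δ σ <;>
        simp only [h1, h2, h3, x, y, z] at this ⊢ <;>
        simp_all [h01.ne, h02.ne, h12.ne, h01.ne', h02.ne', h12.ne', h01.le, h02.le, h12.le]
    have k1 := (key x y (fun σ => (hall σ).1))
    have k2 := (key y z (fun σ => (hall σ).2.1))
    have k3 := (key x z (fun σ => (hall σ).2.2.1))
    rw [show (fun σ => decide (x σ < y σ)) = ε from funext fun σ => (hall σ).2.2.2.1] at k1
    rw [show (fun σ => decide (y σ < z σ)) = ε' from funext fun σ => (hall σ).2.2.2.2.1] at k2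
    rw [show (fun σ => decide (x σ < z σ)) = δ from funext fun σ => (hall σ).2.2.2.2.2] at k3
    exact k3.1 (lt_trans (k1.2 h1) (k2.2 h2)))
  refine ⟨fun a => pt (fun τ => lam τ a), fun a τ => hBN _ _, fun τ a b hab => (hBlt _ _ _).2 hab,
    σ, ?_⟩
  cases b
  · right
    intro a b hab
    have hne : b ≠ a := fun h => by subst h; exact lt_irrefl _ hab
    refine (key _ _ (fun τ h => hne (hlam τ h))).2 ((hσ _).2 ?_)
    simp [hab.le]
  · left
    intro a b hab
    have hne : a ≠ b := fun h => by subst h; exact lt_irrefl _ hab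
    refine (key _ _ (fun τ h => hne (hlam τ h))).2 ((hσ _).2 ?_)
    simp [hab]

end

section

/-- Labels of the vertices of a twin pair of edges. -/
abbrev Lab (m : ℕ) := Fin 2 ⊕ (Bool × Fin m)

/-- The two edges of a labelled twin pair. -/
def EE (m : ℕ) (b : Bool) : Finset (Lab m) :=
  Finset.univ.image (Sum.map id (Prod.mk b) : Fin 2 ⊕ Fin m → Lab m)

theorem card_lab (m : ℕ) : Fintype.card (Lab m) = 2 * m + 2 := by
  simp [Lab]; ring

theorem emb_inj (m : ℕ) (b : Bool) :
    Function.Injective (Sum.map id (Prod.mk b) : Fin 2 ⊕ Fin m → Lab m) :=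
  Function.Injective.sumMap Function.injective_id (Prod.mk_right_injective b)

theorem card_EE (m : ℕ) (b : Bool) : (EE m b).card = m + 2 := by
  rw [EE, Finset.card_image_of_injective _ (emb_inj m b)]
  simp; ring

theorem inl_mem_EE (m : ℕ) (b : Bool) (z : Fin 2) : (Sum.inl z : Lab m) ∈ EE m b :=
  Finset.mem_image.mpr ⟨Sum.inl z, Finset.mem_univ _, rfl⟩

theorem inr_mem_EE (m : ℕ) (b c : Bool) (j : Fin m) :
    (Sum.inr (c, j) : Lab m) ∈ EE m b ↔ c = b := by
  simp [EE]; tauto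

/-- Rank of a common vertex in one of the two edges. -/
def rk {m : ℕ} {β : Type*} [LinearOrder β] (b : Bool) (x : Lab m → β) (z : Fin 2) : ℕ :=
  ((EE m b).filter (fun a => x a < x (Sum.inl z))).card

/-- The common vertices of a twin pair do not have the same ranks. -/
def Incons {m : ℕ} {β : Type*} [LinearOrder β] (x : Lab m → β) : Prop :=
  ∃ z : Fin 2, rk true x z ≠ rk false x z

theorem Incons.congr {m : ℕ} {β γ : Type*} [LinearOrder β] [LinearOrder γ] {x : Lab m → β}
    {y : Lab m → γ} (hx : Incons x) (h : ∀ a b, x a < x b ↔ y a < y b) : Incons y := by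
  obtain ⟨z, hz⟩ := hx
  refine ⟨z, ?_⟩
  simpa only [rk, h] using hz

theorem rk_rev {m : ℕ} {β γ : Type*} [LinearOrder β] [LinearOrder γ] {x : Lab m → β}
    {y : Lab m → γ} (hx : Function.Injective x) (h : ∀ a b, x a < x b ↔ y b < y a)
    (b : Bool) (z : Fin 2) : rk b x z + rk b y z + 1 = m + 2 := by
  classical
  rw [← card_EE m b]
  have h1 := Finset.card_filter_add_card_filter_not (s := EE m b)
    (fun a => x a < x (Sum.inl z))
  have h2 : (EE m b).filter (fun a => ¬ x a < x (Sum.inl z)) =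
      insert (Sum.inl z) ((EE m b).filter (fun a => y a < y (Sum.inl z))) := by
    ext a
    simp only [Finset.mem_filter, Finset.mem_insert, ← h]
    constructor
    · rintro ⟨ha, hn⟩
      rcases (not_lt.mp hn).lt_or_eq with hh | hh
      · exact Or.inr ⟨ha, hh⟩
      · exact Or.inl (hx hh).symm
    · rintro (rfl | ⟨ha, hn⟩)
      · exact ⟨inl_mem_EE m b z, lt_irrefl _⟩
      · exact ⟨ha, hn.asymm⟩
  rw [h2, Finset.card_insert_of_notMem (by simp)] at h1
  unfold rk
  omega

theorem Incons.rev {m : ℕ} {β γ : Type*} [LinearOrder β] [LinearOrder γ] {x : Lab m → β}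
    {y : Lab m → γ} (hI : Incons x) (hx : Function.Injective x)
    (h : ∀ a b, x a < x b ↔ y b < y a) : Incons y := by
  obtain ⟨z, hz⟩ := hI
  refine ⟨z, ?_⟩
  have h1 := rk_rev hx h true z
  have h2 := rk_rev hx h false z
  omega

/-- Inconsistent order types. -/
abbrev Sg (m : ℕ) := {lam : Lab m → Fin (2 * m + 2) // Function.Injective lam ∧ Incons lam}

theorem Sg_nonempty (m : ℕ) (hm : 1 ≤ m) : Nonempty (Sg m) := by
  classical
  let f : Lab m → Fin (2 * m + 2) := fun a => match a with
    | Sum.inl z => ⟨m + z, by omega⟩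
    | Sum.inr (true, j) => ⟨j, by omega⟩
    | Sum.inr (false, j) => ⟨m + 2 + j, by omega⟩
  refine ⟨⟨f, ?_, 0, ?_⟩⟩
  · rintro (z | ⟨c, j⟩) (z' | ⟨c', j'⟩) h
    · simp only [f, Fin.mk.injEq] at h
      rw [Fin.ext_iff.mpr (show (z : ℕ) = z' by omega)]
    · cases c' <;> simp only [f, Fin.mk.injEq] at h <;> omega
    · cases c <;> simp only [f, Fin.mk.injEq] at h <;> omega
    · cases c <;> cases c' <;> simp only [f, Fin.mk.injEq] at h
      · rw [Fin.ext_iff.mpr (show (j : ℕ) = j' by omega)]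
      · omega
      · omega
      · rw [Fin.ext_iff.mpr (show (j : ℕ) = j' by omega)]
  · have h1 : rk false f 0 = 0 := by
      unfold rk
      rw [Finset.card_eq_zero, Finset.filter_eq_empty_iff]
      rintro (z | ⟨c, j⟩) ha
      · simp only [f, Fin.mk_lt_mk]; simp
      · rw [inr_mem_EE] at ha
        subst ha
        simp only [f, Fin.mk_lt_mk]; simp; omega
    have h2 : 0 < rk true f 0 := by
      unfold rk
      rw [Finset.card_pos]
      refine ⟨Sum.inr (true, ⟨0, by omega⟩), ?_⟩
      rw [Finset.mem_filter, inr_mem_EE]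
      refine ⟨rfl, ?_⟩
      simp only [f, Fin.mk_lt_mk]; simp; omega
    omega

/-- The order type of an injective function. -/
theorem exists_rank {α β : Type*} [Fintype α] [LinearOrder β] (n : ℕ) (hn : Fintype.card α = n)
    (y : α → β) (hy : Function.Injective y) :
    ∃ o : α → Fin n, Function.Injective o ∧ ∀ a b, o a < o b ↔ y a < y b := by
  classical
  subst hn
  have hlt : ∀ a, (Finset.univ.filter (fun c => y c < y a)).card < Fintype.card α := fun a =>
    Finset.card_lt_univ_of_notMem (x := a) (by simp)
  have hmono : ∀ a b, y a < y b → (Finset.univ.filter (fun c => y c < y a)).card <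
      (Finset.univ.filter (fun c => y c < y b)).card := fun a b hab => by
    refine Finset.card_lt_card ⟨?_, ?_⟩
    · intro c hc
      simp only [Finset.mem_filter, Finset.mem_univ, true_and] at hc ⊢
      exact hc.trans hab
    · intro hcon
      have := hcon (show a ∈ _ by simpa using hab)
      simp at this
  refine ⟨fun a => ⟨_, hlt a⟩, ?_, ?_⟩
  · intro a b hab
    simp only [Fin.mk.injEq] at hab
    rcases lt_trichotomy (y a) (y b) with h | h | h
    · exact absurd hab (hmono a b h).ne
    · exact hy h
    · exact absurd hab (hmono b a h).ne'
  · intro a b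
    rw [Fin.mk_lt_mk]
    refine ⟨fun h => ?_, hmono a b⟩
    by_contra hcon
    rcases (not_lt.mp hcon).lt_or_eq with h' | h'
    · exact absurd h (hmono b a h').asymm
    · rw [hy h'] at h; exact lt_irrefl _ h

/-- Greedy selection of a conflict-free family hitting everything. -/
theorem greedy {A Om : Type*} [Fintype A] [DecidableEq A] (bad : A → Om → Prop)
    (conf : A → A → Prop) (Ω : Finset Om) (B D : ℕ) (hB : 0 < B)
    (hbad : ∀ w ∈ Ω, ∃ S : Finset A, B ≤ S.card ∧ ∀ a ∈ S, bad a w)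
    (hconf : ∀ a, ∃ S : Finset A, S.card ≤ D ∧ ∀ b, conf a b → b ∈ S) (T : ℕ) :
    2 * T * D ≤ B → ∃ (L : Finset A) (Ω' : Finset Om), L.card ≤ T ∧ Ω' ⊆ Ω ∧
      (∀ w ∈ Ω, w ∉ Ω' → ∃ a ∈ L, bad a w) ∧
      (∀ a ∈ L, ∀ b ∈ L, a ≠ b → ¬ conf a b ∨ ¬ conf b a) ∧
      (Ω'.card : ℝ) ≤ Ω.card * (1 - B / (2 * Fintype.card A)) ^ T := by
  classical
  induction T with
  | zero => exact fun _ => ⟨∅, Ω, by simp, subset_rfl, by simp +contextual, by simp, by simp⟩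
  | succ T ih =>
    intro hT
    obtain ⟨L, Ω', hLc, hΩ', hcov, hnc, hcard⟩ := ih (by nlinarith)
    choose S hS hSb using hbad
    choose C hC hCb using hconf
    rcases Ω'.eq_empty_or_nonempty with h0 | ⟨w0, hw0⟩
    · obtain ⟨S0, hS0⟩ : True := trivial
      refine ⟨L, ∅, by omega, by simp, by subst h0; simpa using hcov, hnc, ?_⟩
      rcases Ω.eq_empty_or_nonempty with h1 | ⟨w1, hw1⟩
      · simp [h1]
      · have hBA : B ≤ Fintype.card A := (hS w1 hw1).trans (Finset.card_le_univ _)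
        have : (B : ℝ) / (2 * Fintype.card A) ≤ 1 := by
          apply div_le_one_of_le₀ _ (by positivity)
          have : (B : ℝ) ≤ Fintype.card A := by exact_mod_cast hBA
          linarith
        simp only [Finset.card_empty, Nat.cast_zero]
        have : (0 : ℝ) ≤ 1 - B / (2 * Fintype.card A) := by linarith
        positivity
    · have hBA : B ≤ Fintype.card A := (hS w0 (hΩ' hw0)).trans (Finset.card_le_univ _)
      have hA : 0 < Fintype.card A := by omega
      let X := L.biUnion C
      have hX : X.card ≤ T * D :=
        (Finset.card_biUnion_le_card_mul _ _ _ (fun a _ => hC a)).trans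
          (Nat.mul_le_mul_right _ hLc)
      -- double counting
      have hdc : Ω'.card * B ≤ 2 * ∑ a ∈ Finset.univ \ X, (Ω'.filter (bad a)).card := by
        have e1 : ∑ a ∈ Finset.univ \ X, (Ω'.filter (bad a)).card =
            ∑ w ∈ Ω', ((Finset.univ \ X).filter (fun a => bad a w)).card :=
          Finset.sum_card_bipartiteAbove_eq_sum_card_bipartiteBelow _
        rw [e1, Finset.mul_sum, ← smul_eq_mul, ← Finset.sum_const]
        refine Finset.sum_le_sum fun w hw => ?_
        have h1 : S w (hΩ' hw) \ X ⊆ (Finset.univ \ X).filter (fun a => bad a w) := by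
          intro a ha
          rw [Finset.mem_sdiff] at ha
          simp only [Finset.mem_filter, Finset.mem_sdiff, Finset.mem_univ, true_and]
          exact ⟨ha.2, hSb w _ a ha.1⟩
        have h2 := Finset.card_le_card h1
        have h3 := Finset.le_card_sdiff X (S w (hΩ' hw))
        have h4 := hS w (hΩ' hw)
        have h5 : 2 * (T + 1) * D = 2 * (T * D) + 2 * D := by ring
        omega
      obtain ⟨a, ha, hab⟩ : ∃ a ∈ Finset.univ \ X,
          Ω'.card * B ≤ 2 * (Fintype.card A * (Ω'.filter (bad a)).card) := by
        by_contra hcon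
        push Not at hcon
        have hΩpos : 0 < Ω'.card := Finset.card_pos.mpr ⟨w0, hw0⟩
        by_cases hne : (Finset.univ \ X).Nonempty
        · have := Finset.sum_lt_sum_of_nonempty hne hcon
          rw [← Finset.mul_sum, ← Finset.mul_sum, Finset.sum_const, smul_eq_mul] at this
          have h6 : (Finset.univ \ X).card ≤ Fintype.card A := Finset.card_le_univ _
          have h7 : (Finset.univ \ X).card * (Ω'.card * B) ≤ Fintype.card A * (Ω'.card * B) :=
            Nat.mul_le_mul_right _ h6
          have h8 : Fintype.card A * (Ω'.card * B) ≤
            Fintype.card A * (2 * ∑ a ∈ Finset.univ \ X, (Ω'.filter (bad a)).card) :=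
            Nat.mul_le_mul_left _ hdc
          have hc : 0 < (Finset.univ \ X).card := Finset.card_pos.mpr hne
          -- average
          have h9 : ∑ a ∈ Finset.univ \ X, 2 * (Fintype.card A * (Ω'.filter (bad a)).card) =
            Fintype.card A * (2 * ∑ a ∈ Finset.univ \ X, (Ω'.filter (bad a)).card) := by
            rw [Finset.mul_sum, Finset.mul_sum]
            exact Finset.sum_congr rfl fun _ _ => by ring
          have h10 := Finset.sum_lt_sum_of_nonempty hne hcon
          rw [h9, Finset.sum_const, smul_eq_mul] at h10
          omega
        · rw [Finset.not_nonempty_iff_eq_empty] at hne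
          rw [hne] at hdc
          have h0 : 0 < Ω'.card * B := Nat.mul_pos hΩpos hB
          rw [Finset.sum_empty] at hdc
          omega
      refine ⟨insert a L, Ω'.filter (fun w => ¬ bad a w), ?_, ?_, ?_, ?_, ?_⟩
      · exact (Finset.card_insert_le _ _).trans (by omega)
      · exact (Finset.filter_subset _ _).trans hΩ'
      · intro w hw hw'
        by_cases hwΩ : w ∈ Ω'
        · refine ⟨a, by simp, ?_⟩
          by_contra hb
          exact hw' (by simp [hwΩ, hb])
        · obtain ⟨b, hb, hbw⟩ := hcov w hw hwΩ
          exact ⟨b, by simp [hb], hbw⟩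
      · have haX : ∀ b ∈ L, ¬ conf b a := by
          intro b hb hcon
          rw [Finset.mem_sdiff] at ha
          exact ha.2 (Finset.mem_biUnion.mpr ⟨b, hb, hCb b a hcon⟩)
        intro b hb c hc hbc
        rw [Finset.mem_insert] at hb hc
        rcases hb with rfl | hb <;> rcases hc with rfl | hc
        · exact absurd rfl hbc
        · exact Or.inr (haX c hc)
        · exact Or.inl (haX b hb)
        · exact hnc b hb c hc hbc
      · have h1 := Finset.card_filter_add_card_filter_not (s := Ω') (bad a)
        have h2 : ((Ω'.filter (bad a)).card : ℝ) + (Ω'.filter (fun w => ¬ bad a w)).card = Ω'.card := by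
          exact_mod_cast h1
        have h3 : (Ω'.card : ℝ) * B ≤ 2 * (Fintype.card A * (Ω'.filter (bad a)).card) := by
          exact_mod_cast hab
        have hA' : (0 : ℝ) < Fintype.card A := by exact_mod_cast hA
        have h4 : (Ω'.card : ℝ) * (B / (2 * Fintype.card A)) ≤ (Ω'.filter (bad a)).card := by
          rw [← mul_div_assoc, div_le_iff₀ (by positivity)]
          linarith
        have h5 : (B : ℝ) / (2 * Fintype.card A) ≤ 1 := by
          apply div_le_one_of_le₀ _ (by positivity)
          have : (B : ℝ) ≤ Fintype.card A := by exact_mod_cast hBA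
          linarith
        have h6 : ((Ω'.filter (fun w => ¬ bad a w)).card : ℝ) ≤
            Ω'.card * (1 - B / (2 * Fintype.card A)) := by linarith
        refine h6.trans ?_
        rw [pow_succ, ← mul_assoc]
        exact mul_le_mul_of_nonneg_right hcard (by linarith)

end

section

theorem card_two_fixed {I : Type*} [Fintype I] [DecidableEq I] (N : ℕ) (a b : I) (hab : a ≠ b)
    (c d : Fin N) :
    (Finset.univ.filter (fun y : I → Fin N => y a = c ∧ y b = d)).card * N ^ 2 ≤
      N ^ Fintype.card I := by
  classical
  have h1 : ((Finset.univ.filter (fun y : I → Fin N => y a = c ∧ y b = d)) ×ˢ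
      (Finset.univ : Finset (Fin N × Fin N))).card ≤ (Finset.univ : Finset (I → Fin N)).card := by
    refine Finset.card_le_card_of_injOn
      (fun p => Function.update (Function.update p.1 a p.2.1) b p.2.2) (fun _ _ => Finset.mem_coe.mpr (Finset.mem_univ _)) ?_
    rintro ⟨y, s, t⟩ hy ⟨y', s', t'⟩ hy' h
    simp only [Finset.coe_product, Set.mem_prod, Finset.mem_coe, Finset.mem_filter,
      Finset.mem_univ, true_and, and_true] at hy hy'
    simp only at h
    have hb := congrFun h b
    have ha := congrFun h a
    simp only [Function.update_self, Function.update_of_ne hab] at ha hb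
    subst ha hb
    congr 1
    funext i
    by_cases hia : i = a
    · subst hia; rw [hy.1, hy'.1]
    · by_cases hib : i = b
      · subst hib; rw [hy.2, hy'.2]
      · have := congrFun h i
        simpa only [Function.update_of_ne hia, Function.update_of_ne hib] using this
  simpa [Finset.card_product, sq] using h1

theorem card_fixed {I J : Type*} [Fintype I] [DecidableEq I] [Fintype J] [DecidableEq J] (N : ℕ)
    (u : I → J) (hu : Function.Injective u) (y : I → Fin N) :
    (Finset.univ.filter (fun x : J → Fin N => ∀ i, x (u i) = y i)).card * N ^ Fintype.card I ≤
      N ^ Fintype.card J := by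
  classical
  have h1 : ((Finset.univ.filter (fun x : J → Fin N => ∀ i, x (u i) = y i)) ×ˢ
      (Finset.univ : Finset (I → Fin N))).card ≤ (Finset.univ : Finset (J → Fin N)).card := by
    refine Finset.card_le_card_of_injOn
      (fun p => Function.extend u p.2 p.1) (fun _ _ => Finset.mem_coe.mpr (Finset.mem_univ _)) ?_
    rintro ⟨x, z⟩ hx ⟨x', z'⟩ hx' h
    simp only [Finset.coe_product, Set.mem_prod, Finset.mem_coe, Finset.mem_filter,
      Finset.mem_univ, true_and, and_true] at hx hx'
    simp only at h
    have hz : z = z' := by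
      funext i
      have := congrFun h (u i)
      simpa only [hu.extend_apply] using this
    subst hz
    congr 1
    funext j
    by_cases hj : ∃ i, u i = j
    · obtain ⟨i, rfl⟩ := hj
      rw [hx, hx']
    · have := congrFun h j
      simpa only [Function.extend_apply' _ _ _ hj] using this
  simpa [Finset.card_product] using h1

theorem numeric_choice (g P q : ℕ) (hP : 0 < P) : ∃ k : ℕ, 0 < k ∧ 2 * P * q ^ 4 ≤ k ∧
    ∀ M : ℕ, M = g * k ^ 2 →
      ((M : ℝ) ^ M) * (1 - 1 / (2 * P)) ^ (k ^ 3) < 1 := by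
  obtain ⟨j, hj⟩ := exists_nat_gt ((g : ℝ) * (g + 4) * (2 * P) + 2 * P * q ^ 4)
  have hP' : (1 : ℝ) ≤ P := by exact_mod_cast hP
  have hj1 : (g : ℝ) * (g + 4) * (2 * P) < j := lt_of_le_of_lt (by
    have : (0:ℝ) ≤ 2 * P * q ^ 4 := by positivity
    linarith) hj
  have hj2 : 2 * (P : ℝ) * q ^ 4 < j := lt_of_le_of_lt (by
    have : (0:ℝ) ≤ (g : ℝ) * (g + 4) * (2 * P) := by positivity
    linarith) hj
  have hj0 : 0 < j := by
    have : (0 : ℝ) < j := lt_of_le_of_lt (by positivity) hj2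
    exact_mod_cast this
  have hj0' : (1 : ℝ) ≤ j := by exact_mod_cast hj0
  refine ⟨j ^ 2, by positivity, ?_, ?_⟩
  · have h1 : 2 * P * q ^ 4 < j := by exact_mod_cast hj2
    nlinarith
  · intro M hM
    have hbase : (0 : ℝ) ≤ 1 - 1 / (2 * P) := by
      have : 1 / (2 * (P : ℝ)) ≤ 1 := by
        rw [div_le_one (by positivity)]; linarith
      linarith
    rcases Nat.eq_zero_or_pos g with hg | hg
    · subst hg
      simp only [zero_mul] at hM
      subst hM
      simp only [Nat.cast_zero, pow_zero, one_mul]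
      refine pow_lt_one₀ hbase ?_ (by positivity)
      have : 0 < 1 / (2 * (P : ℝ)) := by positivity
      linarith
    · have hg' : (1 : ℝ) ≤ g := by exact_mod_cast hg
      have hMpos : (0 : ℝ) < M := by subst hM; positivity
      have e1 : ((M : ℝ)) ^ M = Real.exp (M * Real.log M) := by
        rw [mul_comm, Real.exp_mul, Real.exp_log hMpos, Real.rpow_natCast]
      have e2 : (1 - 1 / (2 * (P : ℝ))) ^ ((j ^ 2) ^ 3) ≤
          Real.exp (-(1 / (2 * P)) * ((j ^ 2) ^ 3 : ℕ)) := by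
        rw [Real.exp_mul, Real.rpow_natCast]
        refine pow_le_pow_left₀ hbase ?_ _
        have := Real.add_one_le_exp (-(1 / (2 * (P : ℝ))))
        linarith
      have e3 : Real.log M ≤ g + 4 * j := by
        have : (M : ℝ) = g * (j : ℝ) ^ 4 := by
          subst hM; push_cast; ring
        rw [this, Real.log_mul (by positivity) (by positivity), Real.log_pow]
        have h1 := Real.log_le_self (show (0:ℝ) ≤ g by positivity)
        have h2 := Real.log_le_self (show (0:ℝ) ≤ j by positivity)
        push_cast
        linarith
      refine lt_of_le_of_lt (mul_le_mul_of_nonneg_left e2 (by positivity)) ?_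
      rw [e1, ← Real.exp_add, Real.exp_lt_one_iff]
      have h3 : (M : ℝ) * Real.log M ≤ M * (g + 4 * j) :=
        mul_le_mul_of_nonneg_left e3 hMpos.le
      have h4 : (M : ℝ) = g * (j : ℝ) ^ 4 := by
          subst hM; push_cast; ring
      have h5 : (g : ℝ) * (g + 4 * j) ≤ g * (g + 4) * j := by nlinarith [mul_nonneg (show (0:ℝ) ≤ g by positivity) (show (0:ℝ) ≤ g by positivity)]
      have h6 : (g : ℝ) * (g + 4) < (1 / (2 * P)) * j := by
        rw [one_div, inv_mul_eq_div, lt_div_iff₀ (by positivity)]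
        exact hj1
      have h7 : (g : ℝ) * (g + 4 * j) < (1 / (2 * P)) * j * j :=
        lt_of_le_of_lt h5 (mul_lt_mul_of_pos_right h6 (by positivity))
      have h8 : (g : ℝ) * (g + 4 * j) * j ^ 4 < (1 / (2 * P)) * j * j * j ^ 4 :=
        mul_lt_mul_of_pos_right h7 (by positivity)
      push_cast
      rw [h4] at h3 ⊢
      nlinarith

theorem config_aux (m : ℕ) {G PP : Type} [Fintype G] [DecidableEq G] [Fintype PP]
    [DecidableEq PP] [Nonempty PP] (uu : PP → Lab m → G) (hPinj : ∀ p, Function.Injective (uu p))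
    (grid : ∀ w : G → ℕ, Function.Injective w → ∃ u : PP, Incons (w ∘ uu u)) :
    ∃ (N : ℕ) (L : Finset (PP × (Lab m → Fin N))),
      (∀ p ∈ L, ∀ p' ∈ L, p ≠ p' → ∀ a b a' b', (uu p.1 a, p.2 a) = (uu p'.1 a', p'.2 a') →
        (uu p.1 b, p.2 b) = (uu p'.1 b', p'.2 b') → a = b) ∧
      (∀ o : G × Fin N → Fin (Fintype.card (G × Fin N)), Function.Injective o →
        ∃ p ∈ L, Incons (fun a => o (uu p.1 a, p.2 a))) := by
  classical
  have hPc : 0 < Fintype.card PP := Fintype.card_pos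
  obtain ⟨k, hk0, hk1, hk2⟩ := numeric_choice (Fintype.card G) (Fintype.card PP) (2 * m + 2) hPc
  set N := k ^ 2 with hN
  set q := 2 * m + 2 with hq
  let W := G × Fin N
  let A := PP × (Lab m → Fin N)
  let vx : A → Lab m → W := fun p a => (uu p.1 a, p.2 a)
  have hvx : ∀ p, Function.Injective (vx p) := fun p a b h => hPinj p.1 (congrArg Prod.fst h)
  set M := Fintype.card W with hM
  have hM' : M = Fintype.card G * k ^ 2 := by simp [hM, W, hN]
  let Om := W → Fin M
  let bad : A → Om → Prop := fun p w => Incons (w ∘ vx p)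
  let conf : A → A → Prop := fun p p' => ∃ a b a' b', a ≠ b ∧ vx p a = vx p' a' ∧ vx p b = vx p' b'
  let Ω : Finset Om := Finset.univ.filter Function.Injective
  have hNpos : 0 < N := by positivity
  obtain ⟨L, Ω', hLc, hΩ', hcov, hnc, hcard⟩ := greedy bad conf Ω (N ^ q)
    (Fintype.card PP * q ^ 4 * N ^ (q - 2)) (by positivity) (by
      intro w hw
      have hwinj : Function.Injective w := (Finset.mem_filter.mp hw).2
      refine ⟨Finset.univ.filter (fun p => bad p w), ?_, fun a ha => (Finset.mem_filter.mp ha).2⟩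
      have h1 : (Finset.univ : Finset (G → Fin N)) ⊆
          (Finset.univ.filter (fun p => bad p w)).biUnion
            (fun p => Finset.univ.filter (fun x : G → Fin N => ∀ i, x (uu p.1 i) = p.2 i)) := by
        intro x _
        obtain ⟨u, hu⟩ := grid (fun g => w (g, x g)) (fun g g' h => by
          have := hwinj (Fin.ext h)
          exact congrArg Prod.fst this)
        rw [Finset.mem_biUnion]
        refine ⟨(u, fun a => x (uu u a)), ?_, by simp⟩
        simp only [Finset.mem_filter, Finset.mem_univ, true_and, bad]
        exact hu.congr (fun a b => by simp [vx])
      have h2 := (Finset.card_le_card h1).trans Finset.card_biUnion_le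
      have h3 := Nat.mul_le_mul_right (N ^ Fintype.card (Lab m)) h2
      rw [Finset.sum_mul] at h3
      have h4 := h3.trans (Finset.sum_le_sum (fun p _ => card_fixed N (uu p.1) (hPinj p.1) p.2))
      rw [Finset.sum_const, smul_eq_mul, card_lab, Finset.card_univ, Fintype.card_fun,
        Fintype.card_fin, mul_comm] at h4
      exact Nat.le_of_mul_le_mul_right h4 (by positivity)) (by
      intro p
      refine ⟨(Finset.univ : Finset (PP × Lab m × Lab m × Lab m × Lab m)).biUnion (fun t =>
        if t.2.2.2.1 = t.2.2.2.2 then ∅ else ((Finset.univ.filter (fun y : Lab m → Fin N =>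
          y t.2.2.2.1 = p.2 t.2.1 ∧ y t.2.2.2.2 = p.2 t.2.2.1)).image (fun y => (t.1, y)))), ?_, ?_⟩
      · refine (Finset.card_biUnion_le_card_mul _ _ (N ^ (q - 2)) ?_).trans ?_
        · intro t _
          split_ifs with h
          · simp
          · refine Finset.card_image_le.trans ?_
            have := card_two_fixed N _ _ h (p.2 t.2.1) (p.2 t.2.2.1)
            rw [card_lab] at this
            have e : N ^ (2 * m + 2) = N ^ (q - 2) * N ^ 2 := by
              rw [← pow_add]; congr 1
            rw [e] at this
            exact Nat.le_of_mul_le_mul_right this (by positivity)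
        · rw [Finset.card_univ]
          simp only [Fintype.card_prod, card_lab]
          apply le_of_eq; ring
      · rintro p' ⟨a, b, a', b', hab, ha, hb⟩
        rw [Finset.mem_biUnion]
        refine ⟨(p'.1, a, b, a', b'), Finset.mem_univ _, ?_⟩
        have hab' : a' ≠ b' := fun h => by
          subst h
          exact hab (hvx p (ha.trans hb.symm))
        simp only [hab', if_false, Finset.mem_image, Finset.mem_filter, Finset.mem_univ, true_and]
        exact ⟨p'.2, ⟨(congrArg Prod.snd ha).symm, (congrArg Prod.snd hb).symm⟩, rfl⟩) (k ^ 3) (by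
      have e : N ^ q = k ^ 3 * k * N ^ (q - 2) := by
        have : k ^ 3 * k = N ^ 2 := by rw [hN]; ring
        rw [this, ← pow_add]; congr 1; omega
      rw [e]
      calc 2 * k ^ 3 * (Fintype.card PP * q ^ 4 * N ^ (q - 2))
          = k ^ 3 * (2 * Fintype.card PP * q ^ 4) * N ^ (q - 2) := by ring
        _ ≤ _ := Nat.mul_le_mul_right _ (Nat.mul_le_mul_left _ hk1))
  have hΩ0 : Ω' = ∅ := by
    rw [← Finset.card_eq_zero]
    have h1 : (Ω.card : ℝ) ≤ (M : ℝ) ^ M := by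
      have : Ω.card ≤ M ^ M := by
        refine (Finset.card_le_univ _).trans ?_
        simp [Om, M]
      exact_mod_cast this
    have hPr : (0 : ℝ) < Fintype.card PP := by exact_mod_cast hPc
    have hNr : (0 : ℝ) < N := by exact_mod_cast hNpos
    have h2 : ((N ^ q : ℕ) : ℝ) / (2 * Fintype.card A) = 1 / (2 * Fintype.card PP) := by
      have : (Fintype.card A : ℝ) = Fintype.card PP * (N : ℝ) ^ q := by
        have : Fintype.card A = Fintype.card PP * N ^ q := by
          rw [Fintype.card_prod, Fintype.card_fun, card_lab, Fintype.card_fin]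
        rw [this]; push_cast; ring
      rw [this]
      push_cast
      field_simp
    rw [h2] at hcard
    have h0 : (0 : ℝ) ≤ 1 - 1 / (2 * Fintype.card PP) := by
      have hP1 : (1 : ℝ) ≤ Fintype.card PP := by exact_mod_cast hPc
      have : 1 / (2 * (Fintype.card PP : ℝ)) ≤ 1 := by
        rw [div_le_one (by positivity)]; linarith
      linarith
    have h3 := lt_of_le_of_lt (hcard.trans (mul_le_mul_of_nonneg_right h1 (pow_nonneg h0 _)))
      (hk2 M hM')
    have : Ω'.card < 1 := by exact_mod_cast h3
    omega
  refine ⟨N, L, ?_, fun o ho => hcov o (by simp [Ω, ho]) (by simp [hΩ0])⟩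
  intro p hp p' hp' hpp a b a' b' ha hb
  by_contra hab
  rcases hnc p hp p' hp' hpp with h | h
  · exact h ⟨a, b, a', b', hab, ha, hb⟩
  · refine h ⟨a', b', a, b, ?_, ha.symm, hb.symm⟩
    intro h'
    subst h'
    exact hab (hvx p (ha.trans hb.symm))

theorem exists_config (m : ℕ) (hm : 1 ≤ m) : ∃ (n : ℕ) (F : Finset (Lab m → Fin n)),
    (∀ l ∈ F, Function.Injective l) ∧
    (∀ l ∈ F, ∀ l' ∈ F, l ≠ l' → ∀ a b a' b', l a = l' a' → l b = l' b' → a = b) ∧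
    (∀ ord : Fin n → ℕ, Function.Injective ord → ∃ l ∈ F, Incons (ord ∘ l)) ∧
    (∀ σ : Sg m, ∃ o : Fin n → Fin n, Function.Injective o ∧
      ∀ l ∈ F, ∀ a b, σ.1 a < σ.1 b → o (l a) < o (l b)) := by
  classical
  have hSg := Sg_nonempty m hm
  obtain ⟨N1, hN1⟩ := grid_ramsey (Sg := Sg m) (L := Lab m) (2 * m + 2) (by omega) (fun σ => σ.1)
    (fun σ => σ.2.1)
  let G := Sg m → Fin N1
  let PP := {u : Lab m → G // ∀ (σ : Sg m) a b, σ.1 a < σ.1 b → u a σ < u b σ}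
  have hPinj : ∀ u : PP, Function.Injective u.1 := by
    intro u a b hab
    obtain ⟨σ⟩ := hSg
    by_contra hne
    rcases lt_or_gt_of_ne (fun h => hne (σ.2.1 h)) with h | h
    · have := u.2 σ a b h; rw [hab] at this; exact lt_irrefl _ this
    · have := u.2 σ b a h; rw [hab] at this; exact lt_irrefl _ this
  -- restatement of the grid property
  have grid : ∀ w : G → ℕ, Function.Injective w → ∃ u : PP, Incons (w ∘ u.1) := by
    intro w hw
    obtain ⟨u, hu1, hu2, σ, hu3⟩ := hN1
      (fun x => if h : ∀ σ, x σ < N1 then w (fun σ => ⟨x σ, h σ⟩) else 0) (by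
        intro x hx y hy hxy
        simp only [Set.mem_ofPred_eq] at hx hy
        simp only [hx, hy, implies_true, dif_pos] at hxy
        have := hw hxy
        funext σ
        have := congrFun this σ
        simpa using this)
    simp only [hu1, implies_true, dif_pos] at hu3
    let u' : PP := ⟨fun a σ => ⟨u a σ, hu1 a σ⟩, fun σ a b h => by
      simpa using hu2 σ a b h⟩
    refine ⟨u', ?_⟩
    rcases hu3 with h | h
    · refine σ.2.2.congr (fun a b => ⟨h a b, fun hl => ?_⟩)
      by_contra hcon
      rcases (not_lt.mp hcon).lt_or_eq with h' | h'
      · exact absurd hl (h b a h').asymm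
      · rw [σ.2.1 h'] at hl; exact lt_irrefl _ hl
    · refine σ.2.2.rev σ.2.1 (fun a b => ⟨h a b, fun hl => ?_⟩)
      by_contra hcon
      rcases (not_lt.mp hcon).lt_or_eq with h' | h'
      · exact absurd hl (h b a h').asymm
      · rw [σ.2.1 h'] at hl; exact lt_irrefl _ hl
  have hPP : Nonempty PP := by
    let e := Fintype.equivFin G
    obtain ⟨u, -⟩ := grid (fun g => e g) (fun a b h => e.injective (Fin.ext h))
    exact ⟨u⟩
  have hfin : Finite PP := Subtype.finite
  let _ : Fintype PP := Fintype.ofFinite PP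
  obtain ⟨N, L, hL1, hL2⟩ := config_aux m (G := G) (PP := PP) (fun p => p.1) hPinj grid
  let W := G × Fin N
  let A := PP × (Lab m → Fin N)
  let vx : A → Lab m → W := fun p a => (p.1.1 a, p.2 a)
  have hvx : ∀ p, Function.Injective (vx p) := fun p a b h => hPinj p.1 (congrArg Prod.fst h)
  set M := Fintype.card W with hM
  -- transport to `Fin M`
  let e : W ≃ Fin M := Fintype.equivFin W
  refine ⟨M, L.image (fun p a => e (vx p a)), ?_, ?_, ?_, ?_⟩
  · intro l hl
    obtain ⟨p, -, rfl⟩ := Finset.mem_image.mp hl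
    exact e.injective.comp (hvx p)
  · intro l hl l' hl' hne a b a' b' ha hb
    obtain ⟨p, hp, rfl⟩ := Finset.mem_image.mp hl
    obtain ⟨p', hp', rfl⟩ := Finset.mem_image.mp hl'
    have hpp : p ≠ p' := fun h => hne (by rw [h])
    exact hL1 p hp p' hp' hpp a b a' b' (e.injective ha) (e.injective hb)
  · intro ord hord
    obtain ⟨o, ho1, ho2⟩ := exists_rank M rfl (ord ∘ e) (hord.comp e.injective)
    obtain ⟨p, hp, hb⟩ := hL2 o ho1
    refine ⟨_, Finset.mem_image_of_mem _ hp, hb.congr (fun a b => ?_)⟩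
    exact ho2 _ _
  · intro σ
    let key : Fin M → Lex (Fin N1 × Fin M) := fun v => toLex ((e.symm v).1 σ, v)
    have hkey : Function.Injective key := fun v v' h => by
      have := congrArg (fun z => (ofLex z).2) h
      exact this
    obtain ⟨o, ho1, ho2⟩ := exists_rank M (Fintype.card_fin M) key hkey
    refine ⟨o, ho1, ?_⟩
    intro l hl a b hab
    obtain ⟨p, hp, rfl⟩ := Finset.mem_image.mp hl
    rw [ho2, Prod.Lex.lt_iff]
    left
    simpa [key, vx] using p.1.2 σ a b hab

end

section

open Function (extend update)

/-- Swapping resampled coordinates. -/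
theorem comb {ι α : Type*} [Fintype ι] [DecidableEq ι] [Fintype α] [DecidableEq α]
    (V : ι → Finset ℕ) (l : α → ι) (hl : Function.Injective l) (g : (ι → ℕ) → ℕ) :
    (Fintype.piFinset (fun a => V (l a))).card * ∑ x ∈ Fintype.piFinset V, g x =
      ∑ x ∈ Fintype.piFinset V, ∑ y ∈ Fintype.piFinset (fun a => V (l a)), g (extend l y x) := by
  classical
  have h1 : ∑ x ∈ Fintype.piFinset V, ∑ y ∈ Fintype.piFinset (fun a => V (l a)),
      g (extend l y x) = ∑ x ∈ Fintype.piFinset V, ∑ y ∈ Fintype.piFinset (fun a => V (l a)), g x := by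
    rw [← Finset.sum_product', ← Finset.sum_product']
    have hmem : ∀ p ∈ Fintype.piFinset V ×ˢ Fintype.piFinset (fun a => V (l a)),
        ((extend l p.2 p.1, fun a => p.1 (l a)) : (ι → ℕ) × (α → ℕ)) ∈
          Fintype.piFinset V ×ˢ Fintype.piFinset (fun a => V (l a)) := by
      rintro ⟨x, y⟩ h
      simp only [Finset.mem_product, Fintype.mem_piFinset] at h ⊢
      refine ⟨fun i => ?_, fun a => h.1 _⟩
      by_cases hi : ∃ a, l a = i
      · obtain ⟨a, rfl⟩ := hi
        rw [hl.extend_apply]; exact h.2 a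
      · rw [Function.extend_apply' _ _ _ hi]; exact h.1 i
    have hinv : ∀ p : (ι → ℕ) × (α → ℕ),
        ((extend l (fun a => p.1 (l a)) (extend l p.2 p.1),
          fun a => extend l p.2 p.1 (l a)) : (ι → ℕ) × (α → ℕ)) = p := by
      rintro ⟨x, y⟩
      refine Prod.ext ?_ ?_
      · funext i
        by_cases hi : ∃ a, l a = i
        · obtain ⟨a, rfl⟩ := hi
          simp only [hl.extend_apply]
        · simp only [Function.extend_apply' _ _ _ hi]
      · funext a
        simp only [hl.extend_apply]
    refine Finset.sum_nbij' (fun p => (extend l p.2 p.1, fun a => p.1 (l a)))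
      (fun p => (extend l p.2 p.1, fun a => p.1 (l a))) hmem hmem
      (fun p _ => hinv p) (fun p _ => hinv p) (fun p _ => rfl)
  rw [h1]
  simp only [Finset.sum_const, smul_eq_mul, ← Finset.mul_sum]

/-- Conditions meeting the range of `l` in at most one place cut out a box. -/
theorem comb_box {ι α κ : Type*} [Fintype ι] [DecidableEq ι] [Fintype α] [DecidableEq α]
    (V : ι → Finset ℕ) (l : α → ι) (hl : Function.Injective l) (Q : Finset κ)
    (cond : κ → (ι → ℕ) → Prop)
    (hdep : ∀ c ∈ Q, ∃ a : α, ∀ x y : ι → ℕ,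
      (∀ i, (∀ b, b ≠ a → l b ≠ i) → x i = y i) → (cond c x ↔ cond c y)) :
    ∃ S : (ι → ℕ) → α → Finset ℕ, (∀ x a, S x a ⊆ V (l a)) ∧
      (∀ x ∈ Fintype.piFinset V, (∀ c ∈ Q, cond c x) → ∀ a, x (l a) ∈ S x a) ∧
      (∀ x, ∀ y ∈ Fintype.piFinset (fun a => V (l a)),
        (∀ c ∈ Q, cond c (extend l y x)) ↔ y ∈ Fintype.piFinset (S x)) := by
  classical
  let dep : κ → α → Prop := fun c a => ∀ x y : ι → ℕ,
      (∀ i, (∀ b, b ≠ a → l b ≠ i) → x i = y i) → (cond c x ↔ cond c y)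
  have hmain : ∀ x : ι → ℕ, ∀ y ∈ Fintype.piFinset (fun a => V (l a)),
        (∀ c ∈ Q, cond c (extend l y x)) ↔ ∀ a, ∀ c ∈ Q, dep c a → cond c (update x (l a) (y a)) := by
    intro x y hy
    have key : ∀ a c, dep c a → (cond c (update x (l a) (y a)) ↔ cond c (extend l y x)) := by
      intro a c hd
      refine hd _ _ (fun i hi => ?_)
      by_cases h : ∃ b, l b = i
      · obtain ⟨b, rfl⟩ := h
        by_cases hb : b = a
        · subst hb; simp [hl.extend_apply]
        · exact absurd rfl (hi b hb)
      · rw [Function.extend_apply' _ _ _ h, Function.update_of_ne]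
        intro h'; exact h ⟨a, h'.symm⟩
    constructor
    · intro h a c hc hd
      exact (key a c hd).2 (h c hc)
    · intro h c hc
      obtain ⟨a, ha⟩ := hdep c hc
      exact (key a c ha).1 (h a c hc ha)
  refine ⟨fun x a => (V (l a)).filter (fun v => ∀ c ∈ Q, dep c a → cond c (update x (l a) v)),
    fun x a => Finset.filter_subset _ _, ?_, ?_⟩
  · intro x hx hQ a
    rw [Fintype.mem_piFinset] at hx
    rw [Finset.mem_filter]
    refine ⟨hx _, fun c hc _ => ?_⟩
    rw [Function.update_eq_self]; exact hQ c hc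
  · intro x y hy
    rw [hmain x y hy]
    rw [Fintype.mem_piFinset] at hy ⊢
    constructor
    · intro h a; rw [Finset.mem_filter]; exact ⟨hy a, h a⟩
    · intro h a; exact (Finset.mem_filter.mp (h a)).2

theorem comb_box_card {ι α κ : Type*} [Fintype ι] [DecidableEq ι] [Fintype α] [DecidableEq α]
    (V : ι → Finset ℕ) (l : α → ι) (hl : Function.Injective l) (Q : Finset κ)
    (cond : κ → (ι → ℕ) → Prop) [∀ c x, Decidable (cond c x)]
    (S : (ι → ℕ) → α → Finset ℕ) (hS : ∀ x a, S x a ⊆ V (l a))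
    (hS2 : ∀ x, ∀ y ∈ Fintype.piFinset (fun a => V (l a)),
        (∀ c ∈ Q, cond c (extend l y x)) ↔ y ∈ Fintype.piFinset (S x))
    (R : (α → ℕ) → Prop) [DecidablePred R] :
    (Fintype.piFinset (fun a => V (l a))).card *
      ((Fintype.piFinset V).filter (fun x => (∀ c ∈ Q, cond c x) ∧ R (fun a => x (l a)))).card =
    ∑ x ∈ Fintype.piFinset V, ((Fintype.piFinset (S x)).filter R).card := by
  classical
  rw [Finset.card_filter, comb V l hl]
  refine Finset.sum_congr rfl fun x _ => ?_
  rw [← Finset.card_filter]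
  congr 1
  ext y
  have e : (fun a => extend l y x (l a)) = y := funext fun a => hl.extend_apply _ _ _
  simp only [Finset.mem_filter, e]
  constructor
  · rintro ⟨h1, h2, h3⟩; exact ⟨(hS2 x y h1).1 h2, h3⟩
  · rintro ⟨h1, h3⟩
    have h0 : y ∈ Fintype.piFinset (fun a => V (l a)) := by
      rw [Fintype.mem_piFinset] at h1 ⊢
      exact fun a => hS x a (h1 a)
    exact ⟨h0, (hS2 x y h0).2 h1, h3⟩

/-- Edges between two sets. -/
noncomputable def eb (A : ℕ → ℕ → Prop) (S T : Finset ℕ) : ℕ :=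
  open Classical in ((S ×ˢ T).filter (fun p => A p.1 p.2)).card

/-- Number of partite cliques. -/
noncomputable def cnt {r : ℕ} (V : Fin r → Finset ℕ) (A : Fin r × Fin r → ℕ → ℕ → Prop)
    (Q : Finset (Fin r × Fin r)) : ℕ :=
  open Classical in
  ((Fintype.piFinset V).filter (fun x => ∀ p ∈ Q, A p (x p.1) (x p.2))).card

theorem pair_card (S : Fin 2 → Finset ℕ) (A : ℕ → ℕ → Prop) [DecidablePred (fun y : Fin 2 → ℕ => A (y 0) (y 1))] :
    ((Fintype.piFinset S).filter (fun y : Fin 2 → ℕ => A (y 0) (y 1))).card = eb A (S 0) (S 1) := by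
  classical
  unfold eb
  refine Finset.card_bij' (fun y _ => (y 0, y 1)) (fun p _ => ![p.1, p.2]) ?_ ?_ ?_ ?_
  · intro y hy
    simp only [Finset.mem_filter, Fintype.mem_piFinset, Finset.mem_product] at hy ⊢
    exact ⟨⟨hy.1 0, hy.1 1⟩, hy.2⟩
  · intro p hp
    simp only [Finset.mem_filter, Fintype.mem_piFinset, Finset.mem_product] at hp ⊢
    refine ⟨fun i => ?_, by simpa using hp.2⟩
    fin_cases i
    · simpa using hp.1.1
    · simpa using hp.1.2
  · intro y hy
    funext i; fin_cases i <;> simp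
  · intro p hp
    simp

theorem pair_step {r : ℕ} (V : Fin r → Finset ℕ) (A : Fin r × Fin r → ℕ → ℕ → Prop)
    (Q : Finset (Fin r × Fin r)) (hQ : ∀ p ∈ Q, p.1 < p.2) (p : Fin r × Fin r) (hp : p.1 < p.2)
    (hpQ : p ∉ Q) :
    ∃ S T : (Fin r → ℕ) → Finset ℕ, (∀ x, S x ⊆ V p.1) ∧ (∀ x, T x ⊆ V p.2) ∧
      (V p.1).card * (V p.2).card * cnt V A Q =
        ∑ x ∈ Fintype.piFinset V, (S x).card * (T x).card ∧
      (V p.1).card * (V p.2).card * cnt V A (insert p Q) =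
        ∑ x ∈ Fintype.piFinset V, eb (A p) (S x) (T x) := by
  classical
  let l : Fin 2 → Fin r := ![p.1, p.2]
  have hl : Function.Injective l := by
    intro i j h
    fin_cases i <;> fin_cases j <;> simp [l] at h ⊢
    · exact hp.ne h
    · exact hp.ne' h
  obtain ⟨S, hS1, -, hS2⟩ := comb_box V l hl Q (fun c x => A c (x c.1) (x c.2)) (by
    intro c hc
    have hc' := hQ c hc
    have hne : c ≠ p := fun h => hpQ (h ▸ hc)
    have : (c.1 ≠ p.2 ∧ c.2 ≠ p.2) ∨ (c.1 ≠ p.1 ∧ c.2 ≠ p.1) := by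
      by_contra hcon
      have : c.1 = p.1 ∧ c.2 = p.2 := by
        constructor
        · omega
        · omega
      exact hne (Prod.ext this.1 this.2)
    rcases this with h | h
    · refine ⟨0, fun x y hxy => ?_⟩
      rw [hxy c.1, hxy c.2]
      · intro b hb; fin_cases b
        · simp at hb
        · simpa [l] using h.2.symm
      · intro b hb; fin_cases b
        · simp at hb
        · simpa [l] using h.1.symm
    · refine ⟨1, fun x y hxy => ?_⟩
      rw [hxy c.1, hxy c.2]
      · intro b hb; fin_cases b
        · simpa [l] using h.2.symm
        · simp at hb
      · intro b hb; fin_cases b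
        · simpa [l] using h.1.symm
        · simp at hb)
  have hY : (Fintype.piFinset (fun a => V (l a))).card = (V p.1).card * (V p.2).card := by
    simp [Fintype.card_piFinset, Fin.prod_univ_two, l]
  refine ⟨fun x => S x 0, fun x => S x 1, fun x => hS1 x 0, fun x => hS1 x 1, ?_, ?_⟩
  · have := comb_box_card V l hl Q (fun c x => A c (x c.1) (x c.2)) S hS1 hS2 (fun _ => True)
    rw [hY] at this
    simp only [and_true, Finset.filter_true, Fintype.card_piFinset, Fin.prod_univ_two] at this
    rw [← this]
    unfold cnt
    congr!
  · have := comb_box_card V l hl Q (fun c x => A c (x c.1) (x c.2)) S hS1 hS2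
      (fun y => A p (y 0) (y 1))
    rw [hY] at this
    simp only [pair_card] at this
    rw [← this]
    unfold cnt
    congr 2
    refine Finset.filter_congr fun x _ => ?_
    simp [l, Finset.forall_mem_insert, and_comm]

theorem card_pi_le {r : ℕ} (V : Fin r → Finset ℕ) (s : ℕ) (hs : ∀ i, (V i).card ≤ s)
    (a b : Fin r) (hab : a ≠ b) :
    (Fintype.piFinset V).card ≤ (V a).card * (V b).card * s ^ (r - 2) := by
  rw [Fintype.card_piFinset, ← Finset.mul_prod_erase _ _ (Finset.mem_univ a),
    ← Finset.mul_prod_erase _ _ (show b ∈ Finset.univ.erase a by simp [hab.symm]), mul_assoc]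
  refine Nat.mul_le_mul_left _ (Nat.mul_le_mul_left _ ?_)
  refine (Finset.prod_le_pow_card _ _ s (fun i _ => hs i)).trans (le_of_eq ?_)
  congr 1
  rw [Finset.card_erase_of_mem (by simp [hab.symm]), Finset.card_erase_of_mem (Finset.mem_univ _)]
  simp
  omega

theorem cnt_zero {r : ℕ} (V : Fin r → Finset ℕ) (A : Fin r × Fin r → ℕ → ℕ → Prop)
    (Q : Finset (Fin r × Fin r)) (i : Fin r) (h : (V i).card = 0) : cnt V A Q = 0 := by
  classical
  unfold cnt
  rw [Finset.card_eq_zero, Finset.filter_eq_empty_iff]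
  intro x hx
  rw [Fintype.mem_piFinset] at hx
  have := hx i
  rw [Finset.card_eq_zero.mp h] at this
  simp at this

theorem cnt_empty {r : ℕ} (V : Fin r → Finset ℕ) (A : Fin r × Fin r → ℕ → ℕ → Prop) :
    cnt V A ∅ = (Fintype.piFinset V).card := by
  classical
  unfold cnt; simp

theorem cnt_lower {r : ℕ} (V : Fin r → Finset ℕ) (s : ℕ) (hs : ∀ i, (V i).card ≤ s)
    (A : Fin r × Fin r → ℕ → ℕ → Prop) (β D : ℝ) (hβ0 : 0 ≤ β) (hβ : β ≤ 1) (hD : 0 ≤ D)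
    (Q : Finset (Fin r × Fin r)) (hQ : ∀ p ∈ Q, p.1 < p.2)
    (hA : ∀ p ∈ Q, ∀ S ⊆ V p.1, ∀ T ⊆ V p.2, β * (S.card * T.card) - D ≤ eb (A p) S T) :
    β ^ Q.card * (Fintype.piFinset V).card - Q.card * (D * s ^ (r - 2)) ≤ cnt V A Q := by
  classical
  induction Q using Finset.induction_on with
  | empty => simp [cnt_empty]
  | insert p Q hpQ ih =>
    have ih := ih (fun p' h => hQ p' (Finset.mem_insert_of_mem h))
      (fun p' h => hA p' (Finset.mem_insert_of_mem h))
    have hp := hQ p (Finset.mem_insert_self _ _)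
    obtain ⟨S, T, hS, hT, h1, h2⟩ := pair_step V A Q
      (fun p' h => hQ p' (Finset.mem_insert_of_mem h)) p hp hpQ
    have hstep : β * cnt V A Q - D * s ^ (r - 2) ≤ cnt V A (insert p Q) := by
      rcases Nat.eq_zero_or_pos (V p.1).card with h0 | h0
      · rw [cnt_zero V A _ _ h0, cnt_zero V A _ _ h0]
        have : 0 ≤ D * (s : ℝ) ^ (r - 2) := by positivity
        simp; linarith
      rcases Nat.eq_zero_or_pos (V p.2).card with h0' | h0'
      · rw [cnt_zero V A _ _ h0', cnt_zero V A _ _ h0']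
        have : 0 ≤ D * (s : ℝ) ^ (r - 2) := by positivity
        simp; linarith
      have h1' : ((V p.1).card * (V p.2).card : ℝ) * cnt V A Q =
        ∑ x ∈ Fintype.piFinset V, ((S x).card * (T x).card : ℝ) := by exact_mod_cast h1
      have h2' : ((V p.1).card * (V p.2).card : ℝ) * cnt V A (insert p Q) =
        ∑ x ∈ Fintype.piFinset V, (eb (A p) (S x) (T x) : ℝ) := by exact_mod_cast h2
      have h3 : ∑ x ∈ Fintype.piFinset V, (β * ((S x).card * (T x).card : ℝ) - D) ≤
          ∑ x ∈ Fintype.piFinset V, (eb (A p) (S x) (T x) : ℝ) :=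
        Finset.sum_le_sum fun x _ => hA p (Finset.mem_insert_self _ _) _ (hS x) _ (hT x)
      rw [Finset.sum_sub_distrib, ← Finset.mul_sum, ← h1', ← h2', Finset.sum_const,
        nsmul_eq_mul] at h3
      have h4 : ((Fintype.piFinset V).card : ℝ) ≤ (V p.1).card * (V p.2).card * s ^ (r - 2) := by
        exact_mod_cast card_pi_le V s hs _ _ hp.ne
      have h5 := mul_le_mul_of_nonneg_right h4 hD
      have hpos : (0 : ℝ) < (V p.1).card * (V p.2).card := by positivity
      refine le_of_mul_le_mul_left ?_ hpos
      nlinarith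
    rw [Finset.card_insert_of_notMem hpQ, pow_succ]
    have h6 := mul_le_mul_of_nonneg_left ih hβ0
    push_cast
    have h7 : β * (Q.card * (D * s ^ (r - 2))) ≤ 1 * (Q.card * (D * (s : ℝ) ^ (r - 2))) :=
      mul_le_mul_of_nonneg_right hβ (by positivity)
    nlinarith

theorem cnt_upper {r : ℕ} (V : Fin r → Finset ℕ) (s : ℕ) (hs : ∀ i, (V i).card ≤ s)
    (A : Fin r × Fin r → ℕ → ℕ → Prop) (w : Fin r × Fin r → ℝ) (D : ℝ) (hw0 : ∀ p, 0 ≤ w p)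
    (hw : ∀ p, w p ≤ 2) (hD : 0 ≤ D)
    (Q : Finset (Fin r × Fin r)) (hQ : ∀ p ∈ Q, p.1 < p.2)
    (hA : ∀ p ∈ Q, ∀ S ⊆ V p.1, ∀ T ⊆ V p.2, (eb (A p) S T : ℝ) ≤ w p * (S.card * T.card) + D) :
    (cnt V A Q : ℝ) ≤ (∏ p ∈ Q, w p) * (Fintype.piFinset V).card + (3 ^ Q.card) * (D * s ^ (r - 2)) := by
  classical
  induction Q using Finset.induction_on with
  | empty => simp [cnt_empty]; positivity
  | insert p Q hpQ ih =>
    have ih := ih (fun p' h => hQ p' (Finset.mem_insert_of_mem h))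
      (fun p' h => hA p' (Finset.mem_insert_of_mem h))
    have hp := hQ p (Finset.mem_insert_self _ _)
    obtain ⟨S, T, hS, hT, h1, h2⟩ := pair_step V A Q
      (fun p' h => hQ p' (Finset.mem_insert_of_mem h)) p hp hpQ
    have hstep : cnt V A (insert p Q) ≤ w p * cnt V A Q + D * s ^ (r - 2) := by
      rcases Nat.eq_zero_or_pos (V p.1).card with h0 | h0
      · rw [cnt_zero V A _ _ h0, cnt_zero V A _ _ h0]
        have : 0 ≤ D * (s : ℝ) ^ (r - 2) := by positivity
        simp; linarith
      rcases Nat.eq_zero_or_pos (V p.2).card with h0' | h0'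
      · rw [cnt_zero V A _ _ h0', cnt_zero V A _ _ h0']
        have : 0 ≤ D * (s : ℝ) ^ (r - 2) := by positivity
        simp; linarith
      have h1' : ((V p.1).card * (V p.2).card : ℝ) * cnt V A Q =
        ∑ x ∈ Fintype.piFinset V, ((S x).card * (T x).card : ℝ) := by exact_mod_cast h1
      have h2' : ((V p.1).card * (V p.2).card : ℝ) * cnt V A (insert p Q) =
        ∑ x ∈ Fintype.piFinset V, (eb (A p) (S x) (T x) : ℝ) := by exact_mod_cast h2
      have h3 : ∑ x ∈ Fintype.piFinset V, (eb (A p) (S x) (T x) : ℝ) ≤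
          ∑ x ∈ Fintype.piFinset V, (w p * ((S x).card * (T x).card : ℝ) + D) :=
        Finset.sum_le_sum fun x _ => hA p (Finset.mem_insert_self _ _) _ (hS x) _ (hT x)
      rw [Finset.sum_add_distrib, ← Finset.mul_sum, ← h1', ← h2', Finset.sum_const,
        nsmul_eq_mul] at h3
      have h4 : ((Fintype.piFinset V).card : ℝ) ≤ (V p.1).card * (V p.2).card * s ^ (r - 2) := by
        exact_mod_cast card_pi_le V s hs _ _ hp.ne
      have h5 := mul_le_mul_of_nonneg_right h4 hD
      have hpos : (0 : ℝ) < (V p.1).card * (V p.2).card := by positivity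
      refine le_of_mul_le_mul_left ?_ hpos
      nlinarith
    rw [Finset.card_insert_of_notMem hpQ, pow_succ, Finset.prod_insert hpQ]
    have h6 := mul_le_mul_of_nonneg_left ih (hw0 p)
    have h7 : w p * (3 ^ Q.card * (D * s ^ (r - 2))) ≤ 2 * (3 ^ Q.card * (D * (s : ℝ) ^ (r - 2))) :=
      mul_le_mul_of_nonneg_right (hw p) (by positivity)
    have h8 : 1 * (D * (s : ℝ) ^ (r - 2)) ≤ 3 ^ Q.card * (D * s ^ (r - 2)) :=
      mul_le_mul_of_nonneg_right (one_le_pow₀ (by norm_num)) (by positivity)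
    nlinarith

/-- Few tuples have two entries in the same block. -/
theorem noncross_tuples {α : Type*} [Fintype α] [DecidableEq α] (S : Finset ℕ) (blk : ℕ → ℕ)
    (k : ℝ) (hk0 : 0 ≤ k)
    (hk : ∀ u ∈ S, k * (S.filter (fun v => blk v = blk u)).card ≤ S.card) :
    k * ((Fintype.piFinset (fun _ : α => S)).filter
      (fun y => ¬ Function.Injective (fun a => blk (y a)))).card ≤
      (Fintype.card α : ℝ) ^ 2 * (S.card : ℝ) ^ Fintype.card α := by
  classical
  have hpair : ∀ a b : α, a ≠ b → k * ((Fintype.piFinset (fun _ : α => S)).filter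
      (fun y => blk (y a) = blk (y b))).card ≤ (S.card : ℝ) ^ Fintype.card α := by
    intro a b hab
    have h := comb (fun _ : α => S) (fun _ : Unit => a) (fun _ _ _ => rfl)
      (fun y => if blk (y a) = blk (y b) then 1 else 0)
    rw [← Finset.card_filter] at h
    have hl : Function.Injective (fun _ : Unit => a) := fun _ _ _ => rfl
    have e1 : (Fintype.piFinset (fun _ : Unit => S)).card = S.card := by
      simp [Fintype.card_piFinset]
    have h2 : ∀ x ∈ Fintype.piFinset (fun _ : α => S),
        k * ((∑ y ∈ Fintype.piFinset (fun _ : Unit => S),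
          if blk (extend (fun _ : Unit => a) y x a) = blk (extend (fun _ : Unit => a) y x b)
            then 1 else 0 : ℕ) : ℝ) ≤ S.card := by
      intro x hx
      rw [← Finset.card_filter]
      rw [Fintype.mem_piFinset] at hx
      refine le_trans (mul_le_mul_of_nonneg_left ?_ hk0) (hk (x b) (hx b))
      norm_cast
      refine Finset.card_le_card_of_injOn (fun y => y ()) ?_ ?_
      · intro y hy
        have e2 : extend (fun _ : Unit => a) y x a = y () := hl.extend_apply _ _ ()
        have e3 : extend (fun _ : Unit => a) y x b = x b :=
          Function.extend_apply' _ _ _ (by rintro ⟨_, h⟩; exact hab h)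
        simp only [Finset.coe_filter, Set.mem_ofPred_eq, e2, e3, Fintype.mem_piFinset] at hy ⊢
        exact ⟨hy.1 (), hy.2⟩
      · intro y _ y' _ h
        funext i
        exact h
    rcases Nat.eq_zero_or_pos S.card with h0 | h0
    · have : (Fintype.piFinset (fun _ : α => S)).filter (fun y => blk (y a) = blk (y b)) = ∅ := by
        rw [Finset.filter_eq_empty_iff]
        intro x hx
        rw [Fintype.mem_piFinset] at hx
        have := hx a
        rw [Finset.card_eq_zero.mp h0] at this
        simp at this
      rw [this]; simp
    · rw [e1] at h
      have h' := congrArg (Nat.cast (R := ℝ)) h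
      rw [Nat.cast_mul] at h'
      have hpos : (0 : ℝ) < S.card := by exact_mod_cast h0
      refine le_of_mul_le_mul_left ?_ hpos
      calc (S.card : ℝ) * (k * ((Fintype.piFinset (fun _ : α => S)).filter
            (fun y => blk (y a) = blk (y b))).card)
          = k * (S.card * ((Fintype.piFinset (fun _ : α => S)).filter
            (fun y => blk (y a) = blk (y b))).card) := by ring
        _ = ∑ x ∈ Fintype.piFinset (fun _ : α => S), k * ((∑ y ∈ Fintype.piFinset (fun _ : Unit => S),
          if blk (extend (fun _ : Unit => a) y x a) = blk (extend (fun _ : Unit => a) y x b)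
            then 1 else 0 : ℕ) : ℝ) := by
            rw [h', ← Finset.mul_sum]
            push_cast
            rfl
        _ ≤ ∑ x ∈ Fintype.piFinset (fun _ : α => S), (S.card : ℝ) := Finset.sum_le_sum h2
        _ = _ := by
          rw [Finset.sum_const, nsmul_eq_mul, Fintype.card_piFinset]
          simp [mul_comm]
  have hsub : (Fintype.piFinset (fun _ : α => S)).filter
      (fun y => ¬ Function.Injective (fun a => blk (y a))) ⊆
      (Finset.univ : Finset (α × α)).biUnion (fun p => if p.1 = p.2 then ∅ else
        (Fintype.piFinset (fun _ : α => S)).filter (fun y => blk (y p.1) = blk (y p.2))) := by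
    intro y hy
    rw [Finset.mem_filter] at hy
    obtain ⟨h1, h2⟩ := hy
    unfold Function.Injective at h2
    push Not at h2
    obtain ⟨a, b, h3, h4⟩ := h2
    rw [Finset.mem_biUnion]
    refine ⟨(a, b), Finset.mem_univ _, ?_⟩
    simp only [h4, if_false, Finset.mem_filter]
    exact ⟨h1, h3⟩
  have h5 := (Finset.card_le_card hsub).trans Finset.card_biUnion_le
  have h6 : (((Fintype.piFinset (fun _ : α => S)).filter
      (fun y => ¬ Function.Injective (fun a => blk (y a)))).card : ℝ) ≤
      ∑ p : α × α, ((if p.1 = p.2 then (∅ : Finset (α → ℕ)) else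
        (Fintype.piFinset (fun _ : α => S)).filter (fun y => blk (y p.1) = blk (y p.2))).card : ℝ) := by
    exact_mod_cast h5
  refine (mul_le_mul_of_nonneg_left h6 hk0).trans ?_
  rw [Finset.mul_sum]
  refine (Finset.sum_le_card_nsmul _ _ ((S.card : ℝ) ^ Fintype.card α) ?_).trans ?_
  · intro p _
    split_ifs with h
    · simp
    · exact hpair _ _ h
  · rw [nsmul_eq_mul, Finset.card_univ, Fintype.card_prod]
    push_cast
    rw [sq]

end

section

theorem cross_bij (r : ℕ) (S : Finset ℕ) (blk : ℕ → ℕ)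
    (hmono : ∀ u ∈ S, ∀ v ∈ S, u ≤ v → blk u ≤ blk v) (φ : Finset ℕ → Prop) [DecidablePred φ]
    [DecidablePred fun e : Finset ℕ => Set.InjOn blk (e : Set ℕ)]
    [DecidablePred fun x : Fin r → ℕ => StrictMono (fun i => blk (x i))] :
    ((Finset.powersetCard r S).filter (fun e : Finset ℕ => Set.InjOn blk (e : Set ℕ) ∧ φ e)).card =
      ((Fintype.piFinset (fun _ : Fin r => S)).filter
        (fun x => StrictMono (fun i => blk (x i)) ∧ φ (Finset.univ.image x))).card := by
  classical
  have hsm : ∀ x ∈ Fintype.piFinset (fun _ : Fin r => S), StrictMono (fun i => blk (x i)) →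
      StrictMono x := by
    intro x hx h i j hij
    rw [Fintype.mem_piFinset] at hx
    by_contra hcon
    exact absurd (h hij) (not_lt.mpr (hmono _ (hx j) _ (hx i) (not_lt.mp hcon)))
  symm
  refine Finset.card_bij (fun x _ => Finset.univ.image x) ?_ ?_ ?_
  · intro x hx
    rw [Finset.mem_filter] at hx ⊢
    obtain ⟨hx1, hx2, hx3⟩ := hx
    have hs := hsm x hx1 hx2
    rw [Fintype.mem_piFinset] at hx1
    refine ⟨?_, ?_, hx3⟩
    · rw [Finset.mem_powersetCard]
      refine ⟨?_, ?_⟩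
      · intro v hv
        obtain ⟨i, -, rfl⟩ := Finset.mem_image.mp hv
        exact hx1 i
      · rw [Finset.card_image_of_injective _ hs.injective]; simp
    · intro u hu v hv huv
      obtain ⟨i, -, rfl⟩ := Finset.mem_image.mp (Finset.mem_coe.mp hu)
      obtain ⟨j, -, rfl⟩ := Finset.mem_image.mp (Finset.mem_coe.mp hv)
      rw [hx2.injective huv]
  · intro x hx y hy hxy
    rw [Finset.mem_filter] at hx hy
    have hs := hsm x hx.1 hx.2.1
    have hs' := hsm y hy.1 hy.2.1
    have hc : (Finset.univ.image x).card = r := by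
      rw [Finset.card_image_of_injective _ hs.injective]; simp
    have e1 := Finset.orderEmbOfFin_unique hc
      (fun k => Finset.mem_image_of_mem _ (Finset.mem_univ k)) hs
    have e2 := Finset.orderEmbOfFin_unique hc (f := y)
      (fun k => by rw [hxy]; exact Finset.mem_image_of_mem _ (Finset.mem_univ k)) hs'
    exact e1.trans e2.symm
  · intro e he
    rw [Finset.mem_filter, Finset.mem_powersetCard] at he
    obtain ⟨⟨h1, h2⟩, h3, h4⟩ := he
    have him : Finset.univ.image (e.orderEmbOfFin h2) = e := by
      apply Finset.coe_injective
      simp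
    refine ⟨e.orderEmbOfFin h2, ?_, him⟩
    rw [Finset.mem_filter, Fintype.mem_piFinset, him]
    refine ⟨fun i => h1 (Finset.orderEmbOfFin_mem _ _ _), ?_, h4⟩
    intro i j hij
    have hm := Finset.orderEmbOfFin_mem e h2
    refine lt_of_le_of_ne (hmono _ (h1 (hm i)) _ (h1 (hm j)) ?_) ?_
    · exact (e.orderEmbOfFin h2).monotone hij.le
    · intro h
      have := h3 (hm i) (hm j) h
      exact hij.ne ((e.orderEmbOfFin h2).injective this)

theorem cross_fiber (r : ℕ) (S I : Finset ℕ) (blk : ℕ → ℕ) (hI : ∀ u ∈ S, blk u ∈ I)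
    (φ : (Fin r → ℕ) → Prop) [DecidablePred φ]
    [DecidablePred fun x : Fin r → ℕ => StrictMono x] :
      ((Fintype.piFinset (fun _ : Fin r => S)).filter
        (fun x => StrictMono (fun i => blk (x i)) ∧ φ x)).card =
      ∑ t ∈ (Fintype.piFinset (fun _ : Fin r => I)).filter (fun t => StrictMono t),
        ((Fintype.piFinset (fun i => S.filter (fun v => blk v = t i))).filter φ).card := by
  classical
  rw [Finset.card_eq_sum_card_fiberwise (f := fun x i => blk (x i))
    (t := (Fintype.piFinset (fun _ : Fin r => I)).filter (fun t => StrictMono t))]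
  · refine Finset.sum_congr rfl fun t ht => ?_
    congr 1
    ext x
    simp only [Finset.mem_filter, Fintype.mem_piFinset] at ht ⊢
    constructor
    · rintro ⟨⟨h1, h2, h3⟩, h4⟩
      exact ⟨fun i => ⟨h1 i, congrFun h4 i⟩, h3⟩
    · rintro ⟨h1, h2⟩
      have : (fun i => blk (x i)) = t := funext fun i => (h1 i).2
      refine ⟨⟨fun i => (h1 i).1, ?_, h2⟩, this⟩
      rw [this]; exact ht.2
  · intro x hx
    simp only [Finset.coe_filter, Fintype.mem_piFinset, Set.mem_ofPred_eq] at hx ⊢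
    exact ⟨fun i => hI _ (hx.1 i), hx.2.1⟩

theorem card_strictMono (r : ℕ) (I : Finset ℕ) [DecidablePred fun x : Fin r → ℕ => StrictMono x] :
    ((Fintype.piFinset (fun _ : Fin r => I)).filter (fun t => StrictMono t)).card =
      I.card.choose r := by
  classical
  have := cross_bij r I id (fun _ _ _ _ h => h) (fun _ => True)
  simp only [Set.injOn_id, and_true, Finset.filter_true, Finset.card_powersetCard, id] at this
  rw [this]

theorem noncross_sets (r : ℕ) (S : Finset ℕ) (blk : ℕ → ℕ) (k : ℝ) (hk0 : 0 ≤ k)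
    (hk : ∀ u ∈ S, k * (S.filter (fun v => blk v = blk u)).card ≤ S.card)
    [DecidablePred fun e : Finset ℕ => Set.InjOn blk (e : Set ℕ)] :
    k * ((Finset.powersetCard r S).filter (fun e : Finset ℕ => ¬ Set.InjOn blk (e : Set ℕ))).card ≤
      (r : ℝ) ^ 2 * (S.card : ℝ) ^ r := by
  classical
  have h := noncross_tuples (α := Fin r) S blk k hk0 hk
  rw [Fintype.card_fin] at h
  refine le_trans (mul_le_mul_of_nonneg_left ?_ hk0) h
  norm_cast
  refine Finset.card_le_card_of_surjOn (fun y => Finset.univ.image y) ?_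
  intro e he
  rw [Finset.mem_coe, Finset.mem_filter, Finset.mem_powersetCard] at he
  obtain ⟨⟨h1, h2⟩, h3⟩ := he
  have him : Finset.univ.image (e.orderEmbOfFin h2) = e := by
    apply Finset.coe_injective
    simp
  refine ⟨e.orderEmbOfFin h2, ?_, him⟩
  rw [Finset.mem_coe, Finset.mem_filter, Fintype.mem_piFinset]
  refine ⟨fun i => h1 (Finset.orderEmbOfFin_mem _ _ _), ?_⟩
  intro hinj
  apply h3
  rw [← him]
  intro u hu v hv huv
  obtain ⟨i, -, rfl⟩ := Finset.mem_image.mp (Finset.mem_coe.mp hu)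
  obtain ⟨j, -, rfl⟩ := Finset.mem_image.mp (Finset.mem_coe.mp hv)
  rw [hinj huv]

theorem pow_le_choose' (r n : ℕ) (h : 2 * r ≤ n) :
    (n : ℝ) ^ r ≤ 2 ^ r * r.factorial * n.choose r := by
  have h1 := Nat.pow_le_choose (α := ℝ) r n
  have h2 : (n : ℝ) ≤ 2 * ((n + 1 - r : ℕ) : ℝ) := by
    have : n ≤ 2 * (n + 1 - r) := by omega
    exact_mod_cast this
  calc (n : ℝ) ^ r ≤ (2 * ((n + 1 - r : ℕ) : ℝ)) ^ r := pow_le_pow_left₀ (by positivity) h2 r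
    _ = 2 ^ r * ((n + 1 - r : ℕ) : ℝ) ^ r := mul_pow _ _ _
    _ ≤ 2 ^ r * (r.factorial * n.choose r) := by
      refine mul_le_mul_of_nonneg_left ?_ (by positivity)
      have h0 : (0:ℝ) < r.factorial := by exact_mod_cast Nat.factorial_pos r
      first
        | exact h1
        | (rw [div_le_iff₀ h0] at h1; linarith)
    _ = _ := by ring

/-- The hypergraph of a configuration. -/
def cfgGraph (m n : ℕ) (F : Finset (Lab m → Fin n)) (hF : ∀ l ∈ F, Function.Injective l) :
    RGraph (m + 2) where
  verts := Finset.range n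
  edges := F.biUnion (fun l => Finset.univ.image (fun b => (EE m b).image (fun a => (l a : ℕ))))
  edges_subset := by
    intro e he
    obtain ⟨l, hl, he⟩ := Finset.mem_biUnion.mp he
    obtain ⟨b, -, rfl⟩ := Finset.mem_image.mp he
    intro v hv
    obtain ⟨a, -, rfl⟩ := Finset.mem_image.mp hv
    simp
  edges_card := by
    intro e he
    obtain ⟨l, hl, he⟩ := Finset.mem_biUnion.mp he
    obtain ⟨b, -, rfl⟩ := Finset.mem_image.mp he
    rw [Finset.card_image_of_injective, card_EE]
    exact fun x y h => hF l hl (Fin.ext h)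

theorem cfg_sub_iff (m n : ℕ) (F : Finset (Lab m → Fin n)) (hF : ∀ l ∈ F, Function.Injective l)
    (H : RGraph (m + 2)) : IsSubgraph (cfgGraph m n F hF) H ↔
    ∃ x : Fin n → ℕ, Function.Injective x ∧ (∀ v, x v ∈ H.verts) ∧
      ∀ l ∈ F, ∀ b, (EE m b).image (fun a => x (l a)) ∈ H.edges := by
  classical
  constructor
  · rintro ⟨φ, h1, h2, h3⟩
    refine ⟨fun v => φ v, ?_, ?_, ?_⟩
    · intro u v huv
      exact Fin.ext (h1 (by simp [cfgGraph]) (by simp [cfgGraph]) huv)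
    · intro v; exact h2 _ (by simp [cfgGraph])
    · intro l hl b
      have := h3 ((EE m b).image (fun a => (l a : ℕ))) (Finset.mem_biUnion.mpr
        ⟨l, hl, Finset.mem_image_of_mem _ (Finset.mem_univ b)⟩)
      rwa [Finset.image_image] at this
  · rintro ⟨x, h1, h2, h3⟩
    refine ⟨fun v => if h : v < n then x ⟨v, h⟩ else 0, ?_, ?_, ?_⟩
    · intro u hu v hv huv
      simp only [cfgGraph, Finset.coe_range, Set.mem_Iio] at hu hv
      simp only [hu, hv, dif_pos] at huv
      simpa using h1 huv
    · intro v hv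
      simp only [cfgGraph, Finset.mem_range] at hv
      simp only [hv, dif_pos]
      exact h2 _
    · intro e he
      obtain ⟨l, hl, he⟩ := Finset.mem_biUnion.mp he
      obtain ⟨b, -, rfl⟩ := Finset.mem_image.mp he
      rw [Finset.image_image]
      convert h3 l hl b using 2
      funext a
      simp

end

section

theorem disc (p : ℕ) [Fact p.Prime] (C : Finset (ZMod p)) (X Y : Finset (ZMod p × ZMod p)) :
    ((C.card : ℝ) / p * (X.card * Y.card) -
      ((X ×ˢ Y).filter (fun t => t.1.1 * t.2.1 + t.1.2 + t.2.2 ∈ C)).card) ^ 2 ≤ (p : ℝ) ^ 7 := by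
  classical
  have hp : (0 : ℝ) < p := by exact_mod_cast (Fact.out : p.Prime).pos
  set β : ℝ := (C.card : ℝ) / p with hβ
  have hCp : C.card ≤ p := by
    have := Finset.card_le_univ C
    rwa [ZMod.card] at this
  have hβ0 : 0 ≤ β := by positivity
  have hβ1 : β ≤ 1 := by
    rw [hβ, div_le_one hp]; exact_mod_cast hCp
  let g : ZMod p → ℝ := fun z => (if z ∈ C then 1 else 0) - β
  have hg1 : ∀ z, |g z| ≤ 1 := by
    intro z
    simp only [g]
    split_ifs <;> rw [abs_le] <;> constructor <;> linarith
  have hg0 : ∑ z, g z = 0 := by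
    simp only [g, Finset.sum_sub_distrib, Finset.sum_const, Finset.card_univ, ZMod.card, nsmul_eq_mul]
    rw [← Finset.sum_filter]
    simp [hβ]
    field_simp
    simp
  let f : ZMod p × ZMod p → ZMod p × ZMod p → ZMod p := fun x y => x.1 * y.1 + x.2 + y.2
  have hD : (C.card : ℝ) / p * (X.card * Y.card) -
      ((X ×ˢ Y).filter (fun t => t.1.1 * t.2.1 + t.1.2 + t.2.2 ∈ C)).card =
      - ∑ x ∈ X, ∑ y ∈ Y, g (f x y) := by
    rw [← Finset.sum_product']
    simp only [g, Finset.sum_sub_distrib, Finset.sum_const, Finset.card_product, nsmul_eq_mul]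
    rw [Finset.card_filter]
    push_cast
    simp only [f]
    ring
  rw [hD, neg_sq]
  have hcs : (∑ x ∈ X, ∑ y ∈ Y, g (f x y)) ^ 2 ≤ X.card * ∑ x ∈ X, (∑ y ∈ Y, g (f x y)) ^ 2 :=
    sq_sum_le_card_mul_sum_sq
  have hXc : (X.card : ℝ) ≤ p ^ 2 := by
    have := Finset.card_le_univ X
    rw [Fintype.card_prod, ZMod.card] at this
    rw [sq]; exact_mod_cast this
  have hYc : (Y.card : ℝ) ≤ p ^ 2 := by
    have := Finset.card_le_univ Y
    rw [Fintype.card_prod, ZMod.card] at this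
    rw [sq]; exact_mod_cast this
  have hle : ∑ x ∈ X, (∑ y ∈ Y, g (f x y)) ^ 2 ≤ ∑ x, (∑ y ∈ Y, g (f x y)) ^ 2 :=
    Finset.sum_le_sum_of_subset_of_nonneg (Finset.subset_univ _) (fun _ _ _ => sq_nonneg _)
  have hswap : ∑ x, (∑ y ∈ Y, g (f x y)) ^ 2 =
      ∑ y ∈ Y, ∑ y' ∈ Y, ∑ x, g (f x y) * g (f x y') := by
    simp only [sq, Finset.sum_mul_sum]
    rw [Finset.sum_comm]
    refine Finset.sum_congr rfl fun y _ => ?_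
    rw [Finset.sum_comm]
  have hkey : ∀ y y' : ZMod p × ZMod p, ∑ x, g (f x y) * g (f x y') ≤
      if y'.1 = y.1 then (p : ℝ) ^ 2 else 0 := by
    intro y y'
    split_ifs with h
    · refine (Finset.sum_le_card_nsmul _ _ 1 (fun x _ => ?_)).trans ?_
      · refine (le_abs_self _).trans ?_
        rw [abs_mul]
        exact mul_le_one₀ (hg1 _) (abs_nonneg _) (hg1 _)
      · rw [Finset.card_univ, Fintype.card_prod, ZMod.card]
        simp [sq]
    · have hbij : Function.Bijective (fun x : ZMod p × ZMod p => (f x y, f x y')) := by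
        rw [Fintype.bijective_iff_injective_and_card]
        refine ⟨?_, rfl⟩
        rintro ⟨a, b⟩ ⟨a', b'⟩ hab
        simp only [f, Prod.mk.injEq] at hab
        obtain ⟨h1, h2⟩ := hab
        have h3 : (a - a') * (y.1 - y'.1) = 0 := by linear_combination h1 - h2
        have h4 : a = a' := by
          rcases mul_eq_zero.mp h3 with h5 | h5
          · exact sub_eq_zero.mp h5
          · exact absurd (sub_eq_zero.mp h5).symm h
        subst h4
        have : b = b' := by linear_combination h1
        rw [this]
      have := hbij.sum_comp (fun t : ZMod p × ZMod p => g t.1 * g t.2)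
      simp only at this
      rw [this, Fintype.sum_prod_type, ← Finset.sum_mul_sum, hg0]
      simp
  have h1 : ∑ y ∈ Y, ∑ y' ∈ Y, ∑ x, g (f x y) * g (f x y') ≤ (p : ℝ) ^ 5 := by
    have h2 : ∀ y ∈ Y, ∑ y' ∈ Y, ∑ x, g (f x y) * g (f x y') ≤ (p : ℝ) ^ 3 := by
      intro y _
      refine (Finset.sum_le_sum fun y' _ => hkey y y').trans ?_
      refine (Finset.sum_le_sum_of_subset_of_nonneg (Finset.subset_univ Y) (fun _ _ _ => by
        split_ifs <;> positivity)).trans ?_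
      rw [Fintype.sum_prod_type_right]
      have h3 : ∀ b : ZMod p, (∑ a : ZMod p, if (a, b).1 = y.1 then (p : ℝ) ^ 2 else 0) = p ^ 2 := by
        intro b
        rw [Finset.sum_eq_single y.1]
        · simp
        · intro a _ ha
          exact if_neg ha
        · simp
      refine (Finset.sum_le_sum (g := fun _ => (p : ℝ) ^ 2) fun b _ => ?_).trans ?_
      · refine le_trans (le_of_eq ?_) (h3 b).le
        refine Finset.sum_congr rfl fun a _ => ?_
        congr
      rw [Finset.sum_const, Finset.card_univ, ZMod.card, nsmul_eq_mul]
      apply le_of_eq; ring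
    refine (Finset.sum_le_card_nsmul _ _ _ h2).trans ?_
    rw [nsmul_eq_mul]
    calc (Y.card : ℝ) * p ^ 3 ≤ p ^ 2 * p ^ 3 := mul_le_mul_of_nonneg_right hYc (by positivity)
      _ = _ := by ring
  calc _ ≤ _ := hcs
    _ ≤ (p : ℝ) ^ 2 * p ^ 5 := by
      refine mul_le_mul hXc (hle.trans (hswap.le.trans h1)) ?_ (by positivity)
      exact Finset.sum_nonneg fun _ _ => sq_nonneg _
    _ = _ := by ring

/-- The explicit pseudorandom colouring of pairs. -/
def pcol (p K : ℕ) (u v : ℕ) : ℕ :=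
  ((((u / p : ℕ) : ZMod p) * ((v / p : ℕ) : ZMod p) + (u : ZMod p) + (v : ZMod p)).val) % K

theorem pcol_disc (p K : ℕ) [Fact p.Prime] (hK : 0 < K) (c : ℕ) (hc : c < K) (S T : Finset ℕ)
    (i j : ℕ) (hS : ∀ v ∈ S, v / p ^ 2 = i) (hT : ∀ v ∈ T, v / p ^ 2 = j) :
    (1 / (K : ℝ) - 1 / p) * (S.card * T.card) - Real.sqrt p ^ 7 ≤
      eb (fun u v => pcol p K u v = c) S T := by
  classical
  have hp0 : 0 < p := (Fact.out : p.Prime).pos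
  have hp : (0 : ℝ) < p := by exact_mod_cast hp0
  have hne : NeZero p := ⟨hp0.ne'⟩
  let C : Finset (ZMod p) := Finset.univ.filter (fun z => z.val % K = c)
  let ψ : ℕ → ZMod p × ZMod p := fun v => (((v / p : ℕ) : ZMod p), (v : ZMod p))
  have hψ : ∀ u v : ℕ, u / p ^ 2 = v / p ^ 2 → ψ u = ψ v → u = v := by
    intro u v h1 h2
    simp only [ψ, Prod.mk.injEq, ZMod.natCast_eq_natCast_iff'] at h2
    rw [sq, ← Nat.div_div_eq_div_mul, ← Nat.div_div_eq_div_mul] at h1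
    have h3 : u / p = v / p := by
      rw [← Nat.div_add_mod (u / p) p, ← Nat.div_add_mod (v / p) p, h1, h2.1]
    rw [← Nat.div_add_mod u p, ← Nat.div_add_mod v p, h3, h2.2]
  have hSi : Set.InjOn ψ S := fun u hu v hv h => hψ u v ((hS u hu).trans (hS v hv).symm) h
  have hTi : Set.InjOn ψ T := fun u hu v hv h => hψ u v ((hT u hu).trans (hT v hv).symm) h
  have hd := disc p C (S.image ψ) (T.image ψ)
  rw [Finset.card_image_of_injOn hSi, Finset.card_image_of_injOn hTi] at hd
  have he : (((S.image ψ) ×ˢ (T.image ψ)).filter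
      (fun t => t.1.1 * t.2.1 + t.1.2 + t.2.2 ∈ C)).card = eb (fun u v => pcol p K u v = c) S T := by
    unfold eb
    symm
    refine Finset.card_bij (fun t _ => (ψ t.1, ψ t.2)) ?_ ?_ ?_
    · rintro ⟨u, v⟩ h
      simp only [Finset.mem_filter, Finset.mem_product] at h ⊢
      refine ⟨⟨Finset.mem_image_of_mem _ h.1.1, Finset.mem_image_of_mem _ h.1.2⟩, ?_⟩
      simp only [C, Finset.mem_filter, Finset.mem_univ, true_and, ψ]
      exact h.2
    · rintro ⟨u, v⟩ h ⟨u', v'⟩ h' heq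
      simp only [Finset.mem_filter, Finset.mem_product] at h h'
      simp only [Prod.mk.injEq] at heq
      rw [hSi h.1.1 h'.1.1 heq.1, hTi h.1.2 h'.1.2 heq.2]
    · rintro ⟨a, b⟩ h
      simp only [Finset.mem_filter, Finset.mem_product, Finset.mem_image] at h
      obtain ⟨⟨⟨u, hu, rfl⟩, ⟨v, hv, rfl⟩⟩, h2⟩ := h
      refine ⟨(u, v), ?_, rfl⟩
      simp only [Finset.mem_filter, Finset.mem_product]
      refine ⟨⟨hu, hv⟩, ?_⟩
      simp only [C, Finset.mem_filter, Finset.mem_univ, true_and, ψ] at h2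
      exact h2
  rw [he] at hd
  have hC : 1 / (K : ℝ) - 1 / p ≤ (C.card : ℝ) / p := by
    have h1 : p / K ≤ C.card := by
      rw [← Finset.card_range (p / K)]
      have hlt : ∀ j < p / K, j * K + c < p := fun j hj => by
        have h2 : (j + 1) * K ≤ p / K * K := Nat.mul_le_mul_right _ hj
        have h3 := Nat.div_mul_le_self p K
        have : (j + 1) * K = j * K + K := by ring
        omega
      refine Finset.card_le_card_of_injOn (fun j => ((j * K + c : ℕ) : ZMod p)) ?_ ?_
      · intro j hj
        simp only [Finset.coe_range, Set.mem_Iio] at hj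
        simp only [C, Finset.coe_filter, Finset.mem_univ, true_and, Set.mem_ofPred_eq]
        rw [ZMod.val_natCast_of_lt (hlt j hj)]
        rw [Nat.mul_comm, Nat.mul_add_mod, Nat.mod_eq_of_lt hc]
      · intro j hj j' hj' h
        simp only [Finset.coe_range, Set.mem_Iio] at hj hj'
        simp only [ZMod.natCast_eq_natCast_iff'] at h
        rw [Nat.mod_eq_of_lt (hlt j hj), Nat.mod_eq_of_lt (hlt j' hj')] at h
        exact Nat.eq_of_mul_eq_mul_right hK (by omega)
    have h2 : (p : ℝ) / K - 1 ≤ (p / K : ℕ) := by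
      have := Nat.lt_div_mul_add (a := p) hK
      have h3 : (p : ℝ) < (p / K : ℕ) * K + K := by exact_mod_cast this
      have hK' : (0 : ℝ) < K := by exact_mod_cast hK
      rw [sub_le_iff_le_add, div_le_iff₀ hK']
      linarith
    have h3 : ((p / K : ℕ) : ℝ) ≤ C.card := by exact_mod_cast h1
    rw [le_div_iff₀ hp, sub_mul]
    field_simp
    field_simp at h2
    have := h2.trans (mul_le_mul_of_nonneg_left h3 (Nat.cast_nonneg K))
    linarith
  have h4 : (C.card : ℝ) / p * (S.card * T.card) - eb (fun u v => pcol p K u v = c) S T ≤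
      Real.sqrt p ^ 7 := by
    apply le_of_sq_le_sq _ (by positivity)
    calc _ ≤ _ := hd
      _ = (Real.sqrt p ^ 2) ^ 7 := by rw [Real.sq_sqrt hp.le]
      _ = _ := by ring
  have h5 := mul_le_mul_of_nonneg_right hC (show (0:ℝ) ≤ S.card * T.card by positivity)
  linarith

end

section

/-- Coding of roles by colours. -/
def code (a b : ℕ) : ℕ := b.choose 2 + a

theorem code_lt_succ {a b : ℕ} (h : a < b) : code a b < (b + 1).choose 2 := by
  unfold code
  rw [Nat.choose_succ_succ' b 1, Nat.choose_one_right]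
  simp only [Nat.reduceAdd]
  omega

theorem code_lt {a b r : ℕ} (h : a < b) (hb : b < r) : code a b < r.choose 2 :=
  (code_lt_succ h).trans_le (Nat.choose_le_choose 2 hb)

theorem code_inj {a b a' b' : ℕ} (h : a < b) (h' : a' < b') (he : code a b = code a' b') :
    a = a' ∧ b = b' := by
  have hb : b = b' := by
    rcases lt_trichotomy b b' with hlt | heq | hlt
    · have h1 := code_lt h hlt
      have : b'.choose 2 ≤ code a' b' := Nat.le_add_right _ _
      omega
    · exact heq
    · have h1 := code_lt h' hlt
      have : b.choose 2 ≤ code a b := Nat.le_add_right _ _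
      omega
  subst hb
  unfold code at he
  exact ⟨by omega, rfl⟩

/-- Rank of a vertex in an edge. -/
def rkk (e : Finset ℕ) (u : ℕ) : ℕ := (e.filter (fun w => w < u)).card

theorem rkk_lt {e : Finset ℕ} {u v : ℕ} (hu : u ∈ e) (h : u < v) : rkk e u < rkk e v := by
  unfold rkk
  apply Finset.card_lt_card
  rw [Finset.ssubset_iff_of_subset]
  · exact ⟨u, by simp [hu, h], by simp⟩
  · intro w hw
    simp only [Finset.mem_filter] at hw ⊢
    exact ⟨hw.1, hw.2.trans h⟩

theorem rkk_lt_card {e : Finset ℕ} {u : ℕ} (hu : u ∈ e) : rkk e u < e.card := by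
  unfold rkk
  apply Finset.card_lt_card
  rw [Finset.ssubset_iff_of_subset (Finset.filter_subset _ _)]
  exact ⟨u, hu, by simp⟩

theorem rkk_image {m : ℕ} (y : Lab m → ℕ) (hy : Function.Injective y) (b : Bool) (z : Fin 2) :
    rkk ((EE m b).image y) (y (Sum.inl z)) = rk b y z := by
  unfold rkk rk
  rw [Finset.filter_image, Finset.card_image_of_injective _ hy]

theorem rkk_strictMono {r : ℕ} (x : Fin r → ℕ) (hx : StrictMono x) (i : Fin r) :
    rkk (Finset.univ.image x) (x i) = i := by
  unfold rkk
  rw [Finset.filter_image, Finset.card_image_of_injective _ hx.injective]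
  have : (Finset.univ.filter (fun a => x a < x i)) = Finset.Iio i := by
    ext a
    simp [hx.lt_iff_lt]
  rw [this, Fin.card_Iio]

/-- All increasing pairs. -/
def Qall (r : ℕ) : Finset (Fin r × Fin r) := Finset.univ.filter (fun p => p.1 < p.2)

theorem card_Qall (r : ℕ) : (Qall r).card = r.choose 2 := by
  unfold Qall
  have h : (Finset.univ.filter (fun p : Fin r × Fin r => p.1 < p.2)).card =
      ∑ j : Fin r, (j : ℕ) := by
    rw [Finset.card_filter, Fintype.sum_prod_type_right]
    refine Finset.sum_congr rfl fun j _ => ?_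
    rw [← Finset.card_filter]
    have : (Finset.univ.filter (fun a : Fin r => (a, j).1 < (a, j).2)) = Finset.Iio j := by
      ext a; simp
    rw [this, Fin.card_Iio]
  rw [h, Fin.sum_univ_eq_sum_range (fun j => j) r, Finset.sum_range_id, Nat.choose_two_right]

theorem cnt_le_card {r : ℕ} (V : Fin r → Finset ℕ) (A : Fin r × Fin r → ℕ → ℕ → Prop)
    (Q : Finset (Fin r × Fin r)) (X : Finset (Fin r → ℕ))
    (h : ∀ x ∈ Fintype.piFinset V, (∀ p ∈ Q, A p (x p.1) (x p.2)) → x ∈ X) :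
    cnt V A Q ≤ X.card := by
  classical
  unfold cnt
  apply Finset.card_le_card
  intro x hx
  rw [Finset.mem_filter] at hx
  exact h x hx.1 hx.2

theorem card_le_cnt {r : ℕ} (V : Fin r → Finset ℕ) (A : Fin r × Fin r → ℕ → ℕ → Prop)
    (Q : Finset (Fin r × Fin r)) (X : Finset (Fin r → ℕ))
    (h : ∀ x ∈ X, x ∈ Fintype.piFinset V ∧ (∀ p ∈ Q, A p (x p.1) (x p.2))) :
    X.card ≤ cnt V A Q := by
  classical
  unfold cnt
  apply Finset.card_le_card
  intro x hx
  rw [Finset.mem_filter]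
  exact h x hx

/-- Edge condition of the lower bound construction. -/
def isE (r p : ℕ) (e : Finset ℕ) : Prop :=
  ∀ u ∈ e, ∀ v ∈ e, u < v → pcol p (r.choose 2) u v = code (rkk e u) (rkk e v)

open Classical in
/-- Lower bound construction. -/
noncomputable def lowGraph (r p J : ℕ) : RGraph r where
  verts := Finset.range (J * p ^ 2)
  edges := (Finset.powersetCard r (Finset.range (J * p ^ 2))).filter (isE r p)
  edges_subset := by
    intro e he
    exact (Finset.mem_powersetCard.mp (Finset.mem_filter.mp he).1).1
  edges_card := by
    intro e he
    exact (Finset.mem_powersetCard.mp (Finset.mem_filter.mp he).1).2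

theorem low_free (m n : ℕ) (F : Finset (Lab m → Fin n)) (hF : ∀ l ∈ F, Function.Injective l)
    (hc : ∀ ord : Fin n → ℕ, Function.Injective ord → ∃ l ∈ F, Incons (ord ∘ l)) (p J : ℕ) :
    ¬ IsSubgraph (cfgGraph m n F hF) (lowGraph (m + 2) p J) := by
  classical
  rw [cfg_sub_iff]
  rintro ⟨x, hx, -, h⟩
  obtain ⟨l, hl, z, hz⟩ := hc x hx
  have hy : Function.Injective (x ∘ l) := hx.comp (hF l hl)
  have hE : ∀ b, isE (m + 2) p ((EE m b).image (x ∘ l)) := fun b =>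
    (Finset.mem_filter.mp (h l hl b)).2
  have hmem : ∀ b z, (x ∘ l) (Sum.inl z) ∈ (EE m b).image (x ∘ l) := fun b z =>
    Finset.mem_image_of_mem _ (inl_mem_EE m b z)
  generalize x ∘ l = y at *
  have key : ∀ z z' : Fin 2, y (Sum.inl z) < y (Sum.inl z') →
      rk true y z = rk false y z ∧ rk true y z' = rk false y z' := by
    intro z z' hlt
    have h1 := hE true _ (hmem true z) _ (hmem true z') hlt
    have h2 := hE false _ (hmem false z) _ (hmem false z') hlt
    have h3 := code_inj (rkk_lt (hmem true z) hlt) (rkk_lt (hmem false z) hlt) (h1.symm.trans h2)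
    simpa only [rkk_image y hy] using h3
  have hne : y (Sum.inl 0) ≠ y (Sum.inl 1) := fun h => by
    have := hy h
    simp at this
  apply hz
  rcases lt_or_gt_of_ne hne with h1 | h1
  · have := key 0 1 h1
    fin_cases z
    · exact this.1
    · exact this.2
  · have := key 1 0 h1
    fin_cases z
    · exact this.2
    · exact this.1

theorem low_count (r p J : ℕ) [Fact p.Prime] (hr : 2 ≤ r) (hp : r.choose 2 ≤ p) (S : Finset ℕ)
    (hS : S ⊆ Finset.range (J * p ^ 2)) (k : ℝ) (hk : 0 < k) (hkS : k * p ^ 2 ≤ S.card) :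
    (1 / (r.choose 2 : ℝ) - 1 / p) ^ (r.choose 2) *
        (S.card.choose r - (r : ℝ) ^ 2 * S.card ^ r / k) -
      J ^ r * (r.choose 2 * (Real.sqrt p ^ 7 * (p ^ 2) ^ (r - 2))) ≤
    (((lowGraph r p J).edges.filter (fun e => e ⊆ S)).card : ℝ) := by
  classical
  have hK : 0 < r.choose 2 := Nat.choose_pos hr
  have hK' : (0 : ℝ) < r.choose 2 := by exact_mod_cast hK
  have hp0 : 0 < p := (Fact.out : p.Prime).pos
  have hp' : (0 : ℝ) < p := by exact_mod_cast hp0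
  set β : ℝ := 1 / (r.choose 2 : ℝ) - 1 / p with hβ
  have hβ0 : 0 ≤ β := by
    rw [hβ, sub_nonneg]
    exact one_div_le_one_div_of_le hK' (by exact_mod_cast hp)
  have hβ1 : β ≤ 1 := by
    have h1 : 1 / (r.choose 2 : ℝ) ≤ 1 := by
      rw [div_le_one hK']; exact_mod_cast hK
    have h2 : 0 ≤ 1 / (p : ℝ) := by positivity
    linarith
  set D : ℝ := Real.sqrt p ^ 7 with hD
  have hD0 : 0 ≤ D := by positivity
  let blk : ℕ → ℕ := fun v => v / p ^ 2
  have hmono : ∀ u ∈ S, ∀ v ∈ S, u ≤ v → blk u ≤ blk v := fun u _ v _ h => Nat.div_le_div_right h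
  have hfib : ∀ T : Finset ℕ, ∀ j, (T.filter (fun v => blk v = j)).card ≤ p ^ 2 := by
    intro T j
    calc (T.filter (fun v => blk v = j)).card ≤ (Finset.Ico (j * p ^ 2) ((j + 1) * p ^ 2)).card := by
          apply Finset.card_le_card
          intro v hv
          have hv := (Finset.mem_filter.mp hv).2
          rw [Finset.mem_Ico]
          have h1 := Nat.div_mul_le_self v (p ^ 2)
          have h2 := Nat.lt_div_mul_add (a := v) (pow_pos hp0 2)
          simp only [blk] at hv
          rw [hv] at h1 h2
          exact ⟨h1, by rw [add_mul, one_mul]; exact h2⟩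
      _ = p ^ 2 := by rw [Nat.card_Ico, add_mul, one_mul]; omega
  have hnc := noncross_sets r S blk k hk.le (fun u _ => by
    have : ((S.filter (fun v => blk v = blk u)).card : ℝ) ≤ p ^ 2 := by exact_mod_cast hfib S (blk u)
    exact (mul_le_mul_of_nonneg_left this hk.le).trans hkS)
  have hI : ∀ u ∈ S, blk u ∈ Finset.range J := by
    intro u hu
    have := Finset.mem_range.mp (hS hu)
    rw [Finset.mem_range]
    exact Nat.div_lt_of_lt_mul (by rw [mul_comm]; exact this)
  have hcross1 := cross_bij r S blk hmono (isE r p)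
  have hcross2 := cross_fiber r S (Finset.range J) blk hI (fun x => isE r p (Finset.univ.image x))
  have hcross3 := cross_bij r S blk hmono (fun _ => True)
  have hcross4 := cross_fiber r S (Finset.range J) blk hI (fun _ => True)
  simp only [and_true, Finset.filter_true] at hcross3 hcross4
  have hct := card_strictMono r (Finset.range J)
  set TT := (Fintype.piFinset (fun _ : Fin r => Finset.range J)).filter (fun t => StrictMono t) with hTT
  -- crossing edges are edges
  have hle1 : ((Finset.powersetCard r S).filter
      (fun e : Finset ℕ => Set.InjOn blk (e : Set ℕ) ∧ isE r p e)).card ≤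
      ((lowGraph r p J).edges.filter (fun e => e ⊆ S)).card := by
    apply Finset.card_le_card
    intro e he
    simp only [lowGraph, Finset.mem_filter, Finset.mem_powersetCard] at he ⊢
    exact ⟨⟨⟨he.1.1.trans hS, he.1.2⟩, he.2.2⟩, he.1.1⟩
  let A : Fin r × Fin r → ℕ → ℕ → Prop := fun q u v => pcol p (r.choose 2) u v = code q.1 q.2
  have hle2 : ∀ t ∈ TT, β ^ (r.choose 2) *
      ((Fintype.piFinset (fun i => S.filter (fun v => blk v = t i))).card : ℝ) -
      r.choose 2 * (D * (p ^ 2) ^ (r - 2)) ≤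
      (((Fintype.piFinset (fun i => S.filter (fun v => blk v = t i))).filter
        (fun x => isE r p (Finset.univ.image x))).card : ℝ) := by
    intro t ht
    have htm : StrictMono t := (Finset.mem_filter.mp ht).2
    have h1 := cnt_lower (fun i => S.filter (fun v => blk v = t i)) (p ^ 2)
      (fun i => hfib S (t i)) A β D hβ0 hβ1 hD0 (Qall r)
      (fun q hq => (Finset.mem_filter.mp hq).2) (by
        intro q hq S' hS' T' hT'
        refine pcol_disc p (r.choose 2) hK _ ?_ S' T' (t q.1) (t q.2) ?_ ?_
        · exact code_lt (Finset.mem_filter.mp hq).2 q.2.2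
        · intro v hv
          exact (Finset.mem_filter.mp (hS' hv)).2
        · intro v hv
          exact (Finset.mem_filter.mp (hT' hv)).2)
    rw [card_Qall] at h1
    push_cast at h1
    refine h1.trans ?_
    rw [Nat.cast_le]
    apply cnt_le_card
    intro x hx1 hx2
    refine Finset.mem_filter.mpr ⟨hx1, ?_⟩
    have hxm := Fintype.mem_piFinset.mp hx1
    have hxs : StrictMono x := by
      intro i j hij
      by_contra hcon
      push Not at hcon
      have h2 := Nat.div_le_div_right (c := p ^ 2) hcon
      have h3 := (Finset.mem_filter.mp (hxm i)).2
      have h4 := (Finset.mem_filter.mp (hxm j)).2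
      simp only [blk] at h3 h4
      have := htm hij
      omega
    intro u hu v hv huv
    obtain ⟨i, -, rfl⟩ := Finset.mem_image.mp hu
    obtain ⟨j, -, rfl⟩ := Finset.mem_image.mp hv
    rw [rkk_strictMono x hxs, rkk_strictMono x hxs]
    exact hx2 (i, j) (by simp [Qall, hxs.lt_iff_lt.mp huv])
  have hsum := Finset.sum_le_sum hle2
  rw [Finset.sum_sub_distrib, ← Finset.mul_sum, Finset.sum_const, nsmul_eq_mul, hct,
    Finset.card_range] at hsum
  rw [← Nat.cast_sum, ← Nat.cast_sum, ← hcross2, ← hcross4, ← hcross1, ← hcross3] at hsum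
  have hJ : (J.choose r : ℝ) ≤ J ^ r := by exact_mod_cast Nat.choose_le_pow J r
  have hsplit := Finset.card_filter_add_card_filter_not (s := Finset.powersetCard r S) (fun e : Finset ℕ => Set.InjOn blk (e : Set ℕ))
  rw [Finset.card_powersetCard] at hsplit
  have hsplit' : (S.card.choose r : ℝ) =
    ((Finset.powersetCard r S).filter (fun e : Finset ℕ => Set.InjOn blk (e : Set ℕ))).card +
    ((Finset.powersetCard r S).filter (fun e : Finset ℕ => ¬ Set.InjOn blk (e : Set ℕ))).card := by
    exact_mod_cast hsplit.symm
  have hnc' : (((Finset.powersetCard r S).filter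
      (fun e : Finset ℕ => ¬ Set.InjOn blk (e : Set ℕ))).card : ℝ) ≤ (r : ℝ) ^ 2 * S.card ^ r / k := by
    rw [le_div_iff₀ hk, mul_comm]; exact hnc
  have h5 : β ^ (r.choose 2) * (S.card.choose r - (r : ℝ) ^ 2 * S.card ^ r / k) ≤ β ^ (r.choose 2) *
    ((Finset.powersetCard r S).filter (fun e : Finset ℕ => Set.InjOn blk (e : Set ℕ))).card :=
    mul_le_mul_of_nonneg_left (by linarith) (pow_nonneg hβ0 _)
  have h6 : (J.choose r : ℝ) * (r.choose 2 * (D * (p ^ 2) ^ (r - 2))) ≤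
      J ^ r * (r.choose 2 * (D * (p ^ 2) ^ (r - 2))) :=
    mul_le_mul_of_nonneg_right hJ (by positivity)
  have h7 : (((Finset.powersetCard r S).filter
      (fun e : Finset ℕ => Set.InjOn blk (e : Set ℕ) ∧ isE r p e)).card : ℝ) ≤
      ((lowGraph r p J).edges.filter (fun e => e ⊆ S)).card := by exact_mod_cast hle1
  linarith

theorem low_dense (r : ℕ) (hr : 3 ≤ r) (ε : ℝ) (hε : 0 < ε) (n0 : ℕ) :
    ∃ p J : ℕ, n0 ≤ (lowGraph r p J).verts.card ∧ IsDense (lowGraph r p J) (piR r) ε := by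
  have hK : 0 < r.choose 2 := Nat.choose_pos (by omega)
  have hK' : (0 : ℝ) < r.choose 2 := by exact_mod_cast hK
  set K := r.choose 2 with hKd
  set B : ℝ := 2 ^ r * r.factorial with hB
  have hB0 : 0 < B := by positivity
  obtain ⟨J, hJ⟩ : ∃ J : ℕ, 3 * r ^ 2 * B / ε ^ 2 + n0 + 1 ≤ (J : ℝ) := exists_nat_ge _
  have hq : 0 ≤ 3 * r ^ 2 * B / ε ^ 2 := by positivity
  have hJ1 : (1 : ℝ) ≤ J := by
    have : (0 : ℝ) ≤ n0 := by positivity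
    linarith
  have hJn : n0 ≤ J := by
    have : (n0 : ℝ) ≤ J := by linarith
    exact_mod_cast this
  have hev1 : ∀ᶠ p : ℕ in Filter.atTop, piR r - ε / 3 ≤ (1 / (K : ℝ) - 1 / p) ^ K := by
    have h1 : Filter.Tendsto (fun p : ℕ => (1 / (K : ℝ) - 1 / (p : ℝ)) ^ K) Filter.atTop
        (nhds ((1 / (K : ℝ) - 0) ^ K)) :=
      (tendsto_const_nhds.sub tendsto_one_div_atTop_nhds_zero_nat).pow K
    have h2 : (1 / (K : ℝ) - 0) ^ K = piR r := by
      unfold piR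
      rw [sub_zero, one_div, inv_pow]
    rw [h2] at h1
    exact (h1.eventually (lt_mem_nhds (by linarith : piR r - ε / 3 < piR r))).mono fun _ h => h.le
  have hev2 : ∀ᶠ p : ℕ in Filter.atTop, 3 * K * B / ε ^ (r + 1) ≤ Real.sqrt p :=
    (Real.tendsto_sqrt_atTop.comp tendsto_natCast_atTop_atTop).eventually_ge_atTop _
  have hev3 : ∀ᶠ p : ℕ in Filter.atTop, 2 * r / ε ≤ (p : ℝ) :=
    tendsto_natCast_atTop_atTop.eventually_ge_atTop _
  obtain ⟨P0, hP0⟩ := Filter.eventually_atTop.mp (hev1.and (hev2.and (hev3.and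
    (Filter.eventually_ge_atTop K))))
  obtain ⟨p, hpP, hpp⟩ := Nat.exists_infinite_primes P0
  obtain ⟨h1, h2, h3, h4⟩ := hP0 p hpP
  have hfact : Fact p.Prime := ⟨hpp⟩
  have hp1 : (1 : ℝ) ≤ p := by exact_mod_cast hpp.one_lt.le
  refine ⟨p, J, ?_, ?_⟩
  · simp only [lowGraph, Finset.card_range]
    calc n0 ≤ J := hJn
      _ ≤ J * p ^ 2 := Nat.le_mul_of_pos_right _ (pow_pos hpp.pos 2)
  intro S hS hcard
  simp only [lowGraph, Finset.card_range] at hcard hS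
  push_cast at hcard
  have hc := low_count r p J (by omega) h4 S hS (ε * J) (by positivity) (by
    rw [mul_assoc]; exact hcard)
  refine le_trans ?_ hc
  have h5 : 2 * r ≤ S.card := by
    have : (2 * r : ℝ) ≤ S.card := by
      have h6 : 2 * r ≤ ε * p := by rw [div_le_iff₀ hε] at h3; linarith
      have h7 : (p : ℝ) ≤ J * p ^ 2 := by nlinarith
      have := mul_le_mul_of_nonneg_left h7 hε.le
      linarith
    exact_mod_cast this
  have h6 := pow_le_choose' r S.card h5
  rw [← hB] at h6
  set C : ℝ := (S.card.choose r : ℝ) with hC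
  have hC0 : 0 ≤ C := by positivity
  set γ := (1 / (K : ℝ) - 1 / p) ^ K with hγ
  have hγ1 : γ ≤ 1 := by
    apply pow_le_one₀
    · rw [sub_nonneg]
      exact one_div_le_one_div_of_le hK' (by exact_mod_cast h4)
    · have h1 : 1 / (K : ℝ) ≤ 1 := by
        rw [div_le_one hK']; exact_mod_cast hK
      have h2 : 0 ≤ 1 / (p : ℝ) := by positivity
      linarith
  have e1 : (r : ℝ) ^ 2 * S.card ^ r / (ε * J) ≤ ε / 3 * C := by
    rw [div_le_iff₀ (by positivity)]
    have h8 : 3 * r ^ 2 * B ≤ ε ^ 2 * J := by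
      have : 3 * r ^ 2 * B / ε ^ 2 ≤ J := by
        have : (0 : ℝ) ≤ n0 := by positivity
        linarith
      rw [div_le_iff₀ (by positivity)] at this
      linarith
    calc (r : ℝ) ^ 2 * S.card ^ r ≤ r ^ 2 * (B * C) := mul_le_mul_of_nonneg_left h6 (by positivity)
      _ = (3 * r ^ 2 * B) * C / 3 := by ring
      _ ≤ (ε ^ 2 * J) * C / 3 := by gcongr
      _ = _ := by ring
  have e2 : J ^ r * (K * (Real.sqrt p ^ 7 * ((p : ℝ) ^ 2) ^ (r - 2))) ≤ ε / 3 * C := by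
    have hs : 0 < Real.sqrt p := Real.sqrt_pos.mpr (by linarith)
    have hsq : Real.sqrt p ^ 2 = p := Real.sq_sqrt (by linarith)
    rw [div_le_iff₀ (by positivity)] at h2
    have h9 : (ε * (J * (p : ℝ) ^ 2)) ^ r ≤ B * C :=
      (pow_le_pow_left₀ (by positivity) hcard r).trans h6
    obtain ⟨t, rfl⟩ : ∃ t, r = t + 2 := ⟨r - 2, by omega⟩
    have h10 : Real.sqrt p ^ 7 * ((p : ℝ) ^ 2) ^ t * Real.sqrt p = (p ^ 2) ^ (t + 2) := by
      have h11 : Real.sqrt p ^ 7 * ((p : ℝ) ^ 2) ^ t * Real.sqrt p =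
          (Real.sqrt p ^ 2) ^ 4 * ((p : ℝ) ^ 2) ^ t := by ring
      rw [h11, hsq]; ring
    simp only [Nat.add_sub_cancel]
    rw [← mul_le_mul_iff_right₀ (show (0:ℝ) < 3 * B * Real.sqrt p by positivity)]
    calc 3 * B * Real.sqrt p * (J ^ (t + 2) * (K * (Real.sqrt p ^ 7 * ((p : ℝ) ^ 2) ^ t)))
        = (3 * K * B) * J ^ (t + 2) * (Real.sqrt p ^ 7 * ((p : ℝ) ^ 2) ^ t * Real.sqrt p) := by ring
      _ ≤ (Real.sqrt p * ε ^ (t + 2 + 1)) * J ^ (t + 2) *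
          (Real.sqrt p ^ 7 * ((p : ℝ) ^ 2) ^ t * Real.sqrt p) := by gcongr
      _ = Real.sqrt p * ε * (ε * (J * (p : ℝ) ^ 2)) ^ (t + 2) := by rw [h10]; ring
      _ ≤ Real.sqrt p * ε * (B * C) := by gcongr
      _ = _ := by ring
  have e3 : γ * ((r : ℝ) ^ 2 * S.card ^ r / (ε * J)) ≤ ε / 3 * C := by
    refine le_trans ?_ e1
    exact mul_le_of_le_one_left (by positivity) hγ1
  have e4 : (piR r - ε / 3) * C ≤ γ * C := mul_le_mul_of_nonneg_right h1 hC0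
  rw [mul_sub]
  linarith

end

section

theorem trim_sum (f : ℕ → ℝ) (a : ℝ) (s : ℕ) : ∀ k (S : Finset ℕ), S.card = s + k →
    a * S.card ≤ ∑ x ∈ S, f x → ∃ S' ⊆ S, S'.card = s ∧ a * s ≤ ∑ x ∈ S', f x := by
  intro k
  induction k with
  | zero =>
    intro S hS h
    refine ⟨S, subset_rfl, hS, ?_⟩
    rw [hS] at h
    simpa using h
  | succ k ih =>
    intro S hS h
    have hne : S.Nonempty := by
      rw [← Finset.card_pos]; omega
    obtain ⟨x, hx, hmin⟩ := Finset.exists_min_image S f hne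
    have hcard : (S.erase x).card = s + k := by
      rw [Finset.card_erase_of_mem hx]; omega
    have hsum : f x + ∑ y ∈ S.erase x, f y = ∑ y ∈ S, f y := Finset.add_sum_erase S f hx
    have hcc : (S.card : ℝ) = (S.erase x).card + 1 := by
      rw [hcard, hS]; push_cast; ring
    obtain ⟨S', h1, h2, h3⟩ := ih (S.erase x) hcard (by
      by_cases hfx : f x ≤ a
      · rw [hcc] at h
        linarith
      · push Not at hfx
        have := Finset.card_nsmul_le_sum (S.erase x) f a (fun y hy =>
          hfx.le.trans (hmin y (Finset.mem_of_mem_erase hy)))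
        rw [nsmul_eq_mul] at this
        linarith)
    exact ⟨S', h1.trans (Finset.erase_subset _ _), h2, h3⟩

theorem eb_sum (A : ℕ → ℕ → Prop) (S T : Finset ℕ) :
    (eb A S T : ℝ) = ∑ u ∈ S, (eb A {u} T : ℝ) := by
  classical
  unfold eb
  rw [← Nat.cast_sum]
  congr 1
  rw [Finset.card_filter, Finset.sum_product]
  refine Finset.sum_congr rfl fun u _ => ?_
  rw [Finset.card_filter, Finset.sum_product, Finset.sum_singleton]

theorem eb_sum' (A : ℕ → ℕ → Prop) (S T : Finset ℕ) :
    (eb A S T : ℝ) = ∑ v ∈ T, (eb A S {v} : ℝ) := by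
  classical
  unfold eb
  rw [← Nat.cast_sum]
  congr 1
  rw [Finset.card_filter, Finset.sum_product_right]
  refine Finset.sum_congr rfl fun u _ => ?_
  rw [Finset.card_filter, Finset.sum_product_right, Finset.sum_singleton]

theorem eb_le (A : ℕ → ℕ → Prop) (S T : Finset ℕ) : (eb A S T : ℝ) ≤ S.card * T.card := by
  classical
  unfold eb
  rw [← Nat.cast_mul, ← Finset.card_product]
  exact_mod_cast Finset.card_filter_le _ _

theorem eb_split (A : ℕ → ℕ → Prop) {S X : Finset ℕ} (h : S ⊆ X) (T : Finset ℕ) :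
    (eb A X T : ℝ) = eb A S T + eb A (X \ S) T := by
  rw [eb_sum A X, eb_sum A S, eb_sum A (X \ S), add_comm, Finset.sum_sdiff h]

theorem eb_split' (A : ℕ → ℕ → Prop) (S : Finset ℕ) {T Y : Finset ℕ} (h : T ⊆ Y) :
    (eb A S Y : ℝ) = eb A S T + eb A S (Y \ T) := by
  rw [eb_sum' A S Y, eb_sum' A S T, eb_sum' A S (Y \ T), add_comm, Finset.sum_sdiff h]

theorem trim_box (A : ℕ → ℕ → Prop) (S T : Finset ℕ) (d : ℝ) (s : ℕ) (hS : s ≤ S.card)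
    (hT : s ≤ T.card) (h : d * (S.card * T.card) ≤ eb A S T) :
    ∃ S' ⊆ S, ∃ T' ⊆ T, S'.card = s ∧ T'.card = s ∧ d * ((s : ℝ) * s) ≤ eb A S' T' := by
  obtain ⟨S', h1, h2, h3⟩ := trim_sum (fun u => (eb A {u} T : ℝ)) (d * T.card) s (S.card - s) S
    (by omega) (by rw [← eb_sum]; linarith)
  rw [← eb_sum] at h3
  obtain ⟨T', h4, h5, h6⟩ := trim_sum (fun v => (eb A S' {v} : ℝ)) (d * s) s (T.card - s) T
    (by omega) (by rw [← eb_sum']; linarith)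
  rw [← eb_sum'] at h6
  exact ⟨S', h1, T', h4, h2, h5, by linarith⟩

/-- Regularity with additive error. -/
def Reg (A : ℕ → ℕ → Prop) (X Y : Finset ℕ) (w E : ℝ) : Prop :=
  ∀ S ⊆ X, ∀ T ⊆ Y, (eb A S T : ℝ) ≤ w * (S.card * T.card) + E ∧
    w * (S.card * T.card) - E ≤ eb A S T

theorem Reg.mono {A : ℕ → ℕ → Prop} {X Y X' Y' : Finset ℕ} {w E E' : ℝ} (h : Reg A X Y w E)
    (hX : X' ⊆ X) (hY : Y' ⊆ Y) (hE : E ≤ E') : Reg A X' Y' w E' := by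
  intro S hS T hT
  obtain ⟨h1, h2⟩ := h S (hS.trans hX) T (hT.trans hY)
  exact ⟨by linarith, by linarith⟩

theorem reg_of_upper (A : ℕ → ℕ → Prop) (X Y : Finset ℕ) (s : ℕ) (hX : X.card = s) (hY : Y.card = s)
    (w ε : ℝ) (hε : 0 < ε) (hlow : (w - ε) * ((s : ℝ) * s) ≤ eb A X Y)
    (hup : ∀ S ⊆ X, ∀ T ⊆ Y, (eb A S T : ℝ) ≤ (w + ε) * (S.card * T.card) + ε * ((s : ℝ) * s)) :
    Reg A X Y w (4 * ε * ((s : ℝ) * s)) := by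
  intro S hS T hT
  have hSs : (S.card : ℝ) ≤ s := by rw [← hX]; exact_mod_cast Finset.card_le_card hS
  have hTs : (T.card : ℝ) ≤ s := by rw [← hY]; exact_mod_cast Finset.card_le_card hT
  have hST : (S.card : ℝ) * T.card ≤ s * s := mul_le_mul hSs hTs (by positivity) (by positivity)
  have hST0 : (0 : ℝ) ≤ (S.card : ℝ) * T.card := by positivity
  have hss : (0 : ℝ) ≤ (s : ℝ) * s := by positivity
  constructor
  · have h1 := hup S hS T hT
    have h2 := mul_le_mul_of_nonneg_left hST hε.le
    have h3 := mul_nonneg hε.le hss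
    linarith
  · have h1 := eb_split A hS Y
    have h2 := eb_split' A S hT
    have h3 := hup (X \ S) Finset.sdiff_subset Y subset_rfl
    have h4 := hup S hS (Y \ T) Finset.sdiff_subset
    have c1 : ((X \ S).card : ℝ) = s - S.card := by
      rw [Finset.card_sdiff_of_subset hS, Nat.cast_sub (Finset.card_le_card hS), hX]
    have c2 : ((Y \ T).card : ℝ) = s - T.card := by
      rw [Finset.card_sdiff_of_subset hT, Nat.cast_sub (Finset.card_le_card hT), hY]
    rw [c1, hY] at h3
    rw [c2] at h4
    have h5 := mul_nonneg hε.le hST0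
    have h6 := mul_nonneg hε.le hss
    nlinarith

theorem reg_one (ε : ℝ) (hε : 0 < ε) : ∃ c : ℝ, 0 < c ∧ ∀ (A : ℕ → ℕ → Prop) (X Y : Finset ℕ) (n : ℕ),
    1 ≤ n → X.card = n → Y.card = n → ∃ X' ⊆ X, ∃ Y' ⊆ Y, ∃ s : ℕ, 1 ≤ s ∧ c * n ≤ s ∧
      X'.card = s ∧ Y'.card = s ∧ ∃ w : ℝ, 0 ≤ w ∧ w ≤ 1 ∧ Reg A X' Y' w (ε * ((s : ℝ) * s)) := by
  obtain ⟨δ, hδ0, hδ1, hδ⟩ : ∃ δ : ℝ, 0 < δ ∧ δ ≤ 1 ∧ 8 * δ ≤ ε :=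
    ⟨min 1 (ε / 8), by positivity, min_le_left _ _, by linarith [min_le_right 1 (ε / 8)]⟩
  have main : ∀ j : ℕ, ∃ c : ℝ, 0 < c ∧ ∀ (A : ℕ → ℕ → Prop) (X Y : Finset ℕ) (n : ℕ),
    1 ≤ n → X.card = n → Y.card = n → (1 - j * δ) * ((n : ℝ) * n) ≤ eb A X Y →
      ∃ X' ⊆ X, ∃ Y' ⊆ Y, ∃ s : ℕ, 1 ≤ s ∧ c * n ≤ s ∧
      X'.card = s ∧ Y'.card = s ∧ ∃ w : ℝ, 0 ≤ w ∧ w ≤ 1 ∧ Reg A X' Y' w (ε * ((s : ℝ) * s)) := by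
    intro j
    induction j with
    | zero =>
      refine ⟨1, one_pos, ?_⟩
      intro A X Y n hn hX hY h
      refine ⟨X, subset_rfl, Y, subset_rfl, n, hn, by simp, hX, hY, 1, by norm_num, by norm_num, ?_⟩
      have hnn : (0 : ℝ) ≤ (n : ℝ) * n := by positivity
      have hnd := mul_nonneg hδ0.le hnn
      refine (reg_of_upper A X Y n hX hY 1 δ hδ0 ?_ ?_).mono subset_rfl subset_rfl ?_
      · push_cast at h; linarith
      · intro S _ T _
        have := eb_le A S T
        have h2 : 0 ≤ δ * ((S.card : ℝ) * T.card) := by positivity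
        linarith
      · have := mul_le_mul_of_nonneg_right hδ hnn; linarith
    | succ j ih =>
      obtain ⟨c, hc, ih⟩ := ih
      refine ⟨min 1 (δ * c), by positivity, ?_⟩
      intro A X Y n hn hX hY h
      have hn' : (1 : ℝ) ≤ n := by exact_mod_cast hn
      have hnn : (0 : ℝ) < (n : ℝ) * n := by positivity
      by_cases hup : ∀ S ⊆ X, ∀ T ⊆ Y, (eb A S T : ℝ) ≤
          ((1 - j * δ) + δ) * (S.card * T.card) + δ * ((n : ℝ) * n)
      · by_cases hw : 0 ≤ 1 - j * δ
        · refine ⟨X, subset_rfl, Y, subset_rfl, n, hn, ?_, hX, hY, 1 - j * δ, hw, ?_, ?_⟩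
          · exact mul_le_of_le_one_left (by positivity) (min_le_left _ _)
          · have : 0 ≤ (j : ℝ) * δ := by positivity
            linarith
          refine (reg_of_upper A X Y n hX hY (1 - j * δ) δ hδ0 ?_ hup).mono subset_rfl subset_rfl ?_
          · push_cast at h; linarith
          · have h8 := mul_le_mul_of_nonneg_right hδ hnn.le
            have := mul_nonneg hδ0.le hnn.le
            linarith
        · push Not at hw
          refine (ih A X Y n hn hX hY (le_trans ?_ (Nat.cast_nonneg _))).imp fun X' h => ⟨h.1, ?_⟩
          · exact mul_nonpos_of_nonpos_of_nonneg hw.le hnn.le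
          obtain ⟨Y', hY', s, h1, h2, h3⟩ := h.2
          refine ⟨Y', hY', s, h1, ?_, h3⟩
          refine le_trans ?_ h2
          gcongr
          exact (min_le_right _ _).trans (mul_le_of_le_one_left hc.le hδ1)
      · push Not at hup
        obtain ⟨S, hS, T, hT, hlt⟩ := hup
        by_cases hw : 0 ≤ 1 - j * δ
        · have h1 := eb_le A S T
          have hSn : (S.card : ℝ) ≤ n := by rw [← hX]; exact_mod_cast Finset.card_le_card hS
          have hTn : (T.card : ℝ) ≤ n := by rw [← hY]; exact_mod_cast Finset.card_le_card hT
          have hp : 0 ≤ (1 - j * δ + δ) * ((S.card : ℝ) * T.card) := by positivity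
          have h2 : δ * ((n : ℝ) * n) < S.card * T.card := by linarith
          have hSd : δ * n ≤ S.card := by
            have h3 : (S.card : ℝ) * T.card ≤ S.card * n := by gcongr
            have h4 : δ * n * n < S.card * n := by linarith
            exact (lt_of_mul_lt_mul_right h4 (by positivity)).le
          have hTd : δ * n ≤ T.card := by
            have h3 : (S.card : ℝ) * T.card ≤ n * T.card := by gcongr
            have h4 : δ * n * n < T.card * n := by linarith
            exact (lt_of_mul_lt_mul_right h4 (by positivity)).le
          obtain ⟨S', hS', T', hT', hSc, hTc, hd⟩ := trim_box A S T (1 - j * δ) ⌈δ * n⌉₊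
            (Nat.ceil_le.mpr hSd) (Nat.ceil_le.mpr hTd) (by
              have h5 : 0 ≤ δ * ((S.card : ℝ) * T.card) := by positivity
              have h6 : 0 ≤ δ * ((n : ℝ) * n) := by positivity
              linarith)
          obtain ⟨X', hX', Y', hY', s, g1, g2, g3⟩ := ih A S' T' ⌈δ * n⌉₊
            (Nat.one_le_iff_ne_zero.mpr (Nat.ceil_pos.mpr (by positivity)).ne') hSc hTc hd
          refine ⟨X', (hX'.trans hS').trans hS, Y', (hY'.trans hT').trans hT, s, g1, ?_, g3⟩
          refine le_trans ?_ g2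
          calc min 1 (δ * c) * n ≤ δ * c * n := by gcongr; exact min_le_right _ _
            _ = c * (δ * n) := by ring
            _ ≤ c * ⌈δ * n⌉₊ := by gcongr; exact Nat.le_ceil _
        · push Not at hw
          refine (ih A X Y n hn hX hY (le_trans ?_ (Nat.cast_nonneg _))).imp fun X' h => ⟨h.1, ?_⟩
          · exact mul_nonpos_of_nonpos_of_nonneg hw.le hnn.le
          obtain ⟨Y', hY', s, h1, h2, h3⟩ := h.2
          refine ⟨Y', hY', s, h1, ?_, h3⟩
          refine le_trans ?_ h2
          gcongr
          exact (min_le_right _ _).trans (mul_le_of_le_one_left hc.le hδ1)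
  obtain ⟨j, hj⟩ : ∃ j : ℕ, 1 / δ ≤ j := exists_nat_ge _
  obtain ⟨c, hc, h⟩ := main j
  refine ⟨c, hc, fun A X Y n hn hX hY => h A X Y n hn hX hY (le_trans ?_ (Nat.cast_nonneg _))⟩
  rw [div_le_iff₀ hδ0] at hj
  exact mul_nonpos_of_nonpos_of_nonneg (by linarith) (by positivity)

/-- Simultaneous regularisation. -/
theorem reg_many {ι : Type*} [DecidableEq ι] (L : ℕ) : ∀ (ε : ℝ), 0 < ε →
    ∃ c : ℝ, 0 < c ∧ c ≤ 1 ∧ ∀ (A : Fin L → ℕ → ℕ → Prop) (i j : Fin L → ι), (∀ l, i l ≠ j l) →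
    ∀ (V : ι → Finset ℕ) (n : ℕ), 1 ≤ n → (∀ a, (V a).card = n) →
    ∃ V' : ι → Finset ℕ, (∀ a, V' a ⊆ V a) ∧ ∃ s : ℕ, 1 ≤ s ∧ c * n ≤ s ∧ (∀ a, (V' a).card = s) ∧
      ∃ w : Fin L → ℝ, ∀ l, 0 ≤ w l ∧ w l ≤ 1 ∧
        Reg (A l) (V' (i l)) (V' (j l)) (w l) (ε * ((s : ℝ) * s)) := by
  induction L with
  | zero =>
    intro ε _
    refine ⟨1, one_pos, le_rfl, ?_⟩
    intro A i j _ V n hn hV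
    exact ⟨V, fun _ => subset_rfl, n, hn, by simp, hV, fun _ => 0, fun l => l.elim0⟩
  | succ L ih =>
    intro ε hε
    obtain ⟨c, hc, hc1, ih⟩ := ih ε hε
    obtain ⟨c1, hc1', h1⟩ := reg_one (ε * c ^ 2) (by positivity)
    refine ⟨min 1 (c * c1), by positivity, min_le_left _ _, ?_⟩
    intro A i j hij V n hn hV
    obtain ⟨X', hX', Y', hY', s1, g1, g2, g3, g4, w, hw0, hw1, hreg⟩ :=
      h1 (A 0) (V (i 0)) (V (j 0)) n hn (hV _) (hV _)
    have hs1n : s1 ≤ n := by rw [← g3, ← hV (i 0)]; exact Finset.card_le_card hX'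
    have htrim : ∀ a, ∃ W ⊆ V a, W.card = s1 := fun a =>
      Finset.exists_subset_card_eq (by rw [hV]; exact hs1n)
    choose W hW hWc using htrim
    let V1 : ι → Finset ℕ := fun a => if a = i 0 then X' else if a = j 0 then Y' else W a
    have hV1i : V1 (i 0) = X' := by simp [V1]
    have hV1j : V1 (j 0) = Y' := by simp [V1, (hij 0).symm]
    have hV1 : ∀ a, V1 a ⊆ V a := by
      intro a
      simp only [V1]
      split_ifs with h h'
      · rw [h]; exact hX'
      · rw [h']; exact hY'
      · exact hW a
    have hV1c : ∀ a, (V1 a).card = s1 := by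
      intro a
      simp only [V1]
      split_ifs with h h'
      · exact g3
      · exact g4
      · exact hWc a
    obtain ⟨V', hV', s, k1, k2, k3, w', hw'⟩ := ih (fun l => A l.succ) (fun l => i l.succ)
      (fun l => j l.succ) (fun l => hij _) V1 s1 g1 hV1c
    refine ⟨V', fun a => (hV' a).trans (hV1 a), s, k1, ?_, k3, Fin.cons w w', ?_⟩
    · calc min 1 (c * c1) * n ≤ c * c1 * n := by gcongr; exact min_le_right _ _
        _ = c * (c1 * n) := by ring
        _ ≤ c * s1 := by gcongr
        _ ≤ s := k2
    · intro l
      refine Fin.cases ?_ ?_ l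
      · simp only [Fin.cons_zero]
        refine ⟨hw0, hw1, hreg.mono ((hV' _).trans hV1i.le) ((hV' _).trans hV1j.le) ?_⟩
        calc ε * c ^ 2 * ((s1 : ℝ) * s1) = ε * ((c * s1) * (c * s1)) := by ring
          _ ≤ ε * ((s : ℝ) * s) := by gcongr
      · intro l
        simp only [Fin.cons_succ]
        exact hw' l

end

section

/-- The edge with two specified vertices. -/
def ed {m : ℕ} (u v : ℕ) (w : Fin m → ℕ) : Finset ℕ := insert u (insert v (Finset.univ.image w))

theorem image_EE {m : ℕ} (b : Bool) (y : Lab m → ℕ) : (EE m b).image y =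
    ed (y (Sum.inl 0)) (y (Sum.inl 1)) (fun j => y (Sum.inr (b, j))) := by
  ext x
  simp only [ed, Finset.mem_image, Finset.mem_insert, Finset.mem_univ, true_and]
  constructor
  · rintro ⟨a, ha, rfl⟩
    rcases a with z | ⟨c, j⟩
    · fin_cases z
      · left; rfl
      · right; left; rfl
    · rw [inr_mem_EE] at ha
      subst ha
      right; right; exact ⟨j, rfl⟩
  · rintro (rfl | rfl | ⟨j, rfl⟩)
    · exact ⟨_, inl_mem_EE m b 0, rfl⟩
    · exact ⟨_, inl_mem_EE m b 1, rfl⟩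
    · exact ⟨_, (inr_mem_EE m b b j).mpr rfl, rfl⟩

open Classical in
/-- Completions of a pair in a given role. -/
noncomputable def comps {m : ℕ} (H : RGraph (m + 2)) (V : Finset ℕ) (α β u v : ℕ) :
    Finset (Fin m → ℕ) :=
  (Fintype.piFinset (fun _ : Fin m => V)).filter
    (fun w => ed u v w ∈ H.edges ∧ rkk (ed u v w) u = α ∧ rkk (ed u v w) v = β)

/-- Pairs with many completions in a given role. -/
def Ar {m : ℕ} (H : RGraph (m + 2)) (V : Finset ℕ) (δ : ℝ) (α β u v : ℕ) : Prop :=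
  u < v ∧ δ * (V.card : ℝ) ^ m ≤ (comps H V α β u v).card

open Classical in
/-- Homomorphic twin pairs with given order pattern. -/
noncomputable def TT {m : ℕ} (H : RGraph (m + 2)) (lam : Lab m → Fin (2 * m + 2))
    (S : Lab m → Finset ℕ) : Finset (Lab m → ℕ) :=
  (Fintype.piFinset S).filter (fun y => (∀ a b, lam a < lam b → y a < y b) ∧
    ∀ b, (EE m b).image y ∈ H.edges)

theorem overlap {m : ℕ} (H : RGraph (m + 2)) (V : Finset ℕ) (δ κ : ℝ) (hδ : 0 < δ)
    (hV : 1 ≤ V.card)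
    (hT : ∀ lam : Sg m, ((TT H lam.1 (fun _ => V)).card : ℝ) ≤ κ * (V.card : ℝ) ^ (2 * m + 2))
    (α β α' β' : ℕ) (hne : (α, β) ≠ (α', β')) :
    δ ^ 2 * (eb (fun u v => Ar H V δ α β u v ∧ Ar H V δ α' β' u v) V V : ℝ) ≤
      (((2 * m + 2 : ℕ) : ℝ) ^ 2 / V.card + Nat.card (Sg m) * κ) * (V.card : ℝ) ^ 2 := by
  classical
  set N : ℝ := (V.card : ℝ) with hN
  have hN1 : 1 ≤ N := by rw [hN]; exact_mod_cast hV
  have hN0 : 0 < N := by linarith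
  set O := (V ×ˢ V).filter (fun p : ℕ × ℕ => Ar H V δ α β p.1 p.2 ∧ Ar H V δ α' β' p.1 p.2) with hO
  have hOe : eb (fun u v => Ar H V δ α β u v ∧ Ar H V δ α' β' u v) V V = O.card := by
    unfold eb; rw [hO]; congr
  let bad := (Fintype.piFinset (fun _ : Lab m => V)).filter
    (fun y => ¬ Function.Injective (fun a => id (y a)))
  let X : Finset (Lab m → ℕ) := bad ∪ Finset.univ.biUnion (fun lam : Sg m => TT H lam.1 (fun _ => V))
  have hbad : N * (bad.card : ℝ) ≤ ((2 * m + 2 : ℕ) : ℝ) ^ 2 * N ^ (2 * m + 2) := by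
    have := noncross_tuples (α := Lab m) V id N hN0.le (fun u hu => by
      have : (V.filter (fun v => id v = id u)) = {u} := by
        ext v; simp only [id, Finset.mem_filter, Finset.mem_singleton]
        exact ⟨fun h => h.2, fun h => ⟨h ▸ hu, h⟩⟩
      rw [this]; simp [hN])
    rw [card_lab] at this
    exact this
  have hXc : (X.card : ℝ) ≤ bad.card + Nat.card (Sg m) * (κ * N ^ (2 * m + 2)) := by
    have h1 : X.card ≤ bad.card + ∑ lam : Sg m, (TT H lam.1 (fun _ => V)).card :=
      (Finset.card_union_le _ _).trans (Nat.add_le_add_left Finset.card_biUnion_le _)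
    have h2 : (X.card : ℝ) ≤ bad.card + ∑ lam : Sg m, ((TT H lam.1 (fun _ => V)).card : ℝ) := by
      exact_mod_cast h1
    refine h2.trans (add_le_add le_rfl ?_)
    refine (Finset.sum_le_sum fun lam _ => hT lam).trans ?_
    rw [Finset.sum_const, nsmul_eq_mul, Finset.card_univ, Nat.card_eq_fintype_card]
  let Y : Finset (Σ _ : ℕ × ℕ, (Fin m → ℕ) × (Fin m → ℕ)) :=
    O.sigma (fun p => comps H V α β p.1 p.2 ×ˢ comps H V α' β' p.1 p.2)
  have hYX : Y.card ≤ X.card := by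
    refine Finset.card_le_card_of_injOn
      (fun t => (Sum.elim (fun z : Fin 2 => if z = 0 then t.1.1 else t.1.2)
        (fun bj : Bool × Fin m => if bj.1 = true then t.2.1 bj.2 else t.2.2 bj.2) : Lab m → ℕ)) ?_ ?_
    · rintro ⟨⟨u, v⟩, w, w'⟩ ht
      simp only [Y, Finset.coe_sigma, Set.mem_sigma_iff, Finset.mem_coe, hO, Finset.mem_filter,
        Finset.mem_product, comps, Fintype.mem_piFinset] at ht
      obtain ⟨⟨⟨hu, hv⟩, ⟨huv, -⟩, -⟩, ⟨hw, he, hα, hβ⟩, ⟨hw', he', hα', hβ'⟩⟩ := ht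
      set y : Lab m → ℕ := Sum.elim (fun z : Fin 2 => if z = 0 then u else v)
        (fun bj : Bool × Fin m => if bj.1 = true then w bj.2 else w' bj.2) with hy
      have hyV : y ∈ Fintype.piFinset (fun _ : Lab m => V) := by
        rw [Fintype.mem_piFinset]
        rintro (z | ⟨b, j⟩)
        · simp only [hy, Sum.elim_inl]; split_ifs <;> assumption
        · simp only [hy, Sum.elim_inr]; split_ifs
          · exact hw j
          · exact hw' j
      have hyt : (EE m true).image y = ed u v w := by rw [image_EE]; simp [hy]
      have hyf : (EE m false).image y = ed u v w' := by rw [image_EE]; simp [hy]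
      have hyu : y (Sum.inl 0) = u := by simp [hy]
      have hyv : y (Sum.inl 1) = v := by simp [hy]
      rw [Finset.mem_coe]
      change y ∈ X
      by_cases hinj : Function.Injective y
      · apply Finset.mem_union_right
        obtain ⟨o, ho, hoy⟩ := exists_rank (2 * m + 2) (card_lab m) y hinj
        have hinc : Incons y := by
          by_contra hcon
          unfold Incons at hcon
          push Not at hcon
          have h0 := hcon 0
          have h1 := hcon 1
          rw [← rkk_image y hinj, ← rkk_image y hinj, hyt, hyf] at h0 h1
          rw [hyu, hα, hα'] at h0
          rw [hyv, hβ, hβ'] at h1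
          exact hne (by rw [h0, h1])
        refine Finset.mem_biUnion.mpr ⟨⟨o, ho, hinc.congr fun a b => (hoy a b).symm⟩,
          Finset.mem_univ _, ?_⟩
        refine Finset.mem_filter.mpr ⟨hyV, fun a b h => (hoy a b).mp h, ?_⟩
        intro b
        cases b
        · rw [hyf]; exact he'
        · rw [hyt]; exact he
      · apply Finset.mem_union_left
        exact Finset.mem_filter.mpr ⟨hyV, hinj⟩
    · rintro ⟨⟨u, v⟩, w, w'⟩ - ⟨⟨u', v'⟩, w1, w1'⟩ - h
      have h1 := congrFun h (Sum.inl 0)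
      have h2 := congrFun h (Sum.inl 1)
      have h3 : w = w1 := funext fun j => by simpa using congrFun h (Sum.inr (true, j))
      have h4 : w' = w1' := funext fun j => by simpa using congrFun h (Sum.inr (false, j))
      simp at h1 h2
      subst h1 h2 h3 h4
      rfl
  have hYl : (O.card : ℝ) * (δ ^ 2 * N ^ (2 * m)) ≤ Y.card := by
    simp only [Y, Finset.card_sigma, Finset.card_product]
    push_cast
    rw [← nsmul_eq_mul]
    refine Finset.card_nsmul_le_sum _ _ _ fun p hp => ?_
    have hp2 := (Finset.mem_filter.mp hp).2
    calc δ ^ 2 * N ^ (2 * m) = (δ * N ^ m) * (δ * N ^ m) := by ring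
      _ ≤ _ := mul_le_mul hp2.1.2 hp2.2.2 (by positivity) (by positivity)
  rw [hOe]
  have hYX' : (Y.card : ℝ) ≤ X.card := by exact_mod_cast hYX
  have hfin : (O.card : ℝ) * (δ ^ 2 * N ^ (2 * m)) ≤
      (((2 * m + 2 : ℕ) : ℝ) ^ 2 / N + Nat.card (Sg m) * κ) * N ^ 2 * N ^ (2 * m) := by
    have hb' : (bad.card : ℝ) ≤ ((2 * m + 2 : ℕ) : ℝ) ^ 2 * N ^ (2 * m + 2) / N := by
      rw [le_div_iff₀ hN0, mul_comm]; exact hbad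
    calc _ ≤ _ := hYl.trans (hYX'.trans hXc)
      _ ≤ ((2 * m + 2 : ℕ) : ℝ) ^ 2 * N ^ (2 * m + 2) / N +
          Nat.card (Sg m) * (κ * N ^ (2 * m + 2)) := by linarith
      _ = _ := by rw [pow_add]; ring
  have hpos : 0 < N ^ (2 * m) := by positivity
  refine le_of_mul_le_mul_right (a := N ^ (2 * m)) ?_ hpos
  calc _ = (O.card : ℝ) * (δ ^ 2 * N ^ (2 * m)) := by ring
    _ ≤ _ := hfin

/-- All pairs of the edge lie in the graph of their role. -/
def goodE {m : ℕ} (H : RGraph (m + 2)) (V : Finset ℕ) (δ : ℝ) (e : Finset ℕ) : Prop :=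
  ∀ u ∈ e, ∀ v ∈ e, u < v → Ar H V δ (rkk e u) (rkk e v) u v

theorem bad_edges {m : ℕ} (H : RGraph (m + 2)) (V : Finset ℕ) (δ : ℝ) (hδ : 0 < δ)
    [DecidablePred fun e => e ⊆ V ∧ ¬ goodE H V δ e] :
    ((H.edges.filter (fun e => e ⊆ V ∧ ¬ goodE H V δ e)).card : ℝ) ≤
      ((m + 2 : ℕ) : ℝ) ^ 2 * (δ * (V.card : ℝ) ^ (m + 2)) := by
  classical
  let r := m + 2
  let R : Finset (ℕ × ℕ) := Finset.range r ×ˢ Finset.range r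
  let P : Finset ((ℕ × ℕ) × (ℕ × ℕ)) := R ×ˢ (V ×ˢ V)
  let G : (ℕ × ℕ) × (ℕ × ℕ) → Finset (Finset ℕ) := fun t =>
    if (comps H V t.1.1 t.1.2 t.2.1 t.2.2).card < δ * (V.card : ℝ) ^ m then
      (comps H V t.1.1 t.1.2 t.2.1 t.2.2).image (fun w => ed t.2.1 t.2.2 w) else ∅
  have hsub : H.edges.filter (fun e => e ⊆ V ∧ ¬ goodE H V δ e) ⊆ P.biUnion G := by
    intro e he
    obtain ⟨heH, heV, hbad⟩ := Finset.mem_filter.mp he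
    unfold goodE at hbad
    push Not at hbad
    obtain ⟨u, hu, v, hv, huv, hA⟩ := hbad
    have hec := H.edges_card e heH
    have hlt : (comps H V (rkk e u) (rkk e v) u v).card < δ * (V.card : ℝ) ^ m := by
      by_contra hcon
      push Not at hcon
      exact hA ⟨huv, hcon⟩
    refine Finset.mem_biUnion.mpr ⟨((rkk e u, rkk e v), (u, v)), ?_, ?_⟩
    · simp only [P, R, Finset.mem_product, Finset.mem_range]
      refine ⟨⟨?_, ?_⟩, heV hu, heV hv⟩
      · have := rkk_lt_card hu; omega
      · have := rkk_lt_card hv; omega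
    · simp only [G]
      rw [if_pos hlt]
      have hc : ((e.erase u).erase v).card = m := by
        rw [Finset.card_erase_of_mem, Finset.card_erase_of_mem hu, hec]
        · rfl
        · exact Finset.mem_erase.mpr ⟨huv.ne', hv⟩
      let w : Fin m → ℕ := fun j => ((e.erase u).erase v).orderEmbOfFin hc j
      have hw : Finset.univ.image w = (e.erase u).erase v := by
        simp only [w]
        exact Finset.image_orderEmbOfFin_univ _ hc
      have hed : ed u v w = e := by
        unfold ed
        rw [hw, Finset.insert_erase (Finset.mem_erase.mpr ⟨huv.ne', hv⟩), Finset.insert_erase hu]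
      refine Finset.mem_image.mpr ⟨w, ?_, hed⟩
      refine Finset.mem_filter.mpr ⟨?_, ?_⟩
      · rw [Fintype.mem_piFinset]
        intro j
        have : w j ∈ (e.erase u).erase v := by
          rw [← hw]; exact Finset.mem_image_of_mem _ (Finset.mem_univ j)
        exact heV (Finset.mem_of_mem_erase (Finset.mem_of_mem_erase this))
      · rw [hed]; exact ⟨heH, rfl, rfl⟩
  have hG : ∀ t ∈ P, ((G t).card : ℝ) ≤ δ * (V.card : ℝ) ^ m := by
    intro t _
    simp only [G]
    split_ifs with h
    · refine le_trans ?_ h.le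
      exact_mod_cast Finset.card_image_le
    · simp; positivity
  have h1 : ((H.edges.filter (fun e => e ⊆ V ∧ ¬ goodE H V δ e)).card : ℝ) ≤
      ∑ t ∈ P, ((G t).card : ℝ) := by
    exact_mod_cast (Finset.card_le_card hsub).trans Finset.card_biUnion_le
  refine h1.trans ((Finset.sum_le_card_nsmul _ _ _ hG).trans ?_)
  rw [nsmul_eq_mul]
  simp only [P, R, Finset.card_product, Finset.card_range, r]
  apply le_of_eq
  push_cast
  ring

end

section

theorem rkk_mono (V : Finset ℕ) {u v : ℕ} (h : u ≤ v) : rkk V u ≤ rkk V v := by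
  unfold rkk
  apply Finset.card_le_card
  intro w hw
  simp only [Finset.mem_filter] at hw ⊢
  exact ⟨hw.1, hw.2.trans_le h⟩

theorem rkk_injOn (V : Finset ℕ) : Set.InjOn (rkk V) V := by
  intro u hu v hv h
  rcases lt_trichotomy u v with h1 | h1 | h1
  · have := rkk_lt hu h1; omega
  · exact h1
  · have := rkk_lt hv h1; omega

/-- Consecutive blocks of a finite set. -/
def block (V : Finset ℕ) (n i : ℕ) : Finset ℕ := V.filter (fun u => rkk V u / n = i)

theorem card_block (V : Finset ℕ) (n i : ℕ) (hn : 1 ≤ n) (h : (i + 1) * n ≤ V.card) :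
    (block V n i).card = n := by
  have himg : V.image (rkk V) = Finset.range V.card := by
    apply Finset.eq_of_subset_of_card_le
    · intro x hx
      obtain ⟨u, hu, rfl⟩ := Finset.mem_image.mp hx
      exact Finset.mem_range.mpr (rkk_lt_card hu)
    · rw [Finset.card_image_of_injOn (rkk_injOn V), Finset.card_range]
  have h2 : (block V n i).image (rkk V) = Finset.Ico (i * n) ((i + 1) * n) := by
    ext x
    simp only [block, Finset.mem_image, Finset.mem_filter, Finset.mem_Ico]
    constructor
    · rintro ⟨u, ⟨-, hu⟩, rfl⟩
      rw [Nat.div_eq_iff (by omega)] at hu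
      rw [add_mul, one_mul]
      exact ⟨hu.1, by omega⟩
    · rintro ⟨h1, h2⟩
      have : x ∈ V.image (rkk V) := by rw [himg]; exact Finset.mem_range.mpr (by omega)
      obtain ⟨u, hu, rfl⟩ := Finset.mem_image.mp this
      refine ⟨u, ⟨hu, ?_⟩, rfl⟩
      rw [Nat.div_eq_iff (by omega)]
      rw [add_mul, one_mul] at h2
      exact ⟨h1, by omega⟩
  have h3 := Finset.card_image_of_injOn (s := block V n i)
    ((rkk_injOn V).mono (Finset.coe_subset.mpr (Finset.filter_subset _ _)))
  rw [← h3, h2, Nat.card_Ico, add_mul, one_mul]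
  omega

theorem amgm {ι : Type*} (s : Finset ι) (hs : 0 < s.card) (z : ι → ℝ) (hz : ∀ i ∈ s, 0 ≤ z i) :
    ∏ i ∈ s, z i ≤ ((∑ i ∈ s, z i) / s.card) ^ s.card := by
  have h := Real.geom_mean_le_arith_mean s (fun _ => 1) z (fun _ _ => zero_le_one)
    (by simpa using hs) hz
  simp only [Real.rpow_one, Finset.sum_const, nsmul_eq_mul, mul_one, one_mul] at h
  have h0 : 0 ≤ ∏ i ∈ s, z i := Finset.prod_nonneg hz
  have h2 := pow_le_pow_left₀ (Real.rpow_nonneg h0 _) h s.card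
  rwa [Real.rpow_inv_natCast_pow h0 hs.ne'] at h2

theorem eb_eq_sum (A : ℕ → ℕ → Prop) (S T : Finset ℕ) [∀ u v, Decidable (A u v)] :
    (eb A S T : ℝ) = ∑ p ∈ S ×ˢ T, if A p.1 p.2 then (1 : ℝ) else 0 := by
  classical
  unfold eb
  rw [Finset.card_filter]
  push_cast
  refine Finset.sum_congr rfl fun p _ => ?_
  congr

theorem sum_eb_le {ι : Type*} [DecidableEq ι] (R : Finset ι) (A : ι → ℕ → ℕ → Prop) (S T : Finset ℕ) :
    ∑ p ∈ R, (eb (A p) S T : ℝ) ≤ S.card * T.card +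
      ∑ p ∈ R, ∑ p' ∈ R.erase p, (eb (fun u v => A p u v ∧ A p' u v) S T : ℝ) := by
  classical
  simp only [eb_eq_sum]
  have h1 : (S.card : ℝ) * T.card = ∑ p ∈ S ×ˢ T, (1 : ℝ) := by
    rw [Finset.sum_const, nsmul_eq_mul, mul_one, Finset.card_product]; push_cast; rfl
  have h2 : ∀ p ∈ R, ∑ p' ∈ R.erase p, ∑ t ∈ S ×ˢ T, (if A p t.1 t.2 ∧ A p' t.1 t.2 then (1 : ℝ) else 0) =
      ∑ t ∈ S ×ˢ T, ∑ p' ∈ R.erase p, (if A p t.1 t.2 ∧ A p' t.1 t.2 then (1 : ℝ) else 0) :=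
    fun p _ => Finset.sum_comm
  rw [Finset.sum_congr rfl h2, Finset.sum_comm, h1,
    Finset.sum_comm (s := R) (t := S ×ˢ T), ← Finset.sum_add_distrib]
  refine Finset.sum_le_sum fun t _ => ?_
  have hnn : ∀ p ∈ R, 0 ≤ ∑ p' ∈ R.erase p, (if A p t.1 t.2 ∧ A p' t.1 t.2 then (1 : ℝ) else 0) :=
    fun p _ => Finset.sum_nonneg fun p' _ => by split_ifs <;> norm_num
  by_cases h : ∃ p0 ∈ R, A p0 t.1 t.2
  · obtain ⟨p0, hp0, hA⟩ := h
    rw [← Finset.add_sum_erase R _ hp0, if_pos hA]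
    refine add_le_add le_rfl ?_
    refine le_trans ?_ (Finset.single_le_sum hnn hp0)
    refine Finset.sum_le_sum fun p' _ => ?_
    simp [hA]
  · push Not at h
    rw [Finset.sum_eq_zero (fun p hp => if_neg (h p hp))]
    have := Finset.sum_nonneg hnn
    linarith

theorem cross_upper (r : ℕ) (hr : 2 ≤ r) (I : Finset ℕ) (hI : 0 < I.card) (V : ℕ → Finset ℕ) (s : ℕ)
    (hV : ∀ i ∈ I, (V i).card = s) (blk : ℕ → ℕ) (hblk : ∀ i ∈ I, ∀ v ∈ V i, blk v = i)
    (hmono : ∀ u v, u ≤ v → blk u ≤ blk v) (φ : Finset ℕ → Prop) [DecidablePred φ]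
    (A : Fin r × Fin r → ℕ → ℕ → Prop) (W : Fin r × Fin r → ℝ) (hW0 : ∀ p, 0 ≤ W p)
    (hW2 : ∀ p, W p ≤ 2) (ε : ℝ) (hε : 0 ≤ ε)
    (hA : ∀ p ∈ Qall r, ∀ i ∈ I, ∀ j ∈ I, i < j → ∀ S ⊆ V i, ∀ T ⊆ V j,
      (eb (A p) S T : ℝ) ≤ W p * (S.card * T.card) + ε * ((s : ℝ) * s))
    (hφ : ∀ x : Fin r → ℕ, StrictMono x → φ (Finset.univ.image x) →
      ∀ p ∈ Qall r, A p (x p.1) (x p.2)) :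
    (((Finset.powersetCard r (I.biUnion V)).filter φ).card : ℝ) ≤
      (r : ℝ) ^ 2 * ((I.card * s : ℕ) : ℝ) ^ r / I.card +
      ((I.card * s).choose r : ℝ) * (∏ p ∈ Qall r, W p + 3 ^ (r.choose 2) * ε) := by
  classical
  set U := I.biUnion V with hU
  have hfil : ∀ i ∈ I, U.filter (fun v => blk v = i) = V i := by
    intro i hi
    ext v
    simp only [hU, Finset.mem_filter, Finset.mem_biUnion]
    constructor
    · rintro ⟨⟨j, hj, hv⟩, hb⟩
      rw [hblk j hj v hv] at hb
      exact hb ▸ hv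
    · intro hv
      exact ⟨⟨i, hi, hv⟩, hblk i hi v hv⟩
  have hUc : U.card = I.card * s := by
    rw [hU, Finset.card_biUnion, Finset.sum_congr rfl hV, Finset.sum_const, smul_eq_mul]
    intro i hi j hj hij
    change Disjoint (V i) (V j)
    rw [Finset.disjoint_left]
    intro v hv hv'
    exact hij ((hblk i hi v hv).symm.trans (hblk j hj v hv'))
  have hbI : ∀ u ∈ U, blk u ∈ I := by
    intro u hu
    obtain ⟨i, hi, hv⟩ := Finset.mem_biUnion.mp hu
    rw [hblk i hi u hv]; exact hi
  have hI0 : (0 : ℝ) < I.card := by exact_mod_cast hI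
  have hnc := noncross_sets r U blk I.card hI0.le (fun u hu => by
    rw [hfil _ (hbI u hu), hV _ (hbI u hu), hUc]; push_cast; rfl)
  rw [hUc] at hnc
  have hc1 := cross_bij r U blk (fun u _ v _ h => hmono u v h) φ
  have hc2 := cross_fiber r U I blk hbI (fun x => φ (Finset.univ.image x))
  have hc3 := cross_bij r U blk (fun u _ v _ h => hmono u v h) (fun _ => True)
  have hc4 := cross_fiber r U I blk hbI (fun _ => True)
  simp only [and_true, Finset.filter_true] at hc3 hc4
  set TS := (Fintype.piFinset (fun _ : Fin r => I)).filter (fun t => StrictMono t) with hTS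
  have hpi : ∀ t ∈ TS, (Fintype.piFinset (fun i => U.filter (fun v => blk v = t i))).card = s ^ r := by
    intro t ht
    have ht1 := Fintype.mem_piFinset.mp (Finset.mem_filter.mp ht).1
    rw [Fintype.card_piFinset]
    rw [Finset.prod_congr rfl (fun i _ => by rw [hfil _ (ht1 i), hV _ (ht1 i)])]
    simp
  set Z : ℝ := ∏ p ∈ Qall r, W p + 3 ^ (r.choose 2) * ε with hZ
  have hZ0 : 0 ≤ Z := by
    have : 0 ≤ ∏ p ∈ Qall r, W p := Finset.prod_nonneg fun p _ => hW0 p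
    positivity
  have hup : ∀ t ∈ TS, (((Fintype.piFinset (fun i => U.filter (fun v => blk v = t i))).filter
      (fun x => φ (Finset.univ.image x))).card : ℝ) ≤ (s : ℝ) ^ r * Z := by
    intro t ht
    have ht1 := Fintype.mem_piFinset.mp (Finset.mem_filter.mp ht).1
    have ht2 : StrictMono t := (Finset.mem_filter.mp ht).2
    have h1 := cnt_upper (fun i => U.filter (fun v => blk v = t i)) s
      (fun i => by rw [hfil _ (ht1 i), hV _ (ht1 i)]) A W (ε * ((s : ℝ) * s)) hW0 hW2 (by positivity)
      (Qall r) (fun p hp => (Finset.mem_filter.mp hp).2) (by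
        intro p hp S hS T hT
        rw [hfil _ (ht1 _)] at hS
        rw [hfil _ (ht1 _)] at hT
        exact hA p hp _ (ht1 _) _ (ht1 _) (ht2 (Finset.mem_filter.mp hp).2) S hS T hT)
    have h2 : (((Fintype.piFinset (fun i => U.filter (fun v => blk v = t i))).filter
      (fun x => φ (Finset.univ.image x))).card) ≤
        cnt (fun i => U.filter (fun v => blk v = t i)) A (Qall r) := by
      apply card_le_cnt
      intro x hx
      obtain ⟨hx1, hx2⟩ := Finset.mem_filter.mp hx
      refine ⟨hx1, hφ x ?_ hx2⟩
      have hx3 := Fintype.mem_piFinset.mp hx1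
      intro i j hij
      by_contra hcon
      push Not at hcon
      have h3 := hmono _ _ hcon
      rw [(Finset.mem_filter.mp (hx3 i)).2, (Finset.mem_filter.mp (hx3 j)).2] at h3
      have := ht2 hij
      omega
    have h3 : (((Fintype.piFinset (fun i => U.filter (fun v => blk v = t i))).filter
      (fun x => φ (Finset.univ.image x))).card : ℝ) ≤
        cnt (fun i => U.filter (fun v => blk v = t i)) A (Qall r) := by exact_mod_cast h2
    refine h3.trans (h1.trans ?_)
    rw [hpi t ht, card_Qall]
    obtain ⟨q, rfl⟩ : ∃ q, r = q + 2 := ⟨r - 2, by omega⟩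
    apply le_of_eq
    rw [hZ]
    simp only [Nat.add_sub_cancel]
    push_cast
    ring
  have hsum := Finset.sum_le_sum hup
  rw [← Nat.cast_sum, ← hc2, ← hc1, ← Finset.sum_mul] at hsum
  have hle : (∑ t ∈ TS, (s : ℝ) ^ r) ≤ ((I.card * s).choose r : ℝ) := by
    have h5 : (∑ t ∈ TS, (s : ℝ) ^ r) = ((∑ t ∈ TS,
        (Fintype.piFinset (fun i => U.filter (fun v => blk v = t i))).card : ℕ) : ℝ) := by
      rw [Finset.sum_congr rfl hpi]; push_cast; rfl
    rw [h5, ← hc4, ← hc3, ← hUc, ← Finset.card_powersetCard]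
    exact_mod_cast Finset.card_filter_le _ _
  have hsplit : ((Finset.powersetCard r U).filter φ).card ≤
      ((Finset.powersetCard r U).filter (fun e : Finset ℕ => ¬ Set.InjOn blk (e : Set ℕ))).card +
      ((Finset.powersetCard r U).filter (fun e : Finset ℕ => Set.InjOn blk (e : Set ℕ) ∧ φ e)).card := by
    refine le_trans (Finset.card_le_card ?_) (Finset.card_union_le _ _)
    intro e he
    obtain ⟨h1, h2⟩ := Finset.mem_filter.mp he
    by_cases h : Set.InjOn blk (e : Set ℕ)
    · exact Finset.mem_union_right _ (Finset.mem_filter.mpr ⟨h1, h, h2⟩)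
    · exact Finset.mem_union_left _ (Finset.mem_filter.mpr ⟨h1, h⟩)
  have hsplit' : (((Finset.powersetCard r U).filter φ).card : ℝ) ≤
      ((Finset.powersetCard r U).filter (fun e : Finset ℕ => ¬ Set.InjOn blk (e : Set ℕ))).card +
      ((Finset.powersetCard r U).filter (fun e : Finset ℕ => Set.InjOn blk (e : Set ℕ) ∧ φ e)).card := by
    exact_mod_cast hsplit
  refine hsplit'.trans (add_le_add ?_ ?_)
  · rw [le_div_iff₀ hI0, mul_comm]; exact hnc
  · exact hsum.trans (mul_le_mul_of_nonneg_right hle hZ0)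

/-- Simultaneous regularisation with an arbitrary finite index type. -/
theorem reg_fin {ι Λ : Type*} [DecidableEq ι] [Fintype Λ] (ε : ℝ) (hε : 0 < ε) :
    ∃ c : ℝ, 0 < c ∧ c ≤ 1 ∧ ∀ (A : Λ → ℕ → ℕ → Prop) (i j : Λ → ι), (∀ l, i l ≠ j l) →
    ∀ (V : ι → Finset ℕ) (n : ℕ), 1 ≤ n → (∀ a, (V a).card = n) →
    ∃ V' : ι → Finset ℕ, (∀ a, V' a ⊆ V a) ∧ ∃ s : ℕ, 1 ≤ s ∧ c * n ≤ s ∧ (∀ a, (V' a).card = s) ∧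
      ∃ w : Λ → ℝ, ∀ l, 0 ≤ w l ∧ w l ≤ 1 ∧
        Reg (A l) (V' (i l)) (V' (j l)) (w l) (ε * ((s : ℝ) * s)) := by
  obtain ⟨c, hc, hc1, h⟩ := reg_many (ι := ι) (Fintype.card Λ) ε hε
  refine ⟨c, hc, hc1, fun A i j hij V n hn hV => ?_⟩
  let f := Fintype.equivFin Λ
  obtain ⟨V', h1, s, h2, h3, h4, w, h5⟩ := h (fun l => A (f.symm l)) (fun l => i (f.symm l))
    (fun l => j (f.symm l)) (fun l => hij _) V n hn hV
  refine ⟨V', h1, s, h2, h3, h4, fun l => w (f l), fun l => ?_⟩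
  have := h5 (f l)
  simpa using this

end

section

theorem eb_mono (A : ℕ → ℕ → Prop) {S T X Y : Finset ℕ} (hS : S ⊆ X) (hT : T ⊆ Y) :
    (eb A S T : ℝ) ≤ eb A X Y := by
  rw [eb_split A hS Y, eb_split' A S hT]
  have h1 : (0 : ℝ) ≤ eb A (X \ S) Y := by positivity
  have h2 : (0 : ℝ) ≤ eb A S (Y \ T) := by positivity
  linarith

theorem num_aux (K η N c M s ε : ℝ) (hη : 0 ≤ η) (hc : 0 < c) (hN : 0 ≤ N) (hcN : c * N ≤ 2 * M * s)
    (hηε : K ^ 2 * η * (2 * M) ^ 2 ≤ ε * c ^ 2) : K * (K * (η * N ^ 2)) ≤ ε * (s * s) := by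
  have h3 : (c * N) ^ 2 ≤ (2 * M * s) ^ 2 := pow_le_pow_left₀ (by positivity) hcN 2
  have h4 : K ^ 2 * η * (c * N) ^ 2 ≤ K ^ 2 * η * (2 * M * s) ^ 2 :=
    mul_le_mul_of_nonneg_left h3 (by positivity)
  have h5 : K ^ 2 * η * (2 * M) ^ 2 * (s * s) ≤ ε * c ^ 2 * (s * s) :=
    mul_le_mul_of_nonneg_right hηε (mul_self_nonneg s)
  have hc2 : 0 < c ^ 2 := by positivity
  refine le_of_mul_le_mul_left ?_ hc2
  nlinarith

set_option maxHeartbeats 600000 in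
theorem up_struct (r k : ℕ) (hk : 2 ≤ k) (ε : ℝ) (hε : 0 < ε) (hε2 : ε ≤ 1 / 2) :
    ∃ M : ℕ, 1 ≤ M ∧ ∃ c : ℝ, 0 < c ∧ c ≤ 1 ∧
    ∀ (η : ℝ), 0 ≤ η → (r.choose 2 : ℝ) ^ 2 * η * (2 * M) ^ 2 ≤ ε * c ^ 2 →
    ∀ (A : Fin r × Fin r → ℕ → ℕ → Prop) (V : Finset ℕ), 2 * M ≤ V.card →
    (∀ p ∈ Qall r, ∀ p' ∈ Qall r, p ≠ p' →
      (eb (fun u v => A p u v ∧ A p' u v) V V : ℝ) ≤ η * (V.card : ℝ) ^ 2) →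
    ∃ (I : Finset ℕ) (n1 s : ℕ) (V' : ℕ → Finset ℕ) (W : Fin r × Fin r → ℝ),
      I.card = k ∧ 1 ≤ s ∧ c * V.card ≤ 2 * M * s ∧
      (∀ i ∈ I, V' i ⊆ V ∧ (∀ v ∈ V' i, rkk V v / n1 = i) ∧ (V' i).card = s) ∧
      (∀ p, 0 ≤ W p ∧ W p ≤ 2) ∧
      ∑ p ∈ Qall r, W p ≤ 1 + (2 * (r.choose 2 : ℝ) + 1) * ε ∧
      (∀ p ∈ Qall r, ∀ i ∈ I, ∀ j ∈ I, i < j → ∀ S ⊆ V' i, ∀ T ⊆ V' j,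
      (eb (A p) S T : ℝ) ≤ W p * (S.card * T.card) + ε * ((s : ℝ) * s)) := by
  classical
  set L := ⌈1 / ε⌉₊ with hL
  obtain ⟨N0, hN0⟩ := ramsey (κ := Fin r × Fin r → Fin (L + 1)) 2 k
  set M := max N0 1 with hM
  have hM1 : 1 ≤ M := le_max_right _ _
  obtain ⟨c, hc, hc1, hreg⟩ := reg_fin (ι := Fin M)
    (Λ := (Fin r × Fin r) × {ij : Fin M × Fin M // ij.1 < ij.2}) ε hε
  refine ⟨M, hM1, c, hc, hc1, fun η hη hηε A V hV hov => ?_⟩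
  set n1 := V.card / M with hn1
  have hn1a : 2 ≤ n1 := by rw [hn1, Nat.le_div_iff_mul_le (by omega)]; exact hV
  have hn1b : V.card < (n1 + 1) * M := by
    have h1 := Nat.div_add_mod V.card M
    have h2 := Nat.mod_lt V.card (show 0 < M by omega)
    rw [add_mul, one_mul, mul_comm, hn1]; omega
  obtain ⟨V'', hV1, s, hs1, hs2, hs3, w, hw⟩ := hreg (fun l => A l.1) (fun l => l.2.1.1)
    (fun l => l.2.1.2) (fun l => ne_of_lt l.2.2) (fun a => block V n1 a) n1 (by omega) (by
      intro a
      apply card_block _ _ _ (by omega)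
      calc (a.1 + 1) * n1 ≤ M * n1 := Nat.mul_le_mul_right _ (by omega)
        _ ≤ V.card := Nat.mul_div_le _ _)
  have hs1' : (1 : ℝ) ≤ s := by exact_mod_cast hs1
  have hcN : c * V.card ≤ 2 * M * s := by
    have h1 : (V.card : ℝ) ≤ 2 * M * n1 := by
      have : V.card ≤ 2 * M * n1 := by nlinarith
      exact_mod_cast this
    have hM0 : (0 : ℝ) ≤ 2 * M := by positivity
    nlinarith
  let g : ℕ → ℕ → Fin r × Fin r → ℝ := fun i j p =>
    if h : i < M ∧ j < M ∧ i < j then w (p, ⟨(⟨i, h.1⟩, ⟨j, h.2.1⟩), h.2.2⟩) else 0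
  let V' : ℕ → Finset ℕ := fun i => if h : i < M then V'' ⟨i, h⟩ else ∅
  have hg01 : ∀ i j p, 0 ≤ g i j p ∧ g i j p ≤ 1 := by
    intro i j p
    simp only [g]
    split_ifs with h
    · exact ⟨(hw _).1, (hw _).2.1⟩
    · norm_num
  have hgreg : ∀ i j p, i < M → j < M → i < j →
      Reg (A p) (V' i) (V' j) (g i j p) (ε * ((s : ℝ) * s)) := by
    intro i j p hi hj hij
    have := (hw (p, ⟨(⟨i, hi⟩, ⟨j, hj⟩), hij⟩)).2.2
    simpa only [V', g, hi, hj, hij, dif_pos, and_self] using this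
  have hV' : ∀ i, i < M → V' i ⊆ V ∧ (∀ v ∈ V' i, rkk V v / n1 = i) ∧ (V' i).card = s := by
    intro i hi
    have h1 : V' i = V'' ⟨i, hi⟩ := by simp only [V', hi, dif_pos]
    rw [h1]
    have h2 := hV1 ⟨i, hi⟩
    exact ⟨fun v hv => (Finset.mem_filter.mp (h2 hv)).1,
      fun v hv => (Finset.mem_filter.mp (h2 hv)).2, hs3 _⟩
  let f : Finset ℕ → Fin r × Fin r → Fin (L + 1) := fun t p =>
    ⟨min ⌊g (sInf (t : Set ℕ)) (t.sup id) p / ε⌋₊ L, by omega⟩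
  obtain ⟨I, hIS, hIk, col, hcol⟩ := hN0 (Finset.range M) (by
    rw [Finset.card_range]; exact le_max_left _ _) f
  have hIM : ∀ i ∈ I, i < M := fun i hi => Finset.mem_range.mp (hIS hi)
  let W : Fin r × Fin r → ℝ := fun p => ((col p : ℕ) + 1) * ε
  have hWg : ∀ i ∈ I, ∀ j ∈ I, i < j → ∀ p, g i j p ≤ W p ∧ W p ≤ g i j p + ε := by
    intro i hi j hj hij p
    have h1 := hcol {i, j} (by intro x hx; simp at hx; rcases hx with rfl | rfl <;> assumption)
      (Finset.card_pair hij.ne)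
    have h2 : (col p : ℕ) = ⌊g i j p / ε⌋₊ := by
      rw [← h1]
      simp only [f]
      have h3 : sInf ((({i, j} : Finset ℕ)) : Set ℕ) = i := by
        rw [Finset.coe_pair, csInf_pair]; exact min_eq_left hij.le
      have h4 : ({i, j} : Finset ℕ).sup id = j := by
        simp [hij.le]
      rw [h3, h4]
      apply min_eq_left
      rw [hL]
      apply (Nat.floor_le_ceil _).trans'
      apply Nat.floor_mono
      exact div_le_div_of_nonneg_right (hg01 i j p).2 hε.le
    have h5 := Nat.floor_le (div_nonneg (hg01 i j p).1 hε.le)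
    have h6 := (Nat.lt_floor_add_one (g i j p / ε)).le
    rw [le_div_iff₀ hε] at h5
    rw [div_le_iff₀ hε] at h6
    simp only [W]
    rw [h2]
    constructor
    · exact h6
    · linarith
  clear hcol
  clear_value W V' g f
  obtain ⟨i0, hi0, j0, hj0, hne⟩ := Finset.one_lt_card.mp (show 1 < I.card by omega)
  obtain ⟨i1, hi1, j1, hj1, hlt⟩ : ∃ i1 ∈ I, ∃ j1 ∈ I, i1 < j1 := by
    rcases lt_or_gt_of_ne hne with h | h
    · exact ⟨i0, hi0, j0, hj0, h⟩
    · exact ⟨j0, hj0, i0, hi0, h⟩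
  refine ⟨I, n1, s, V', W, hIk, hs1, hcN, fun i hi => hV' i (hIM i hi), fun p => ?_, ?_, ?_⟩
  · have h1 := hWg i1 hi1 j1 hj1 hlt p
    have h2 := hg01 i1 j1 p
    exact ⟨by linarith, by linarith⟩
  · set K : ℝ := (r.choose 2 : ℝ) with hK
    have hKc : ((Qall r).card : ℝ) = K := by rw [card_Qall]
    set ss : ℝ := (s : ℝ) * s with hss
    have hss0 : 0 < ss := by positivity
    obtain ⟨a1, a2, a3⟩ := hV' i1 (hIM _ hi1)
    obtain ⟨b1, b2, b3⟩ := hV' j1 (hIM _ hj1)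
    have hsum := sum_eb_le (Qall r) A (V' i1) (V' j1)
    rw [a3, b3, ← hss] at hsum
    have h1 : ∑ p ∈ Qall r, ∑ p' ∈ (Qall r).erase p,
        (eb (fun u v => A p u v ∧ A p' u v) (V' i1) (V' j1) : ℝ) ≤ K * (K * (η * (V.card : ℝ) ^ 2)) := by
      rw [← hKc, ← nsmul_eq_mul]
      apply Finset.sum_le_card_nsmul
      intro p hp
      have h3 : ∑ p' ∈ (Qall r).erase p,
        (eb (fun u v => A p u v ∧ A p' u v) (V' i1) (V' j1) : ℝ) ≤
          ((Qall r).erase p).card • (η * (V.card : ℝ) ^ 2) := by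
        apply Finset.sum_le_card_nsmul
        intro p' hp'
        obtain ⟨h4, h5⟩ := Finset.mem_erase.mp hp'
        exact (eb_mono _ a1 b1).trans (hov p hp p' h5 h4.symm)
      refine h3.trans ?_
      rw [nsmul_eq_mul]
      have h6 : (((Qall r).erase p).card : ℝ) ≤ ((Qall r).card : ℝ) :=
        Nat.cast_le.mpr (Finset.card_le_card (Finset.erase_subset _ _))
      exact mul_le_mul_of_nonneg_right h6 (mul_nonneg hη (sq_nonneg _))
    have h2 : K * (K * (η * (V.card : ℝ) ^ 2)) ≤ ε * ss := num_aux K η V.card c M s ε hη hc (Nat.cast_nonneg _) hcN hηε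
    have h3 : ∑ p ∈ Qall r, (g i1 j1 p * ss - ε * ss) ≤ ∑ p ∈ Qall r, (eb (A p) (V' i1) (V' j1) : ℝ) := by
      refine Finset.sum_le_sum fun p _ => ?_
      have := (hgreg i1 j1 p (hIM _ hi1) (hIM _ hj1) hlt _ subset_rfl _ subset_rfl).2
      rwa [a3, b3] at this
    rw [Finset.sum_sub_distrib, ← Finset.sum_mul, Finset.sum_const, nsmul_eq_mul, hKc] at h3
    have h4 : ∑ p ∈ Qall r, W p ≤ ∑ p ∈ Qall r, (g i1 j1 p + ε) :=
      Finset.sum_le_sum fun p _ => (hWg i1 hi1 j1 hj1 hlt p).2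
    rw [Finset.sum_add_distrib, Finset.sum_const, nsmul_eq_mul, hKc] at h4
    have h5 : (∑ p ∈ Qall r, g i1 j1 p) * ss ≤ (1 + K * ε + ε) * ss := by nlinarith
    have h6 := le_of_mul_le_mul_right h5 hss0
    nlinarith
  · intro p _ i hi j hj hij S hS T hT
    have h1 := (hgreg i j p (hIM _ hi) (hIM _ hj) hij S hS T hT).1
    have h2 := (hWg i hi j hj hij p).1
    have h3 : g i j p * ((S.card : ℝ) * T.card) ≤ W p * (S.card * T.card) :=
      mul_le_mul_of_nonneg_right h2 (by positivity)
    linarith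

theorem choose_eps (K : ℕ) (P ε : ℝ) (hε : 0 < ε) :
    ∃ e : ℝ, 0 < e ∧ e ≤ 1 / 2 ∧ P * (1 + (2 * (K : ℝ) + 1) * e) ^ K + 3 ^ K * e ≤ P + ε := by
  have hc : Continuous (fun e : ℝ => P * (1 + (2 * (K : ℝ) + 1) * e) ^ K + 3 ^ K * e) := by fun_prop
  have h0 : Filter.Tendsto (fun e : ℝ => P * (1 + (2 * (K : ℝ) + 1) * e) ^ K + 3 ^ K * e)
      (nhdsWithin 0 (Set.Ioi 0)) (nhds P) := by
    have := (hc.tendsto 0).mono_left (nhdsWithin_le_nhds (s := Set.Ioi 0))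
    simpa using this
  have h1 := h0.eventually (eventually_le_nhds (show P < P + ε by linarith))
  have h2 : ∀ᶠ e in nhdsWithin (0 : ℝ) (Set.Ioi 0), e ≤ 1 / 2 :=
    nhdsWithin_le_nhds (eventually_le_nhds (show (0 : ℝ) < 1 / 2 by norm_num))
  obtain ⟨e, ⟨h3, h4⟩, h5⟩ := ((h1.and h2).and self_mem_nhdsWithin).exists
  exact ⟨e, h5, h4, h3⟩

end

section

theorem prod_bound (r : ℕ) (hr : 2 ≤ r) (W : Fin r × Fin r → ℝ) (hW : ∀ p, 0 ≤ W p) (X : ℝ)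
    (hX : ∑ p ∈ Qall r, W p ≤ X) : ∏ p ∈ Qall r, W p ≤ piR r * X ^ (r.choose 2) := by
  have hK : 0 < r.choose 2 := Nat.choose_pos hr
  have h1 := amgm (Qall r) (by rw [card_Qall]; exact hK) W (fun p _ => hW p)
  rw [card_Qall] at h1
  refine h1.trans ?_
  have h2 : 0 ≤ ∑ p ∈ Qall r, W p := Finset.sum_nonneg fun p _ => hW p
  rw [div_pow, div_eq_mul_inv, mul_comm]
  unfold piR
  apply mul_le_mul_of_nonneg_left (pow_le_pow_left₀ h2 hX _)
  positivity

theorem num_final (r : ℕ) (ε P B C k ks N c M s δ X : ℝ) (hε : 0 < ε) (hr : 1 ≤ (r : ℝ)) (hB : 0 < B)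
    (hC : 0 < C) (hk : 4 * (r : ℝ) ^ 2 * B / ε ≤ k) (hk1 : 1 ≤ k) (hks : ks = k * s) (hs : 0 < s)
    (hN : 0 ≤ N) (hc : 0 < c) (hM : 0 < M)
    (hcN : c * N ≤ 2 * M * s) (hδ : δ = (ε / 4) / ((r : ℝ) ^ 2 * (2 * M / c) ^ r * B))
    (hBC : ks ^ r ≤ B * C) (hX : X ≤ P + ε / 4) :
    (r : ℝ) ^ 2 * (δ * N ^ r) + ((r : ℝ) ^ 2 * ks ^ r / k + C * X) < (P + ε) * C := by
  have h1 : (r : ℝ) ^ 2 * ks ^ r / k ≤ ε / 4 * C := by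
    rw [div_le_iff₀ (by linarith)]
    rw [div_le_iff₀ hε] at hk
    have h2 : (r : ℝ) ^ 2 * ks ^ r ≤ (r : ℝ) ^ 2 * (B * C) := mul_le_mul_of_nonneg_left hBC (by positivity)
    have h3 := mul_le_mul_of_nonneg_right hk hC.le
    nlinarith
  have h2 : C * X ≤ C * (P + ε / 4) := mul_le_mul_of_nonneg_left hX hC.le
  have h3 : (r : ℝ) ^ 2 * (δ * N ^ r) ≤ ε / 4 * C := by
    have h4 : N ≤ 2 * M / c * ks := by
      have h5 : N ≤ 2 * M / c * s := by
        rw [div_mul_eq_mul_div, le_div_iff₀ hc]; linarith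
      refine h5.trans (mul_le_mul_of_nonneg_left ?_ (by positivity))
      rw [hks]; nlinarith
    have h5 : N ^ r ≤ (2 * M / c) ^ r * (B * C) := by
      calc N ^ r ≤ (2 * M / c * ks) ^ r := pow_le_pow_left₀ hN h4 r
        _ = (2 * M / c) ^ r * ks ^ r := mul_pow _ _ _
        _ ≤ _ := mul_le_mul_of_nonneg_left hBC (by positivity)
    have hD : 0 < (r : ℝ) ^ 2 * (2 * M / c) ^ r * B := by positivity
    have hδ0 : 0 ≤ δ := by rw [hδ]; positivity
    have h6 : δ * ((r : ℝ) ^ 2 * (2 * M / c) ^ r * B) = ε / 4 := by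
      rw [hδ]; field_simp
    calc (r : ℝ) ^ 2 * (δ * N ^ r) ≤ (r : ℝ) ^ 2 * (δ * ((2 * M / c) ^ r * (B * C))) := by gcongr
      _ = δ * ((r : ℝ) ^ 2 * (2 * M / c) ^ r * B) * C := by ring
      _ = ε / 4 * C := by rw [h6]
  nlinarith

set_option maxHeartbeats 800000 in
theorem lemma1 (m : ℕ) (hm : 1 ≤ m) (ε : ℝ) (hε : 0 < ε) :
    ∃ κ : ℝ, 0 < κ ∧ ∃ γ : ℝ, 0 < γ ∧ ∃ n0 : ℕ, ∀ (H : RGraph (m + 2)) (V : Finset ℕ), n0 ≤ V.card →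
    (∀ V' ⊆ V, γ * V.card ≤ V'.card → (piR (m + 2) + ε) * (V'.card.choose (m + 2) : ℝ) ≤
      ((H.edges.filter (fun e => e ⊆ V')).card : ℝ)) →
    ∃ lam : Sg m, κ * (V.card : ℝ) ^ (2 * m + 2) ≤ (TT H lam.1 (fun _ => V)).card := by
  classical
  set r := m + 2 with hr
  obtain ⟨e, he, he2, heb⟩ := choose_eps (r.choose 2) (piR r) (ε / 4) (by linarith)
  set B : ℝ := 2 ^ r * r.factorial with hB
  have hB0 : 0 < B := by positivity
  set k := ⌈4 * (r : ℝ) ^ 2 * B / ε⌉₊ + 2 * r + 2 with hk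
  have hkB : 4 * (r : ℝ) ^ 2 * B / ε ≤ k := by
    refine (Nat.le_ceil _).trans ?_
    exact_mod_cast (by omega : ⌈4 * (r : ℝ) ^ 2 * B / ε⌉₊ ≤ k)
  obtain ⟨M, hM, c, hc, hc1, hst⟩ := up_struct r k (by omega) e he he2
  have hM0 : (0 : ℝ) < M := by exact_mod_cast hM
  have hK : 0 < r.choose 2 := Nat.choose_pos (by omega)
  have hK0 : (0 : ℝ) < r.choose 2 := by exact_mod_cast hK
  have hr1 : (1 : ℝ) ≤ r := by exact_mod_cast (by omega : 1 ≤ r)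
  obtain ⟨δ, hδ⟩ : ∃ δ : ℝ, δ = (ε / 4) / ((r : ℝ) ^ 2 * (2 * M / c) ^ r * B) := ⟨_, rfl⟩
  have hδ0 : 0 < δ := by rw [hδ]; positivity
  obtain ⟨η, hη⟩ : ∃ η : ℝ, η = e * c ^ 2 / ((r.choose 2 : ℝ) ^ 2 * (2 * M) ^ 2) := ⟨_, rfl⟩
  have hη0 : 0 < η := by rw [hη]; positivity
  have hηe : (r.choose 2 : ℝ) ^ 2 * η * (2 * M) ^ 2 ≤ e * c ^ 2 := by
    rw [hη]; apply le_of_eq; field_simp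
  have hst' := hst η hη0.le hηe
  obtain ⟨κ, hκ⟩ : ∃ κ : ℝ, κ = η * δ ^ 2 / (2 * ((Nat.card (Sg m) : ℝ) + 1)) := ⟨_, rfl⟩
  have hκ0 : 0 < κ := by rw [hκ]; positivity
  have hκ1 : Nat.card (Sg m) * κ ≤ η * δ ^ 2 / 2 := by
    rw [hκ, ← mul_div_assoc, div_le_div_iff₀ (by positivity) (by positivity)]
    have : 0 ≤ η * δ ^ 2 := by positivity
    nlinarith
  refine ⟨κ, hκ0, c / (2 * M), by positivity,
    ⌈2 * ((2 * m + 2 : ℕ) : ℝ) ^ 2 / (η * δ ^ 2)⌉₊ + 2 * M, fun H V hV hd => ?_⟩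
  by_contra hcon
  push Not at hcon
  have hV1 : 1 ≤ V.card := by omega
  have hN1 : (1 : ℝ) ≤ V.card := by exact_mod_cast hV1
  have hov : ∀ p ∈ Qall r, ∀ p' ∈ Qall r, p ≠ p' →
      (eb (fun u v => Ar H V δ p.1 p.2 u v ∧ Ar H V δ p'.1 p'.2 u v) V V : ℝ) ≤
        η * (V.card : ℝ) ^ 2 := by
    intro p _ p' _ hne
    have h1 := overlap H V δ κ hδ0 hV1 (fun lam => (hcon lam).le) p.1 p.2 p'.1 p'.2 (by
      intro h
      rw [Prod.mk.injEq] at h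
      exact hne (Prod.ext (Fin.ext h.1) (Fin.ext h.2)))
    have h2 : ((2 * m + 2 : ℕ) : ℝ) ^ 2 / V.card ≤ η * δ ^ 2 / 2 := by
      have h3 : 2 * ((2 * m + 2 : ℕ) : ℝ) ^ 2 / (η * δ ^ 2) ≤ V.card := by
        refine (Nat.le_ceil _).trans ?_
        exact_mod_cast (by omega : ⌈2 * ((2 * m + 2 : ℕ) : ℝ) ^ 2 / (η * δ ^ 2)⌉₊ ≤ V.card)
      rw [div_le_iff₀ (by positivity)] at h3
      rw [div_le_iff₀ (by linarith)]
      linarith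
    have h3 : (((2 * m + 2 : ℕ) : ℝ) ^ 2 / V.card + Nat.card (Sg m) * κ) * (V.card : ℝ) ^ 2 ≤
        η * δ ^ 2 * (V.card : ℝ) ^ 2 :=
      mul_le_mul_of_nonneg_right (by linarith) (by positivity)
    have h4 : δ ^ 2 * (eb (fun u v => Ar H V δ p.1 p.2 u v ∧ Ar H V δ p'.1 p'.2 u v) V V : ℝ) ≤
        δ ^ 2 * (η * (V.card : ℝ) ^ 2) := by
      refine (h1.trans h3).trans (le_of_eq (by ring))
    exact le_of_mul_le_mul_left h4 (by positivity)
  obtain ⟨I, n1, s, V', W, hI, hs1, hcN, hV', hW, hWs, hA⟩ :=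
    hst' (fun p => Ar H V δ p.1 p.2) V (by omega) hov
  have hcu := cross_upper r (by omega) I (by omega) V' s (fun i hi => (hV' i hi).2.2)
    (fun u => rkk V u / n1) (fun i hi => (hV' i hi).2.1)
    (fun u v h => Nat.div_le_div_right (rkk_mono V h)) (fun e => e ∈ H.edges ∧ goodE H V δ e)
    (fun p => Ar H V δ p.1 p.2) W (fun p => (hW p).1) (fun p => (hW p).2) e he.le hA (by
      intro x hx hφ p hp
      have h1 := hφ.2 (x p.1) (Finset.mem_image_of_mem _ (Finset.mem_univ _)) (x p.2)
        (Finset.mem_image_of_mem _ (Finset.mem_univ _)) (hx (Finset.mem_filter.mp hp).2)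
      rwa [rkk_strictMono x hx, rkk_strictMono x hx] at h1)
  set U := I.biUnion V' with hU
  have hUV : U ⊆ V := by
    intro u hu
    obtain ⟨i, hi, h⟩ := Finset.mem_biUnion.mp hu
    exact (hV' i hi).1 h
  have hUc : U.card = k * s := by
    rw [hU, Finset.card_biUnion, Finset.sum_congr rfl (fun i hi => (hV' i hi).2.2), Finset.sum_const,
      smul_eq_mul, hI]
    intro i hi j hj hij
    change Disjoint (V' i) (V' j)
    rw [Finset.disjoint_left]
    intro v hv hv'
    exact hij (((hV' i hi).2.1 v hv).symm.trans ((hV' j hj).2.1 v hv'))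
  have hs0 : (0 : ℝ) < s := by exact_mod_cast hs1
  have hk1 : (1 : ℝ) ≤ k := by exact_mod_cast (by omega : 1 ≤ k)
  have hdU := hd U hUV (by
    rw [hUc, div_mul_eq_mul_div, div_le_iff₀ (by positivity)]
    push_cast
    nlinarith [mul_pos hM0 hs0])
  have hbad := bad_edges H V δ hδ0
  have hsplit : (H.edges.filter (fun e => e ⊆ U)).card ≤
      (H.edges.filter (fun e => e ⊆ V ∧ ¬ goodE H V δ e)).card +
      ((Finset.powersetCard r U).filter (fun e => e ∈ H.edges ∧ goodE H V δ e)).card := by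
    refine le_trans (Finset.card_le_card ?_) (Finset.card_union_le _ _)
    intro x hx
    obtain ⟨h1, h2⟩ := Finset.mem_filter.mp hx
    by_cases h : goodE H V δ x
    · exact Finset.mem_union_right _ (Finset.mem_filter.mpr
        ⟨Finset.mem_powersetCard.mpr ⟨h2, H.edges_card x h1⟩, h1, h⟩)
    · exact Finset.mem_union_left _ (Finset.mem_filter.mpr ⟨h1, h2.trans hUV, h⟩)
  have hsplit' : ((H.edges.filter (fun e => e ⊆ U)).card : ℝ) ≤
      (H.edges.filter (fun e => e ⊆ V ∧ ¬ goodE H V δ e)).card +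
      ((Finset.powersetCard r U).filter (fun e => e ∈ H.edges ∧ goodE H V δ e)).card := by
    exact_mod_cast hsplit
  have h2r : 2 * r ≤ k * s := by nlinarith
  have hpc := pow_le_choose' r (k * s) h2r
  have hCpos : (0 : ℝ) < (k * s).choose r := by exact_mod_cast Nat.choose_pos (by omega)
  have hX : ∏ p ∈ Qall r, W p + 3 ^ (r.choose 2) * e ≤ piR r + ε / 4 := by
    have := prod_bound r (by omega) W (fun p => (hW p).1) _ hWs
    linarith
  have hfin := num_final r ε (piR r) B ((k * s).choose r) k ((k * s : ℕ) : ℝ) V.card c M s δ _ hε hr1 hB0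
    hCpos hkB hk1 (by push_cast; rfl) hs0 (by positivity) hc hM0 hcN hδ hpc hX
  rw [hI] at hcu
  rw [hUc] at hdU
  linarith

end

section

/-- A labelled tuple is a twin pair with order pattern `lam`. -/
def RR {m : ℕ} (H : RGraph (m + 2)) (lam : Lab m → Fin (2 * m + 2)) (y : Lab m → ℕ) : Prop :=
  (∀ a b, lam a < lam b → y a < y b) ∧ ∀ b, (EE m b).image y ∈ H.edges

theorem mem_TT {m : ℕ} (H : RGraph (m + 2)) (lam : Lab m → Fin (2 * m + 2)) (S : Lab m → Finset ℕ)
    (y : Lab m → ℕ) : y ∈ TT H lam S ↔ (∀ a, y a ∈ S a) ∧ RR H lam y := by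
  unfold TT RR
  rw [Finset.mem_filter, Fintype.mem_piFinset]

theorem TT_mono {m : ℕ} (H : RGraph (m + 2)) (lam : Lab m → Fin (2 * m + 2)) {S T : Lab m → Finset ℕ}
    (h : ∀ a, S a ⊆ T a) : (TT H lam S).card ≤ (TT H lam T).card := by
  apply Finset.card_le_card
  intro y hy
  rw [mem_TT] at hy ⊢
  exact ⟨fun a => h a (hy.1 a), hy.2⟩

theorem mem_filter_any {α : Type*} {p : α → Prop} {d : DecidablePred p} {s : Finset α} {a : α} :
    a ∈ @Finset.filter α p d s ↔ a ∈ s ∧ p a := Finset.mem_filter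

/-- Partial embeddings. -/
noncomputable def emb {m n : ℕ} (H : RGraph (m + 2)) (lam : Lab m → Fin (2 * m + 2))
    (V : Fin n → Finset ℕ) (Q : Finset (Lab m → Fin n)) : Finset (Fin n → ℕ) :=
  @Finset.filter _ (fun x : Fin n → ℕ => ∀ l' ∈ Q, RR H lam (fun a => x (l' a)))
    (Classical.decPred _) (Fintype.piFinset V)

theorem mem_emb {m n : ℕ} (H : RGraph (m + 2)) (lam : Lab m → Fin (2 * m + 2))
    (V : Fin n → Finset ℕ) (Q : Finset (Lab m → Fin n)) (x : Fin n → ℕ) :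
    x ∈ emb H lam V Q ↔ (∀ v, x v ∈ V v) ∧ ∀ l' ∈ Q, RR H lam (fun a => x (l' a)) := by
  unfold emb
  exact mem_filter_any.trans (and_congr Fintype.mem_piFinset Iff.rfl)

theorem embed_count {m n : ℕ} (H : RGraph (m + 2)) (lam : Lab m → Fin (2 * m + 2))
    (V : Fin n → Finset ℕ) (s : ℕ) (hs : 1 ≤ s) (hV : ∀ v, (V v).card = s)
    (l : Lab m → Fin n) (hl : Function.Injective l) (Q : Finset (Lab m → Fin n))
    (hlin : ∀ l' ∈ Q, ∀ a b a' b', l a = l' a' → l b = l' b' → a = b)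
    (Q' : Finset (Lab m → Fin n)) (hQ' : ∀ l', l' ∈ Q' ↔ l' = l ∨ l' ∈ Q)
    (c : ℝ) (hc : 0 < c) (hcnt : c * (s : ℝ) ^ n ≤ (emb H lam V Q).card) :
    ∃ S : Lab m → Finset ℕ, (∀ a, S a ⊆ V (l a)) ∧ (∀ a, c / 2 * s ≤ (S a).card) ∧
      c / 2 * (s : ℝ) ^ n * (TT H lam S).card ≤ (s : ℝ) ^ (2 * m + 2) * (emb H lam V Q').card := by
  classical
  obtain ⟨S, hS1, -, hS3⟩ := comb_box V l hl Q (fun l' x => RR H lam (fun a => x (l' a))) (by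
    intro l' hl'
    by_cases h : ∃ a a', l a = l' a'
    · obtain ⟨a, a', ha⟩ := h
      refine ⟨a, fun x y hxy => ?_⟩
      have : (fun b => x (l' b)) = fun b => y (l' b) := by
        funext b
        refine hxy _ fun d hd hd' => hd ?_
        exact (hlin l' hl' a d a' b ha hd').symm
      simp only [this]
    · push Not at h
      refine ⟨Sum.inl 0, fun x y hxy => ?_⟩
      have : (fun b => x (l' b)) = fun b => y (l' b) := by
        funext b
        exact hxy _ fun d _ => h d b
      simp only [this])
  have hs0 : (0 : ℝ) < s := by exact_mod_cast hs
  have hbox : (Fintype.piFinset (fun a => V (l a))).card = s ^ (2 * m + 2) := by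
    rw [Fintype.card_piFinset, Finset.prod_congr rfl (fun a _ => hV (l a)), Finset.prod_const,
      Finset.card_univ, card_lab]
  have hP : (Fintype.piFinset V).card = s ^ n := by
    rw [Fintype.card_piFinset, Finset.prod_congr rfl (fun a _ => hV a)]; simp
  have e1 := comb_box_card V l hl Q (fun l' x => RR H lam (fun a => x (l' a))) S hS1 hS3 (fun _ => True)
  have e2 := comb_box_card V l hl Q (fun l' x => RR H lam (fun a => x (l' a))) S hS1 hS3 (RR H lam)
  rw [hbox] at e1 e2
  have f3 : ∀ x : Fin n → ℕ, (Fintype.piFinset (S x)).filter (RR H lam) = TT H lam (S x) := by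
    intro x
    ext y
    rw [mem_TT, Finset.mem_filter, Fintype.mem_piFinset]
  rw [Finset.sum_congr rfl (fun x _ => congrArg Finset.card (f3 x))] at e2
  have e1a : s ^ (2 * m + 2) * (emb H lam V Q).card = ∑ x ∈ Fintype.piFinset V,
      (Fintype.piFinset (S x)).card := by
    simp only [Finset.filter_true] at e1
    refine Eq.trans (congrArg (fun z => s ^ (2 * m + 2) * Finset.card z) ?_) e1
    ext x
    refine (mem_emb H lam V Q x).trans (Iff.trans ?_ mem_filter_any.symm)
    rw [Fintype.mem_piFinset, and_true]
  have e2a : s ^ (2 * m + 2) * (emb H lam V Q').card = ∑ x ∈ Fintype.piFinset V,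
      (TT H lam (S x)).card := by
    refine Eq.trans (congrArg (fun z => s ^ (2 * m + 2) * Finset.card z) ?_) e2
    ext x
    refine (mem_emb H lam V Q' x).trans (Iff.trans ?_ mem_filter_any.symm)
    rw [Fintype.mem_piFinset]
    refine and_congr_right fun _ => ?_
    constructor
    · intro h
      exact ⟨fun l' hl' => h l' ((hQ' l').mpr (Or.inr hl')), h l ((hQ' l).mpr (Or.inl rfl))⟩
    · rintro ⟨h1, h2⟩ l' hl'
      rcases (hQ' l').mp hl' with rfl | h
      · exact h2
      · exact h1 l' h
  have e1' : (s : ℝ) ^ (2 * m + 2) * (emb H lam V Q).card =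
      ∑ x ∈ Fintype.piFinset V, ((Fintype.piFinset (S x)).card : ℝ) := by exact_mod_cast e1a
  have e2' : (s : ℝ) ^ (2 * m + 2) * (emb H lam V Q').card =
      ∑ x ∈ Fintype.piFinset V, ((TT H lam (S x)).card : ℝ) := by exact_mod_cast e2a
  set G := (Fintype.piFinset V).filter
    (fun x => c / 2 * (s : ℝ) ^ (2 * m + 2) ≤ ((Fintype.piFinset (S x)).card : ℝ)) with hG
  have hSle : ∀ x a, (S x a).card ≤ s := fun x a => (Finset.card_le_card (hS1 x a)).trans_eq (hV _)
  have hbox2 : ∀ x, ((Fintype.piFinset (S x)).card : ℝ) ≤ (s : ℝ) ^ (2 * m + 2) := by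
    intro x
    have : (Fintype.piFinset (S x)).card ≤ s ^ (2 * m + 2) := by
      rw [← hbox]
      apply Finset.card_le_card
      intro y hy
      rw [Fintype.mem_piFinset] at hy ⊢
      exact fun a => hS1 x a (hy a)
    exact_mod_cast this
  have hsum : ∑ x ∈ Fintype.piFinset V, ((Fintype.piFinset (S x)).card : ℝ) ≤
      (G.card : ℝ) * (s : ℝ) ^ (2 * m + 2) + (s : ℝ) ^ n * (c / 2 * (s : ℝ) ^ (2 * m + 2)) := by
    rw [← Finset.sum_filter_add_sum_filter_not (Fintype.piFinset V)
      (fun x => c / 2 * (s : ℝ) ^ (2 * m + 2) ≤ ((Fintype.piFinset (S x)).card : ℝ))]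
    apply add_le_add
    · rw [← nsmul_eq_mul]
      exact Finset.sum_le_card_nsmul _ _ _ fun x _ => hbox2 x
    · refine (Finset.sum_le_card_nsmul _ _ (c / 2 * (s : ℝ) ^ (2 * m + 2)) fun x hx => ?_).trans ?_
      · exact (not_le.mp (Finset.mem_filter.mp hx).2).le
      · rw [nsmul_eq_mul]
        refine mul_le_mul_of_nonneg_right ?_ (by positivity)
        have := Finset.card_filter_le (Fintype.piFinset V)
          (fun x => ¬ c / 2 * (s : ℝ) ^ (2 * m + 2) ≤ ((Fintype.piFinset (S x)).card : ℝ))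
        rw [hP] at this
        exact_mod_cast this
  have hsq : (0 : ℝ) < (s : ℝ) ^ (2 * m + 2) := by positivity
  have hGc : c / 2 * (s : ℝ) ^ n ≤ G.card := by
    have h1 := mul_le_mul_of_nonneg_left hcnt hsq.le
    rw [e1'] at h1
    have h2 := h1.trans hsum
    refine le_of_mul_le_mul_right ?_ hsq
    nlinarith
  have hGne : G.Nonempty := by
    rw [← Finset.card_pos]
    have : (0 : ℝ) < G.card := lt_of_lt_of_le (by positivity) hGc
    exact_mod_cast this
  obtain ⟨x0, hx0, hmin⟩ := Finset.exists_min_image G (fun x => (TT H lam (S x)).card) hGne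
  refine ⟨S x0, hS1 x0, fun a => ?_, ?_⟩
  · have h1 := (Finset.mem_filter.mp hx0).2
    have h2 : (Fintype.piFinset (S x0)).card ≤ (S x0 a).card * s ^ (2 * m + 1) := by
      rw [Fintype.card_piFinset, ← Finset.mul_prod_erase _ _ (Finset.mem_univ a)]
      apply Nat.mul_le_mul_left
      refine (Finset.prod_le_pow_card _ _ s (fun b _ => hSle x0 b)).trans_eq ?_
      rw [Finset.card_erase_of_mem (Finset.mem_univ _), Finset.card_univ, card_lab]
      rfl
    have h3 : ((Fintype.piFinset (S x0)).card : ℝ) ≤ (S x0 a).card * (s : ℝ) ^ (2 * m + 1) := by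
      exact_mod_cast h2
    have h4 : (0 : ℝ) < (s : ℝ) ^ (2 * m + 1) := by positivity
    refine le_of_mul_le_mul_right ?_ h4
    refine le_trans (le_of_eq ?_) (h1.trans h3)
    ring
  · rw [e2']
    calc c / 2 * (s : ℝ) ^ n * (TT H lam (S x0)).card ≤ G.card * (TT H lam (S x0)).card :=
          mul_le_mul_of_nonneg_right hGc (by positivity)
      _ ≤ ∑ x ∈ G, ((TT H lam (S x)).card : ℝ) := by
          rw [← nsmul_eq_mul]
          apply Finset.card_nsmul_le_sum
          intro x hx
          exact_mod_cast hmin x hx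
      _ ≤ _ := Finset.sum_le_sum_of_subset_of_nonneg (Finset.filter_subset _ _)
          (fun _ _ _ => by positivity)

end

section

/-- Linear-sized sequences of sets along an ultrafilter. -/
def Large (U : Ultrafilter ℕ) (N : ℕ → ℕ) (S : ℕ → Finset ℕ) : Prop :=
  ∃ c : ℝ, 0 < c ∧ ∀ᶠ n in (U : Filter ℕ), c * N n ≤ (S n).card

/-- Positive density of twin pairs. -/
def Pos {m : ℕ} (U : Ultrafilter ℕ) (H : ℕ → RGraph (m + 2)) (N : ℕ → ℕ) (lam : Lab m → Fin (2 * m + 2))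
    (S : Lab m → ℕ → Finset ℕ) : Prop :=
  ∃ κ : ℝ, 0 < κ ∧ ∀ᶠ n in (U : Filter ℕ),
    κ * (N n : ℝ) ^ (2 * m + 2) ≤ (TT (H n) lam (fun a => S a n)).card

/-- Hereditarily positive density. -/
def Good {m : ℕ} (U : Ultrafilter ℕ) (H : ℕ → RGraph (m + 2)) (N : ℕ → ℕ) (lam : Lab m → Fin (2 * m + 2))
    (V : Lab m → ℕ → Finset ℕ) : Prop :=
  ∀ S : Lab m → ℕ → Finset ℕ, (∀ a n, S a n ⊆ V a n) → (∀ a, Large U N (S a)) → Pos U H N lam S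

section
variable {m : ℕ} {U : Ultrafilter ℕ} {H : ℕ → RGraph (m + 2)} {N : ℕ → ℕ}
  {lam : Lab m → Fin (2 * m + 2)}

theorem Pos.mono {S V : Lab m → ℕ → Finset ℕ} (h : Pos U H N lam S) (hSV : ∀ a n, S a n ⊆ V a n) :
    Pos U H N lam V := by
  obtain ⟨κ, hκ, h⟩ := h
  refine ⟨κ, hκ, h.mono fun n hn => hn.trans ?_⟩
  exact_mod_cast TT_mono (H n) lam (fun a => hSV a n)

theorem Good.mono {S V : Lab m → ℕ → Finset ℕ} (h : Good U H N lam V) (hSV : ∀ a n, S a n ⊆ V a n) :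
    Good U H N lam S :=
  fun T hT hL => h T (fun a n => (hT a n).trans (hSV a n)) hL

theorem not_pos {S : Lab m → ℕ → Finset ℕ} (h : ¬ Pos U H N lam S) (κ : ℝ) (hκ : 0 < κ) :
    ∀ᶠ n in (U : Filter ℕ), ((TT (H n) lam (fun a => S a n)).card : ℝ) < κ * (N n : ℝ) ^ (2 * m + 2) := by
  have h1 : ¬ ∀ᶠ n in (U : Filter ℕ),
      κ * (N n : ℝ) ^ (2 * m + 2) ≤ (TT (H n) lam (fun a => S a n)).card := fun h2 => h ⟨κ, hκ, h2⟩
  rw [← Ultrafilter.eventually_not] at h1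
  exact h1.mono fun n hn => not_le.mp hn

theorem marking (items : Finset ((Lab m → ℕ) × (Lab m → Fin (2 * m + 2))))
    (V : ℕ → ℕ → Finset ℕ) (hV : ∀ i, Large U N (V i)) :
    (∀ p ∈ items, Function.Injective p.1) →
    ∃ V' : ℕ → ℕ → Finset ℕ, (∀ i n, V' i n ⊆ V i n) ∧ (∀ i, Large U N (V' i)) ∧
      ∀ p ∈ items, Good U H N p.2 (fun a => V' (p.1 a)) ∨ ¬ Pos U H N p.2 (fun a => V' (p.1 a)) := by
  classical
  induction items using Finset.induction_on with
  | empty => intro _; exact ⟨V, fun _ _ => subset_rfl, hV, by simp⟩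
  | insert p items _ ih =>
    intro hinj
    obtain ⟨V', h1, h2, h3⟩ := ih (fun p hp => hinj p (Finset.mem_insert_of_mem hp))
    have hp := hinj p (Finset.mem_insert_self _ _)
    by_cases hg : Good U H N p.2 (fun a => V' (p.1 a))
    · refine ⟨V', h1, h2, fun p' hp' => ?_⟩
      rcases Finset.mem_insert.mp hp' with rfl | h
      · exact Or.inl hg
      · exact h3 p' h
    · unfold Good at hg
      push Not at hg
      obtain ⟨S, hS1, hS2, hS3⟩ := hg
      have hsub : ∀ i n, Function.extend p.1 S V' i n ⊆ V' i n := by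
        intro i n
        by_cases hi : ∃ a, p.1 a = i
        · obtain ⟨a, rfl⟩ := hi
          rw [hp.extend_apply]
          exact hS1 a n
        · rw [Function.extend_apply' _ _ _ hi]
      refine ⟨Function.extend p.1 S V', fun i n => (hsub i n).trans (h1 i n), fun i => ?_, fun p' hp' => ?_⟩
      · by_cases hi : ∃ a, p.1 a = i
        · obtain ⟨a, rfl⟩ := hi
          rw [hp.extend_apply]
          exact hS2 a
        · rw [Function.extend_apply' _ _ _ hi]
          exact h2 i
      · rcases Finset.mem_insert.mp hp' with rfl | h
        · right
          simp only [hp.extend_apply]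
          exact hS3
        · rcases h3 p' h with h4 | h4
          · exact Or.inl (h4.mono fun a n => hsub _ n)
          · exact Or.inr fun h5 => h4 (h5.mono fun a n => hsub _ n)

theorem trim (V : ℕ → ℕ → Finset ℕ) (M : ℕ) (hM : 1 ≤ M) (hV : ∀ i, Large U N (V i)) :
    ∃ (V' : ℕ → ℕ → Finset ℕ) (s : ℕ → ℕ), (∀ i n, V' i n ⊆ V i n) ∧
      (∀ i, i < M → ∀ n, (V' i n).card = s n) ∧
      ∃ c : ℝ, 0 < c ∧ ∀ᶠ n in (U : Filter ℕ), c * N n ≤ s n := by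
  classical
  have hne : (Finset.range M).Nonempty := ⟨0, Finset.mem_range.mpr hM⟩
  let s : ℕ → ℕ := fun n => (Finset.range M).inf' hne (fun i => (V i n).card)
  have hs : ∀ i, ∀ n, ∃ T, T ⊆ V i n ∧ (i < M → T.card = s n) := by
    intro i n
    by_cases hi : i < M
    · obtain ⟨T, h1, h2⟩ := Finset.exists_subset_card_eq
        (Finset.inf'_le (fun i => (V i n).card) (Finset.mem_range.mpr hi) : s n ≤ (V i n).card)
      exact ⟨T, h1, fun _ => h2⟩
    · exact ⟨V i n, subset_rfl, fun h => absurd h hi⟩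
  choose V' hV1 hV2 using hs
  choose c hc hcN using hV
  refine ⟨V', s, hV1, fun i hi n => hV2 i n hi, (Finset.range M).inf' hne c, ?_, ?_⟩
  · obtain ⟨i, _, hi⟩ := Finset.exists_mem_eq_inf' hne c
    rw [hi]; exact hc i
  · have h1 : ∀ᶠ n in (U : Filter ℕ), ∀ i ∈ Finset.range M, c i * N n ≤ (V i n).card :=
      (Filter.eventually_all_finset _).mpr fun i _ => hcN i
    refine h1.mono fun n hn => ?_
    obtain ⟨i, hi, hi2⟩ := Finset.exists_mem_eq_inf' hne (fun i => (V i n).card)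
    have h2 : s n = (V i n).card := hi2
    rw [h2]
    refine le_trans ?_ (hn i hi)
    exact mul_le_mul_of_nonneg_right (Finset.inf'_le _ hi) (by positivity)

theorem embed_all {nF : ℕ} (F : Finset (Lab m → Fin nF)) (hinj : ∀ l ∈ F, Function.Injective l)
    (hlin : ∀ l ∈ F, ∀ l' ∈ F, l ≠ l' → ∀ a b a' b', l a = l' a' → l b = l' b' → a = b)
    (X : Fin nF → ℕ → Finset ℕ) (s : ℕ → ℕ) (hX : ∀ v n, (X v n).card = s n)
    (c0 : ℝ) (hc0 : 0 < c0) (hsN : ∀ᶠ n in (U : Filter ℕ), c0 * N n ≤ s n)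
    (hs1 : ∀ᶠ n in (U : Filter ℕ), 1 ≤ s n) (hsN2 : ∀ᶠ n in (U : Filter ℕ), s n ≤ N n)
    (hg : ∀ l ∈ F, Good U H N lam (fun a => X (l a))) :
    ∃ c : ℝ, 0 < c ∧ ∀ᶠ n in (U : Filter ℕ),
      c * (s n : ℝ) ^ nF ≤ (emb (H n) lam (fun v => X v n) F).card := by
  classical
  suffices h : ∀ Q : Finset (Lab m → Fin nF), Q ⊆ F → ∃ c : ℝ, 0 < c ∧ ∀ᶠ n in (U : Filter ℕ),
      c * (s n : ℝ) ^ nF ≤ (emb (H n) lam (fun v => X v n) Q).card from h F subset_rfl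
  intro Q
  induction Q using Finset.induction_on with
  | empty =>
    intro _
    refine ⟨1, one_pos, Filter.Eventually.of_forall fun n => ?_⟩
    have : emb (H n) lam (fun v => X v n) ∅ = Fintype.piFinset (fun v => X v n) := by
      ext x
      rw [mem_emb, Fintype.mem_piFinset]
      simp
    rw [this, Fintype.card_piFinset, Finset.prod_congr rfl (fun v _ => hX v n)]
    simp
  | insert l Q hlQ ih =>
    intro hQF
    obtain ⟨c, hc, hcnt⟩ := ih ((Finset.subset_insert _ _).trans hQF)
    have hlF : l ∈ F := hQF (Finset.mem_insert_self _ _)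
    have hstep : ∀ n, ∃ S : Lab m → Finset ℕ, (∀ a, S a ⊆ X (l a) n) ∧
        (1 ≤ s n ∧ c * (s n : ℝ) ^ nF ≤ (emb (H n) lam (fun v => X v n) Q).card →
          (∀ a, c / 2 * s n ≤ (S a).card) ∧ c / 2 * (s n : ℝ) ^ nF * (TT (H n) lam S).card ≤
            (s n : ℝ) ^ (2 * m + 2) * (emb (H n) lam (fun v => X v n) (insert l Q)).card) := by
      intro n
      by_cases hn : 1 ≤ s n ∧ c * (s n : ℝ) ^ nF ≤ (emb (H n) lam (fun v => X v n) Q).card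
      · obtain ⟨S, h1, h2, h3⟩ := embed_count (H n) lam (fun v => X v n) (s n) hn.1 (fun v => hX v n) l
          (hinj l hlF) Q (fun l' hl' => hlin l hlF l' (hQF (Finset.mem_insert_of_mem hl'))
            (fun h => hlQ (h ▸ hl'))) (insert l Q) (fun l' => Finset.mem_insert) c hc hn.2
        exact ⟨S, h1, fun _ => ⟨h2, h3⟩⟩
      · exact ⟨fun a => X (l a) n, fun _ => subset_rfl, fun h => absurd h hn⟩
    choose S hS1 hS2 using hstep
    obtain ⟨κ, hκ, hpos⟩ := hg l hlF (fun a n => S n a) (fun a n => hS1 n a) (fun a => by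
      refine ⟨c / 2 * c0, by positivity, ?_⟩
      filter_upwards [hsN, hs1, hcnt] with n h1 h2 h3
      have h4 := (hS2 n ⟨h2, h3⟩).1 a
      refine le_trans ?_ h4
      rw [mul_assoc]
      exact mul_le_mul_of_nonneg_left h1 (by positivity))
    refine ⟨c / 2 * κ, by positivity, ?_⟩
    filter_upwards [hs1, hsN2, hcnt, hpos] with n h2 h1 h3 h5
    have h4 := (hS2 n ⟨h2, h3⟩).2
    have hs0 : (0 : ℝ) < s n := by exact_mod_cast h2
    have hsq : (0 : ℝ) < (s n : ℝ) ^ (2 * m + 2) := by positivity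
    refine le_of_mul_le_mul_left (le_trans ?_ h4) hsq
    have h6 : (s n : ℝ) ^ (2 * m + 2) ≤ (N n : ℝ) ^ (2 * m + 2) :=
      pow_le_pow_left₀ hs0.le (by exact_mod_cast h1) _
    calc (s n : ℝ) ^ (2 * m + 2) * (c / 2 * κ * (s n : ℝ) ^ nF)
        = c / 2 * (s n : ℝ) ^ nF * (κ * (s n : ℝ) ^ (2 * m + 2)) := by ring
      _ ≤ c / 2 * (s n : ℝ) ^ nF * (κ * (N n : ℝ) ^ (2 * m + 2)) := by gcongr
      _ ≤ _ := mul_le_mul_of_nonneg_left h5 (by positivity)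

end

end

section

theorem TT_split {m : ℕ} (H : RGraph (m + 2)) (lam : Lab m → Fin (2 * m + 2))
    (hlam : Function.Injective lam)
    (I : Finset ℕ) (hI : 0 < I.card) (V : ℕ → Finset ℕ) (s : ℕ)
    (hV : ∀ i ∈ I, (V i).card = s) (blk : ℕ → ℕ) (hblk : ∀ i ∈ I, ∀ v ∈ V i, blk v = i)
    (hmono : ∀ u v, u ≤ v → blk u ≤ blk v) (T : ℝ) (hT : 0 ≤ T)
    (hT2 : ∀ τ : Lab m → ℕ, (∀ a, τ a ∈ I) → (∀ a b, lam a < lam b → τ a < τ b) →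
      ((TT H lam (fun a => V (τ a))).card : ℝ) ≤ T) :
    (I.biUnion V).card = I.card * s ∧
    ((TT H lam (fun _ => I.biUnion V)).card : ℝ) ≤
      ((2 * m + 2 : ℕ) : ℝ) ^ 2 * ((I.biUnion V).card : ℝ) ^ (2 * m + 2) / I.card +
        (I.card : ℝ) ^ (2 * m + 2) * T := by
  classical
  set U := I.biUnion V with hU
  have hfil : ∀ i ∈ I, U.filter (fun v => blk v = i) = V i := by
    intro i hi
    ext v
    simp only [hU, Finset.mem_filter, Finset.mem_biUnion]
    constructor
    · rintro ⟨⟨j, hj, hv⟩, hb⟩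
      rw [hblk j hj v hv] at hb
      exact hb ▸ hv
    · intro hv
      exact ⟨⟨i, hi, hv⟩, hblk i hi v hv⟩
  have hUc : U.card = I.card * s := by
    rw [hU, Finset.card_biUnion, Finset.sum_congr rfl hV, Finset.sum_const, smul_eq_mul]
    intro i hi j hj hij
    change Disjoint (V i) (V j)
    rw [Finset.disjoint_left]
    intro v hv hv'
    exact hij ((hblk i hi v hv).symm.trans (hblk j hj v hv'))
  refine ⟨hUc, ?_⟩
  have hbI : ∀ u ∈ U, blk u ∈ I ∧ u ∈ V (blk u) := by
    intro u hu
    obtain ⟨i, hi, hv⟩ := Finset.mem_biUnion.mp hu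
    rw [hblk i hi u hv]; exact ⟨hi, hv⟩
  have hI0 : (0 : ℝ) < I.card := by exact_mod_cast hI
  have hnc := noncross_tuples (α := Lab m) U blk I.card hI0.le (fun u hu => by
    rw [hfil _ (hbI u hu).1, hV _ (hbI u hu).1, hUc]; push_cast; rfl)
  rw [card_lab] at hnc
  set NC := (Fintype.piFinset (fun _ : Lab m => U)).filter
      (fun y => ¬ Function.Injective (fun a => blk (y a))) with hNC
  set CT := (Fintype.piFinset (fun _ : Lab m => I)).filter
      (fun τ => ∀ a b, lam a < lam b → τ a < τ b) with hCT
  have hsub : TT H lam (fun _ => U) ⊆ NC ∪ CT.biUnion (fun τ => TT H lam (fun a => V (τ a))) := by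
    intro y hy
    rw [mem_TT] at hy
    by_cases hinj : Function.Injective (fun a => blk (y a))
    · refine Finset.mem_union_right _ (Finset.mem_biUnion.mpr ⟨fun a => blk (y a), ?_, ?_⟩)
      · refine Finset.mem_filter.mpr ⟨Fintype.mem_piFinset.mpr fun a => (hbI _ (hy.1 a)).1, ?_⟩
        intro a b hab
        refine lt_of_le_of_ne (hmono _ _ (hy.2.1 a b hab).le) fun h => ?_
        have := hinj h
        rw [this] at hab
        exact lt_irrefl _ hab
      · rw [mem_TT]
        exact ⟨fun a => (hbI _ (hy.1 a)).2, hy.2⟩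
    · exact Finset.mem_union_left _ (Finset.mem_filter.mpr ⟨Fintype.mem_piFinset.mpr hy.1, hinj⟩)
  have h1 : (TT H lam (fun _ => U)).card ≤ NC.card + ∑ τ ∈ CT, (TT H lam (fun a => V (τ a))).card :=
    (Finset.card_le_card hsub).trans ((Finset.card_union_le _ _).trans
      (Nat.add_le_add_left Finset.card_biUnion_le _))
  have h2 : ((TT H lam (fun _ => U)).card : ℝ) ≤
      NC.card + ∑ τ ∈ CT, ((TT H lam (fun a => V (τ a))).card : ℝ) := by exact_mod_cast h1
  refine h2.trans (add_le_add ?_ ?_)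
  · rw [le_div_iff₀ hI0, mul_comm]; exact hnc
  · have h3 : ∑ τ ∈ CT, ((TT H lam (fun a => V (τ a))).card : ℝ) ≤ CT.card • T := by
      apply Finset.sum_le_card_nsmul
      intro τ hτ
      obtain ⟨h4, h5⟩ := Finset.mem_filter.mp hτ
      exact hT2 τ (Fintype.mem_piFinset.mp h4) h5
    refine h3.trans ?_
    rw [nsmul_eq_mul]
    refine mul_le_mul_of_nonneg_right ?_ hT
    have h6 : CT.card ≤ I.card ^ (2 * m + 2) := by
      refine (Finset.card_filter_le _ _).trans_eq ?_
      rw [Fintype.card_piFinset, Finset.prod_const, Finset.card_univ, card_lab]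
    exact_mod_cast h6

theorem compat_inj {m : ℕ} (lam : Lab m → Fin (2 * m + 2)) (hlam : Function.Injective lam)
    (τ : Lab m → ℕ) (h : ∀ a b, lam a < lam b → τ a < τ b) : Function.Injective τ := by
  intro a b hab
  by_contra hne
  rcases lt_or_gt_of_ne (fun h => hne (hlam h)) with h1 | h1
  · have := h _ _ h1; omega
  · have := h _ _ h1; omega

theorem compat_unique {m : ℕ} (lam : Lab m → Fin (2 * m + 2)) (hlam : Function.Injective lam)
    (t : Finset ℕ) (ht : t.card = 2 * m + 2) (τ τ' : Lab m → ℕ)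
    (h : ∀ a b, lam a < lam b → τ a < τ b) (h' : ∀ a b, lam a < lam b → τ' a < τ' b)
    (hτ : ∀ a, τ a ∈ t) (hτ' : ∀ a, τ' a ∈ t) : τ = τ' := by
  have hb : Function.Bijective lam :=
    (Fintype.bijective_iff_injective_and_card _).mpr ⟨hlam, by rw [card_lab, Fintype.card_fin]⟩
  let g := Equiv.ofBijective lam hb
  have hg : ∀ i, lam (g.symm i) = i := fun i => g.apply_symm_apply i
  have key : ∀ τ : Lab m → ℕ, (∀ a b, lam a < lam b → τ a < τ b) → (∀ a, τ a ∈ t) →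
      (fun i => τ (g.symm i)) = t.orderEmbOfFin ht := by
    intro τ h hτ
    apply Finset.orderEmbOfFin_unique ht (fun i => hτ _)
    intro i j hij
    exact h _ _ (by rw [hg, hg]; exact hij)
  have h1 := (key τ h hτ).trans (key τ' h' hτ').symm
  funext a
  have := congrFun h1 (g a)
  simpa using this

theorem block_large (U : Ultrafilter ℕ) (W : ℕ → Finset ℕ) (M : ℕ) (hM : 1 ≤ M)
    (hN : ∀ᶠ n in (U : Filter ℕ), M ≤ (W n).card) (i : ℕ) (hi : i < M) :
    Large U (fun n => (W n).card) (fun n => block (W n) ((W n).card / M) i) := by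
  have hM0 : (0 : ℝ) < M := by exact_mod_cast hM
  refine ⟨1 / (2 * M), by positivity, hN.mono fun n hn => ?_⟩
  set n1 := (W n).card / M with hn1
  have hn1a : 1 ≤ n1 := by rw [hn1, Nat.le_div_iff_mul_le (by omega)]; omega
  rw [card_block _ _ _ hn1a (by
      calc (i + 1) * n1 ≤ M * n1 := Nat.mul_le_mul_right _ (by omega)
        _ ≤ (W n).card := Nat.mul_div_le _ _)]
  have hn1b : (W n).card < (n1 + 1) * M := by
    have h1 := Nat.div_add_mod (W n).card M
    have h2 := Nat.mod_lt (W n).card (show 0 < M by omega)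
    rw [add_mul, one_mul, mul_comm, hn1]; omega
  have h1 : ((W n).card : ℝ) ≤ 2 * M * n1 := by
    have : (W n).card ≤ 2 * M * n1 := by nlinarith
    exact_mod_cast this
  rw [div_mul_eq_mul_div, one_mul, div_le_iff₀ (by positivity)]
  linarith

end

section

theorem num_contra (q : ℕ) (κ k c N w T : ℝ) (hκ : 0 < κ) (hk : 4 * (q : ℝ) ^ 2 / κ ≤ k) (hk1 : 1 ≤ k)
    (hc : 0 < c) (hN : 0 ≤ N) (hw : 0 < w) (hcN : c * N ≤ w)
    (hT : T = κ * c ^ q / (4 * k ^ q) * N ^ q)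
    (h : κ * w ^ q ≤ (q : ℝ) ^ 2 * w ^ q / k + k ^ q * T) : False := by
  have hk0 : 0 < k := by linarith
  have h1 : (q : ℝ) ^ 2 * w ^ q / k ≤ κ / 4 * w ^ q := by
    rw [div_le_iff₀ hκ] at hk
    rw [div_le_iff₀ hk0]
    have : 0 ≤ w ^ q := by positivity
    nlinarith
  have h2 : k ^ q * T ≤ κ / 4 * w ^ q := by
    have h3 : k ^ q * T = κ / 4 * (c * N) ^ q := by
      rw [hT, mul_pow]; field_simp
    rw [h3]
    exact mul_le_mul_of_nonneg_left (pow_le_pow_left₀ (by positivity) hcN q) (by positivity)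
  have h4 : 0 < κ * w ^ q := by positivity
  nlinarith

set_option maxHeartbeats 1000000 in
theorem upper (m : ℕ) (hm : 1 ≤ m) (nF : ℕ) (F : Finset (Lab m → Fin nF))
    (hinj : ∀ l ∈ F, Function.Injective l)
    (hlin : ∀ l ∈ F, ∀ l' ∈ F, l ≠ l' → ∀ a b a' b', l a = l' a' → l b = l' b' → a = b)
    (hord : ∀ σ : Sg m, ∃ o : Fin nF → Fin nF, Function.Injective o ∧
      ∀ l ∈ F, ∀ a b, σ.1 a < σ.1 b → o (l a) < o (l b))
    (ε : ℝ) (hε : 0 < ε) (H : ℕ → RGraph (m + 2)) (hH : LocallyDense H (piR (m + 2) + ε)) :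
    ∃ n, IsSubgraph (cfgGraph m nF F hinj) (H n) := by
  classical
  obtain ⟨e, he, he0, hN, hd⟩ := hH
  obtain ⟨κ0, hκ0, γ, hγ, n0, hlem⟩ := lemma1 m hm (ε / 2) (by linarith)
  set q := 2 * m + 2 with hq
  let U : Ultrafilter ℕ := Filter.hyperfilter ℕ
  have hU : (U : Filter ℕ) ≤ Filter.atTop := Nat.hyperfilter_le_atTop
  clear_value U
  set N : ℕ → ℕ := fun n => (H n).verts.card with hNdef
  have hNU : ∀ B : ℕ, ∀ᶠ n in (U : Filter ℕ), B ≤ N n :=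
    fun B => hU (hN.eventually_ge_atTop B)
  have heU : ∀ x : ℝ, 0 < x → ∀ᶠ n in (U : Filter ℕ), e n ≤ x :=
    fun x hx => hU (he0.eventually (eventually_le_nhds hx))
  set k := nF + ⌈4 * (q : ℝ) ^ 2 / κ0⌉₊ + 1 with hk
  have hkκ : 4 * (q : ℝ) ^ 2 / κ0 ≤ k := by
    refine (Nat.le_ceil _).trans ?_
    exact_mod_cast (by omega : ⌈4 * (q : ℝ) ^ 2 / κ0⌉₊ ≤ k)
  obtain ⟨M0, hM0⟩ := ramsey (κ := Set (Sg m)) q k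
  set M := max M0 1 with hM
  have hM1 : 1 ≤ M := le_max_right _ _
  obtain ⟨V1, hV1, hV1L, hmark⟩ := marking (U := U) (H := H) (N := N)
    (((Fintype.piFinset (fun _ : Lab m => Finset.range M)) ×ˢ
      (Finset.univ : Finset (Lab m → Fin (2 * m + 2)))).filter (fun p => Function.Injective p.1))
    (fun i n => block (H n).verts (N n / M) (if i < M then i else 0))
    (fun i => block_large U (fun n => (H n).verts) M hM1 (hNU M) _ (by split_ifs <;> omega))
    (fun p hp => (Finset.mem_filter.mp hp).2)
  obtain ⟨V2, s, hV2, hV2s, c0, hc0, hcs⟩ := trim V1 M hM1 hV1L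
  have hmark2 : ∀ (τ : Lab m → ℕ) (lam : Lab m → Fin (2 * m + 2)), Function.Injective τ →
      (∀ a, τ a < M) → Good U H N lam (fun a => V2 (τ a)) ∨ ¬ Pos U H N lam (fun a => V2 (τ a)) := by
    intro τ lam hτ hτM
    have := hmark (τ, lam) (Finset.mem_filter.mpr ⟨Finset.mem_product.mpr
      ⟨Fintype.mem_piFinset.mpr fun a => Finset.mem_range.mpr (hτM a), Finset.mem_univ _⟩, hτ⟩)
    rcases this with h | h
    · exact Or.inl (h.mono fun a n => hV2 _ n)
    · exact Or.inr fun h' => h (h'.mono fun a n => hV2 _ n)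
  have hV2b : ∀ i, i < M → ∀ n, ∀ v ∈ V2 i n, v ∈ (H n).verts ∧ rkk (H n).verts v / (N n / M) = i := by
    intro i hi n v hv
    have h1 := hV1 i n (hV2 i n hv)
    rw [if_pos hi] at h1
    exact Finset.mem_filter.mp h1
  have hs1 : ∀ᶠ n in (U : Filter ℕ), 1 ≤ s n := by
    filter_upwards [hcs, hNU 1] with n h1 h2
    have h3 : (1 : ℝ) ≤ N n := by exact_mod_cast h2
    have h4 : (0 : ℝ) < s n := lt_of_lt_of_le (by nlinarith) h1
    exact_mod_cast h4
  have hsN : ∀ n, s n ≤ N n := by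
    intro n
    rw [← hV2s 0 hM1 n]
    exact Finset.card_le_card fun v hv => (hV2b 0 hM1 n v hv).1
  let f : Finset ℕ → Set (Sg m) := fun t => {σ | ∀ τ : Lab m → ℕ, (∀ a, τ a ∈ t) →
    (∀ a b, σ.1 a < σ.1 b → τ a < τ b) → Good U H N σ.1 (fun a => V2 (τ a))}
  obtain ⟨I, hIM, hIk, col, hcol⟩ := hM0 (Finset.range M) (by
    rw [Finset.card_range]; exact le_max_left _ _) f
  have hIM' : ∀ i ∈ I, i < M := fun i hi => Finset.mem_range.mp (hIM hi)
  have himg : ∀ (σ : Sg m) (τ : Lab m → ℕ), (∀ a, τ a ∈ I) → (∀ a b, σ.1 a < σ.1 b → τ a < τ b) →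
      Finset.univ.image τ ⊆ I ∧ (Finset.univ.image τ).card = q := by
    intro σ τ h1 h2
    refine ⟨fun x hx => ?_, ?_⟩
    · obtain ⟨a, _, rfl⟩ := Finset.mem_image.mp hx
      exact h1 a
    · rw [Finset.card_image_of_injective _ (compat_inj σ.1 σ.2.1 τ h2), Finset.card_univ, card_lab]
  by_cases hne : col.Nonempty
  · obtain ⟨σ, hσ⟩ := hne
    have hgood : ∀ τ : Lab m → ℕ, (∀ a, τ a ∈ I) → (∀ a b, σ.1 a < σ.1 b → τ a < τ b) →
        Good U H N σ.1 (fun a => V2 (τ a)) := by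
      intro τ h1 h2
      obtain ⟨h3, h4⟩ := himg σ τ h1 h2
      have h5 : σ ∈ f (Finset.univ.image τ) := by rw [hcol _ h3 h4]; exact hσ
      exact h5 τ (fun a => Finset.mem_image_of_mem _ (Finset.mem_univ _)) h2
    obtain ⟨o, ho, ho2⟩ := hord σ
    let E := I.orderEmbOfFin hIk
    let P : Fin nF → ℕ := fun v => E (Fin.castLE (by omega) (o v))
    have hPI : ∀ v, P v ∈ I := fun v => Finset.orderEmbOfFin_mem _ _ _
    have hPinj : Function.Injective P := by
      intro v w h
      exact ho (Fin.castLE_injective _ (E.injective h))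
    have hPlt : ∀ v w, o v < o w → P v < P w := by
      intro v w h
      exact E.strictMono (Fin.lt_def.mpr h)
    obtain ⟨c, hc, hcnt⟩ := embed_all (U := U) (H := H) (N := N) (lam := σ.1) F hinj hlin
      (fun v => V2 (P v)) s (fun v n => hV2s _ (hIM' _ (hPI v)) n) c0 hc0 hcs hs1
      (Filter.Eventually.of_forall hsN)
      (fun l hl => hgood (fun a => P (l a)) (fun a => hPI _) (fun a b hab => hPlt _ _ (ho2 l hl a b hab)))
    obtain ⟨n, h1, h2⟩ := (hcnt.and hs1).exists
    refine ⟨n, (cfg_sub_iff m nF F hinj (H n)).mpr ?_⟩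
    have h3 : (0 : ℝ) < s n := by exact_mod_cast h2
    have h4 : (0 : ℝ) < (emb (H n) σ.1 (fun v => V2 (P v) n) F).card :=
      lt_of_lt_of_le (by positivity) h1
    have h5 : 0 < (emb (H n) σ.1 (fun v => V2 (P v) n) F).card := by exact_mod_cast h4
    obtain ⟨x, hx⟩ := Finset.card_pos.mp h5
    rw [mem_emb] at hx
    refine ⟨x, fun v w hvw => ?_, fun v => (hV2b _ (hIM' _ (hPI v)) n _ (hx.1 v)).1,
      fun l hl => (hx.2 l hl).2⟩
    have a1 := (hV2b _ (hIM' _ (hPI v)) n _ (hx.1 v)).2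
    have a2 := (hV2b _ (hIM' _ (hPI w)) n _ (hx.1 w)).2
    rw [hvw] at a1
    exact hPinj (a1.symm.trans a2)
  · exfalso
    rw [Set.not_nonempty_iff_eq_empty] at hne
    have hbad : ∀ (σ : Sg m) (τ : Lab m → ℕ), (∀ a, τ a ∈ I) → (∀ a b, σ.1 a < σ.1 b → τ a < τ b) →
        ¬ Pos U H N σ.1 (fun a => V2 (τ a)) := by
      intro σ τ h1 h2
      obtain ⟨h3, h4⟩ := himg σ τ h1 h2
      refine (hmark2 τ σ.1 (compat_inj σ.1 σ.2.1 τ h2) (fun a => hIM' _ (h1 a))).resolve_left fun hg => ?_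
      have h5 : σ ∉ f (Finset.univ.image τ) := by rw [hcol _ h3 h4, hne]; exact Set.notMem_empty _
      refine h5 fun τ' h6 h7 => ?_
      have : τ = τ' := compat_unique σ.1 σ.2.1 _ h4 τ τ' h2 h7
        (fun a => Finset.mem_image_of_mem _ (Finset.mem_univ _)) h6
      exact this ▸ hg
    have hk1 : (1 : ℝ) ≤ k := by exact_mod_cast (by omega : 1 ≤ k)
    obtain ⟨κ', hκ'⟩ : ∃ κ' : ℝ, κ' = κ0 * c0 ^ q / (4 * (k : ℝ) ^ q) := ⟨_, rfl⟩
    have hκ'0 : 0 < κ' := by rw [hκ']; positivity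
    have hev : ∀ᶠ n in (U : Filter ℕ), ∀ σ : Sg m, ∀ τ ∈ Fintype.piFinset (fun _ : Lab m => I),
        (∀ a b, σ.1 a < σ.1 b → τ a < τ b) →
        ((TT (H n) σ.1 (fun a => V2 (τ a) n)).card : ℝ) < κ' * (N n : ℝ) ^ (2 * m + 2) := by
      refine Filter.eventually_all.mpr fun σ => (Filter.eventually_all_finset _).mpr fun τ hτ => ?_
      by_cases h : ∀ a b, σ.1 a < σ.1 b → τ a < τ b
      · exact (not_pos (hbad σ τ (Fintype.mem_piFinset.mp hτ) h) κ' hκ'0).mono fun n hn _ => hn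
      · exact Filter.Eventually.of_forall fun n h' => absurd h' h
    obtain ⟨n, ⟨⟨⟨⟨h1, h2⟩, h3⟩, h4⟩, h5⟩, h6⟩ := (((((hev.and hs1).and hcs).and
      (heU (γ * c0) (by positivity))).and (heU (ε / 2) (by linarith))).and
      (hNU (⌈(n0 : ℝ) / c0⌉₊))).exists
    set W := I.biUnion (fun i => V2 i n) with hW
    have hsplit := fun σ : Sg m => TT_split (H n) σ.1 σ.2.1 I (by omega) (fun i => V2 i n) (s n)
      (fun i hi => hV2s i (hIM' i hi) n) (fun v => rkk (H n).verts v / (N n / M))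
      (fun i hi v hv => (hV2b i (hIM' i hi) n v hv).2)
      (fun u v h => Nat.div_le_div_right (rkk_mono _ h)) (κ' * (N n : ℝ) ^ (2 * m + 2)) (by positivity)
      (fun τ hτ hc => (h1 σ τ (Fintype.mem_piFinset.mpr hτ) hc).le)
    have hWv : W ⊆ (H n).verts := by
      intro v hv
      obtain ⟨i, hi, h⟩ := Finset.mem_biUnion.mp hv
      exact (hV2b i (hIM' i hi) n v h).1
    have hWc : W.card = k * s n := by
      obtain ⟨σ⟩ := Sg_nonempty m hm
      have := (hsplit σ).1
      rw [hIk] at this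
      exact this
    have hs0 : (0 : ℝ) < s n := by exact_mod_cast h2
    have hWs : (s n : ℝ) ≤ W.card := by
      rw [hWc]; push_cast; nlinarith
    have hcW : c0 * N n ≤ W.card := h3.trans hWs
    obtain ⟨σ, hσ⟩ := hlem (H n) W (by
      have h7 : (n0 : ℝ) / c0 ≤ N n := (Nat.le_ceil _).trans (by exact_mod_cast h6)
      rw [div_le_iff₀ hc0] at h7
      have : (n0 : ℝ) ≤ W.card := by linarith
      exact_mod_cast this) (by
      intro V' hV' hV'c
      have h8 := hd n V' (hV'.trans hWv) (by
        refine le_trans ?_ hV'c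
        have h9 : e n * N n ≤ γ * c0 * N n := mul_le_mul_of_nonneg_right h4 (by positivity)
        have h10 : γ * (c0 * N n) ≤ γ * W.card := mul_le_mul_of_nonneg_left hcW hγ.le
        change e n * N n ≤ _
        linarith)
      refine le_trans (mul_le_mul_of_nonneg_right ?_ (by positivity)) h8
      linarith)
    have hfin := (hsplit σ).2
    rw [hIk] at hfin
    refine num_contra q κ0 k c0 (N n) W.card (κ' * (N n : ℝ) ^ (2 * m + 2)) hκ0 hkκ hk1 hc0
      (by positivity) (by linarith) hcW (by rw [hκ']) (hσ.trans ?_)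
    exact hfin

/-- Main result in terms of `m = r - 2`. -/
theorem main_m (m : ℕ) (hm : 1 ≤ m) :
    ∃ F : RGraph (m + 2),
      (∃ H : ℕ → RGraph (m + 2), LocallyDense H (piR (m + 2)) ∧ ∀ n, ¬ IsSubgraph F (H n)) ∧
      ∀ ε : ℝ, 0 < ε →
        ¬ ∃ H : ℕ → RGraph (m + 2), LocallyDense H (piR (m + 2) + ε) ∧ ∀ n, ¬ IsSubgraph F (H n) := by
  obtain ⟨nF, F, hinj, hlin, hc, hord⟩ := exists_config m hm
  refine ⟨cfgGraph m nF F hinj, ?_, ?_⟩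
  · have h := fun n : ℕ => low_dense (m + 2) (by omega) (1 / ((n : ℝ) + 1)) (by positivity) n
    choose p J h1 h2 using h
    refine ⟨fun n => lowGraph (m + 2) (p n) (J n), ⟨fun n => 1 / ((n : ℝ) + 1), fun n => by positivity,
      tendsto_one_div_add_atTop_nhds_zero_nat, ?_, h2⟩, fun n => low_free m nF F hinj hc _ _⟩
    exact Filter.tendsto_atTop_mono h1 Filter.tendsto_id
  · rintro ε hε ⟨H, hH, hfree⟩
    obtain ⟨n, hn⟩ := upper m hm nF F hinj hlin hord ε hε H hH
    exact hfree n hn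

end

/-- For every r ≥ 3 there is an r-graph F with uniform Turán density
`C(r,2) ^ (-C(r,2))`. -/
theorem exists_rgraph_uniform_turan_density_piR (r : ℕ) (hr : 3 ≤ r) :
    ∃ F : RGraph r,
      (∃ H : ℕ → RGraph r, LocallyDense H (piR r) ∧ ∀ n, ¬ IsSubgraph F (H n)) ∧
      ∀ ε : ℝ, 0 < ε →
        ¬ ∃ H : ℕ → RGraph r, LocallyDense H (piR r + ε) ∧ ∀ n, ¬ IsSubgraph F (H n) := by
  obtain ⟨m, rfl⟩ : ∃ m, r = m + 2 := ⟨r - 2, by omega⟩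
  exact main_m m (by omega)

end UTD
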